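/- The propositional admissible rules of each of IZF_R, CZF_ER, ECST and BCST are exactly those of IPC: for T any of these theories, ⊢~_T = ⊢~_IPC on propositional formulas. -/

import Mathlib

set_option autoImplicit false
set_option linter.unusedVariables false

/-! ## Propositional formulas, intuitionistic and classical propositional logic -/

/-- Formulas of propositional logic, with countably many propositional letters. -/
inductive PropForm : Type
  | var : ℕ → PropForm
  | bot : PropForm
  | top : PropForm
  | and : PropForm → PropForm → PropForm
  | or : PropForm → PropForm → PropForm
  | imp : PropForm → PropForm → PropForm

namespace PropForm
/-- Negation is defined, as usual, by `¬A := A → ⊥`. -/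
def neg (A : PropForm) : PropForm := A.imp .bot
end PropForm

/-- Substitution of propositional formulas for propositional letters;
it commutes with `⊥`, `⊤` and the connectives. -/
def substProp (s : ℕ → PropForm) : PropForm → PropForm
  | .var n => s n
  | .bot => .bot
  | .top => .top
  | .and A B => .and (substProp s A) (substProp s B)
  | .or A B => .or (substProp s A) (substProp s B)
  | .imp A B => .imp (substProp s A) (substProp s B)

/-- Natural deduction for (intuitionistic) propositional logic, with an additional
set `Ax` of axioms (so that classical logic is obtained by adding excluded middle). -/
inductive PropProv (Ax : Set PropForm) : Set PropForm → PropForm → Prop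
  | hyp {Γ : Set PropForm} {A} : A ∈ Γ → PropProv Ax Γ A
  | axm {Γ : Set PropForm} {A} : A ∈ Ax → PropProv Ax Γ A
  | topI {Γ : Set PropForm} : PropProv Ax Γ .top
  | botE {Γ : Set PropForm} {A : PropForm} : PropProv Ax Γ .bot → PropProv Ax Γ A
  | andI {Γ : Set PropForm} {A B : PropForm} : PropProv Ax Γ A → PropProv Ax Γ B → PropProv Ax Γ (A.and B)
  | andE1 {Γ : Set PropForm} {A B : PropForm} : PropProv Ax Γ (A.and B) → PropProv Ax Γ A
  | andE2 {Γ : Set PropForm} {A B : PropForm} : PropProv Ax Γ (A.and B) → PropProv Ax Γ B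
  | orI1 {Γ : Set PropForm} {A B : PropForm} : PropProv Ax Γ A → PropProv Ax Γ (A.or B)
  | orI2 {Γ : Set PropForm} {A B : PropForm} : PropProv Ax Γ B → PropProv Ax Γ (A.or B)
  | orE {Γ : Set PropForm} {A B C : PropForm} : PropProv Ax Γ (A.or B) → PropProv Ax (insert A Γ) C →
      PropProv Ax (insert B Γ) C → PropProv Ax Γ C
  | impI {Γ : Set PropForm} {A B : PropForm} : PropProv Ax (insert A Γ) B → PropProv Ax Γ (A.imp B)
  | impE {Γ : Set PropForm} {A B : PropForm} : PropProv Ax Γ (A.imp B) → PropProv Ax Γ A → PropProv Ax Γ B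

/-- The instances of the law of excluded middle. -/
def emAxioms : Set PropForm := {A | ∃ B : PropForm, A = B.or B.neg}

/-- Derivability in intuitionistic propositional logic `IPC`. -/
def IPCProv : Set PropForm → PropForm → Prop := PropProv ∅

/-- Derivability in classical propositional logic `CPC` (adding excluded middle). -/
def CPCProv : Set PropForm → PropForm → Prop := PropProv emAxioms

/-- The theorems of `IPC`. -/
def IPCThms : Set PropForm := {A | IPCProv ∅ A}

/-- The theorems of `CPC`. -/
def CPCThms : Set PropForm := {A | CPCProv ∅ A}

/-- The rule `A / B` is admissible in `IPC`. -/
def AdmIPC (A B : PropForm) : Prop :=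
  ∀ s : ℕ → PropForm, substProp s A ∈ IPCThms → substProp s B ∈ IPCThms

/-- Admissibility of the rule `A / B` in a propositional logic given as its set of theorems. -/
def AdmInLogic (L : Set PropForm) (A B : PropForm) : Prop :=
  ∀ s : ℕ → PropForm, substProp s A ∈ L → substProp s B ∈ L

/-- A propositional logic: a set of theorems closed under modus ponens and substitution. -/
structure PropLogic where
  thms : Set PropForm
  mp_closed : ∀ {A B : PropForm}, A.imp B ∈ thms → A ∈ thms → B ∈ thms
  subst_closed : ∀ (s : ℕ → PropForm) {A : PropForm}, A ∈ thms → substProp s A ∈ thms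

/-- An intermediate propositional logic: `IPC ⊆ J ⊆ CPC`. -/
def PropLogic.Intermediate (J : PropLogic) : Prop := IPCThms ⊆ J.thms ∧ J.thms ⊆ CPCThms

/-! ### Visser's rules -/

def bigAnd (l : List PropForm) : PropForm := l.foldr .and .top
def bigOr (l : List PropForm) : PropForm := l.foldr .or .bot

/-- The antecedent `⋀_{i=1}^n (A_i → B_i)` of Visser's rule `V_n`. -/
def visserAnte (n : ℕ) (A : Fin (n+2) → PropForm) (B : Fin n → PropForm) : PropForm :=
  bigAnd (List.ofFn fun i : Fin n => (A (i.castLE (by omega))).imp (B i))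

/-- The premise `(⋀_{i=1}^n (A_i → B_i) → (A_{n+1} ∨ A_{n+2})) ∨ C` of Visser's rule `V_n`. -/
def visserPrem (n : ℕ) (A : Fin (n+2) → PropForm) (B : Fin n → PropForm) (C : PropForm) :
    PropForm :=
  ((visserAnte n A B).imp ((A ⟨n, by omega⟩).or (A ⟨n+1, by omega⟩))).or C

/-- The conclusion `⋁_{j=1}^{n+2} (⋀_{i=1}^n (A_i → B_i) → A_j) ∨ C` of Visser's rule `V_n`. -/
def visserConc (n : ℕ) (A : Fin (n+2) → PropForm) (B : Fin n → PropForm) (C : PropForm) :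
    PropForm :=
  (bigOr (List.ofFn fun j : Fin (n+2) => (visserAnte n A B).imp (A j))).or C

/-! ## The language of set theory and Kripke models of set theory -/

/-- Formulas in the language of set theory: a binary membership relation `∈`,
equality `=`, and the intuitionistic connectives and quantifiers
(`¬A` is defined as `A → ⊥`); variables are represented by natural numbers. -/
inductive ZFForm : Type
  | mem : ℕ → ℕ → ZFForm
  | eq : ℕ → ℕ → ZFForm
  | bot : ZFForm
  | top : ZFForm
  | and : ZFForm → ZFForm → ZFForm
  | or : ZFForm → ZFForm → ZFForm
  | imp : ZFForm → ZFForm → ZFForm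
  | all : ℕ → ZFForm → ZFForm
  | ex : ℕ → ZFForm → ZFForm

namespace ZFForm

/-- Negation: `¬A := A → ⊥`. -/
def neg (A : ZFForm) : ZFForm := A.imp .bot

/-- Biconditional: `A ↔ B := (A → B) ∧ (B → A)`. -/
def biimp (A B : ZFForm) : ZFForm := (A.imp B).and (B.imp A)

/-- The free variables of a set-theoretic formula. -/
def FV : ZFForm → Finset ℕ
  | .mem i j => {i, j}
  | .eq i j => {i, j}
  | .bot => ∅
  | .top => ∅
  | .and A B => A.FV ∪ B.FV
  | .or A B => A.FV ∪ B.FV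
  | .imp A B => A.FV ∪ B.FV
  | .all x A => A.FV.erase x
  | .ex x A => A.FV.erase x

/-- A sentence is a formula without free variables. -/
def IsSentence (A : ZFForm) : Prop := A.FV = ∅

end ZFForm

/-- A Kripke model for set theory: a partial order `(K, ≤)` of worlds, a (nonempty) domain
`Dom v` for every world, transition functions `tr : Dom v → Dom w` for `v ≤ w` (functorial),
and interpretations `mem v` of the membership relation that are preserved by the transition
functions; equality is interpreted as actual equality of domain elements. -/
structure SetKripkeModel where
  World : Type
  le : World → World → Prop
  le_refl : ∀ w, le w w
  le_trans : ∀ {u v w}, le u v → le v w → le u w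
  le_antisymm : ∀ {u v}, le u v → le v u → u = v
  Dom : World → Type
  dne : ∀ w, Nonempty (Dom w)
  tr : ∀ {v w}, le v w → Dom v → Dom w
  tr_refl : ∀ (v) (h : le v v) (x : Dom v), tr h x = x
  tr_trans : ∀ {u v w} (h1 : le u v) (h2 : le v w) (h3 : le u w) (x : Dom u),
      tr h2 (tr h1 x) = tr h3 x
  mem : ∀ w, Dom w → Dom w → Prop
  mem_mono : ∀ {v w} (h : le v w) (x y : Dom v), mem v x y → mem w (tr h x) (tr h y)

/-- The forcing relation of a Kripke model of set theory. -/
def zforce (M : SetKripkeModel) : ZFForm → (v : M.World) → (ℕ → M.Dom v) → Prop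
  | .mem i j, v, ρ => M.mem v (ρ i) (ρ j)
  | .eq i j, v, ρ => ρ i = ρ j
  | .bot, _, _ => False
  | .top, _, _ => True
  | .and A B, v, ρ => zforce M A v ρ ∧ zforce M B v ρ
  | .or A B, v, ρ => zforce M A v ρ ∨ zforce M B v ρ
  | .imp A B, v, ρ => ∀ (w : M.World) (h : M.le v w),
      zforce M A w (fun n => M.tr h (ρ n)) → zforce M B w (fun n => M.tr h (ρ n))
  | .all x A, v, ρ => ∀ (w : M.World) (h : M.le v w) (d : M.Dom w),
      zforce M A w (Function.update (fun n => M.tr h (ρ n)) x d)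
  | .ex x A, v, ρ => ∃ d : M.Dom v, zforce M A v (Function.update ρ x d)

/-- `M ⊩ φ`: the formula is forced at every world (under every assignment). -/
def Forces (M : SetKripkeModel) (φ : ZFForm) : Prop :=
  ∀ (v : M.World) (ρ : ℕ → M.Dom v), zforce M φ v ρ

/-- The data needed to extend a Kripke model of set theory with a new root `r` below all
worlds: a domain for the root, a membership relation on it, and transition functions to the
old domains, compatibly with the old transition functions and preserving membership.
The resulting model `E.toModel` is based on the frame `K⁺` and restricts to `M` on `K`. -/
structure RootExtension (M : SetKripkeModel) where
  RDom : Type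
  rdne : Nonempty RDom
  rmem : RDom → RDom → Prop
  rtr : (v : M.World) → RDom → M.Dom v
  rtr_compat : ∀ {v w : M.World} (h : M.le v w) (x : RDom), M.tr h (rtr v x) = rtr w x
  rmem_mono : ∀ (v : M.World) (x y : RDom), rmem x y → M.mem v (rtr v x) (rtr v y)

namespace RootExtension

variable {M : SetKripkeModel}

/-- The order on `K⁺ = K ∪ {r}`; `none` is the new root `r`. -/
def optLe (M : SetKripkeModel) : Option M.World → Option M.World → Prop
  | none, _ => True
  | some _, none => False
  | some v, some w => M.le v w

/-- The domains of the extended model. -/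
def Dom' (E : RootExtension M) : Option M.World → Type
  | none => E.RDom
  | some v => M.Dom v

/-- The transition functions of the extended model. -/
def tr' (E : RootExtension M) :
    ∀ {a b : Option M.World}, optLe M a b → E.Dom' a → E.Dom' b
  | none, none, _, x => x
  | none, some v, _, x => E.rtr v x
  | some _, none, h, _ => h.elim
  | some _, some _, h, x => M.tr h x

/-- The membership relations of the extended model. -/
def mem' (E : RootExtension M) : (a : Option M.World) → E.Dom' a → E.Dom' a → Prop
  | none => E.rmem
  | some v => M.mem v

/-- The extended model `M⁺`, based on the frame `K⁺` obtained by adding a new root,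
which restricts to `M` on `K`. -/
def toModel (E : RootExtension M) : SetKripkeModel where
  World := Option M.World
  le := optLe M
  le_refl := fun a => by cases a with
    | none => trivial
    | some v => exact M.le_refl v
  le_trans := by
    intro a b c h1 h2
    cases a with
    | none => trivial
    | some v =>
      cases b with
      | none => exact h1.elim
      | some w =>
        cases c with
        | none => exact h2.elim
        | some u => exact M.le_trans h1 h2
  le_antisymm := by
    intro a b h1 h2
    cases a with
    | none =>
      cases b with
      | none => rfl
      | some w => exact h2.elim
    | some v =>
      cases b with
      | none => exact h1.elim
      | some w => exact congrArg some (M.le_antisymm h1 h2)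
  Dom := E.Dom'
  dne := fun a => by cases a with
    | none => exact E.rdne
    | some v => exact M.dne v
  tr := fun {a b} h x => E.tr' h x
  tr_refl := by
    intro a h x
    cases a with
    | none => rfl
    | some v => exact M.tr_refl v h x
  tr_trans := by
    intro a b c h1 h2 h3 x
    cases a with
    | none =>
      cases b with
      | none =>
        cases c with
        | none => rfl
        | some u => rfl
      | some w =>
        cases c with
        | none => exact h2.elim
        | some u => exact E.rtr_compat h2 x
    | some v =>
      cases b with
      | none => exact h1.elim
      | some w =>
        cases c with
        | none => exact h2.elim
        | some u => exact M.tr_trans h1 h2 h3 x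
  mem := E.mem'
  mem_mono := by
    intro a b h x y hxy
    cases a with
    | none =>
      cases b with
      | none => exact hxy
      | some w => exact E.rmem_mono w x y hxy
    | some v =>
      cases b with
      | none => exact h.elim
      | some w => exact M.mem_mono h x y hxy

end RootExtension

/-- `Δ` is `Γ`-extensible: every Kripke model of set theory forcing `Γ ∪ Δ` can be extended,
by adding a new root, to a model (based on the extended frame and restricting to the original
model) that forces `Δ`. -/
def GammaExtensible (Γ Δ : Set ZFForm) : Prop :=
  ∀ M : SetKripkeModel, (∀ φ ∈ Γ ∪ Δ, Forces M φ) →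
    ∃ E : RootExtension M, ∀ φ ∈ Δ, Forces E.toModel φ

/-- `Δ` is extensible: it is `∅`-extensible. -/
def Extensible (Δ : Set ZFForm) : Prop := GammaExtensible ∅ Δ

/-! ## Renaming of variables and bounded formulas -/

namespace ZFForm

/-- Rename the free occurrences of the variable `x` to `y`. -/
def renameFree (x y : ℕ) : ZFForm → ZFForm
  | .mem i j => .mem (if i = x then y else i) (if j = x then y else j)
  | .eq i j => .eq (if i = x then y else i) (if j = x then y else j)
  | .bot => .bot
  | .top => .top
  | .and A B => .and (A.renameFree x y) (B.renameFree x y)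
  | .or A B => .or (A.renameFree x y) (B.renameFree x y)
  | .imp A B => .imp (A.renameFree x y) (B.renameFree x y)
  | .all z A => if z = x then .all z A else .all z (A.renameFree x y)
  | .ex z A => if z = x then .ex z A else .ex z (A.renameFree x y)

/-- `y` is free for (substitutable for) `x`: no free occurrence of `x` lies in the scope of a
quantifier binding `y`. -/
def freeFor (y x : ℕ) : ZFForm → Prop
  | .mem _ _ => True
  | .eq _ _ => True
  | .bot => True
  | .top => True
  | .and A B => freeFor y x A ∧ freeFor y x B
  | .or A B => freeFor y x A ∧ freeFor y x B
  | .imp A B => freeFor y x A ∧ freeFor y x B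
  | .all z A => x ∉ (ZFForm.all z A).FV ∨ (y ≠ z ∧ freeFor y x A)
  | .ex z A => x ∉ (ZFForm.ex z A).FV ∨ (y ≠ z ∧ freeFor y x A)

end ZFForm

/-- The `Δ₀` (bounded) formulas: all quantifiers are bounded. -/
inductive IsDelta0 : ZFForm → Prop
  | mem (i j : ℕ) : IsDelta0 (.mem i j)
  | eq (i j : ℕ) : IsDelta0 (.eq i j)
  | bot : IsDelta0 .bot
  | top : IsDelta0 .top
  | and {A B : ZFForm} : IsDelta0 A → IsDelta0 B → IsDelta0 (A.and B)
  | or {A B : ZFForm} : IsDelta0 A → IsDelta0 B → IsDelta0 (A.or B)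
  | imp {A B : ZFForm} : IsDelta0 A → IsDelta0 B → IsDelta0 (A.imp B)
  | ball {x y : ℕ} {A : ZFForm} : x ≠ y → IsDelta0 A →
      IsDelta0 (.all x ((ZFForm.mem x y).imp A))
  | bex {x y : ℕ} {A : ZFForm} : x ≠ y → IsDelta0 A →
      IsDelta0 (.ex x ((ZFForm.mem x y).and A))

/-! ## The axioms of constructive set theories -/

namespace ZFAxioms
open ZFForm

/-- Extensionality: `∀x ∀y (x = y ↔ ∀z (z ∈ x ↔ z ∈ y))`. -/
def extAx : ZFForm :=
  .all 0 (.all 1 ((ZFForm.eq 0 1).biimp (.all 2 ((ZFForm.mem 2 0).biimp (.mem 2 1)))))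

/-- Empty set: `∃x ∀y (y ∉ x)`. -/
def empAx : ZFForm := .ex 0 (.all 1 (ZFForm.mem 1 0).neg)

/-- Pairing: `∀x ∀y ∃z ∀w (w ∈ z ↔ (w = x ∨ w = y))`. -/
def pairAx : ZFForm :=
  .all 0 (.all 1 (.ex 2 (.all 3 ((ZFForm.mem 3 2).biimp ((ZFForm.eq 3 0).or (.eq 3 1))))))

/-- Union: `∀x ∃y ∀z (z ∈ y ↔ ∃w (w ∈ x ∧ z ∈ w))`. -/
def unionAx : ZFForm :=
  .all 0 (.ex 1 (.all 2 ((ZFForm.mem 2 1).biimp (.ex 3 ((ZFForm.mem 3 0).and (.mem 2 3))))))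

/-- Power set: `∀x ∃y ∀w (w ∈ y ↔ w ⊆ x)`. -/
def powAx : ZFForm :=
  .all 0 (.ex 1 (.all 2 ((ZFForm.mem 2 1).biimp (.all 3 ((ZFForm.mem 3 2).imp (.mem 3 0))))))

/-- An instance of separation for `φ` (with distinguished variable `x₂`, the separated set
being `x₁`, separating from `x₀`): `∀x ∃y ∀z (z ∈ y ↔ (z ∈ x ∧ φ(z)))`. -/
def sepAx (φ : ZFForm) : ZFForm :=
  .all 0 (.ex 1 (.all 2 ((ZFForm.mem 2 1).biimp ((ZFForm.mem 2 0).and φ))))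

/-- The separation scheme. -/
def sepScheme : Set ZFForm := {A | ∃ φ : ZFForm, 1 ∉ φ.FV ∧ A = sepAx φ}

/-- The bounded (`Δ₀`) separation scheme. -/
def d0sepScheme : Set ZFForm := {A | ∃ φ : ZFForm, IsDelta0 φ ∧ 1 ∉ φ.FV ∧ A = sepAx φ}

/-- An instance of `∈`-induction for `φ` (with distinguished variable `x₀`):
`(∀x ((∀y ∈ x φ(y)) → φ(x))) → ∀x φ(x)`. -/
def indAx (φ : ZFForm) : ZFForm :=
  (ZFForm.all 0 ((ZFForm.all 1 ((ZFForm.mem 1 0).imp (φ.renameFree 0 1))).imp φ)).imp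
    (.all 0 φ)

/-- The `∈`-induction scheme. -/
def indScheme : Set ZFForm :=
  {A | ∃ φ : ZFForm, 1 ∉ φ.FV ∧ φ.freeFor 1 0 ∧ A = indAx φ}

/-- An instance of replacement for `φ` (with input variable `x₁` and output variable `x₂`):
`∀x ((∀y ∈ x ∃!z φ(y,z)) → ∃w ∀y ∈ x ∃z ∈ w φ(y,z))`. -/
def replAx (φ : ZFForm) : ZFForm :=
  .all 0 ((ZFForm.all 1 ((ZFForm.mem 1 0).imp
      (.ex 2 (φ.and (.all 4 ((φ.renameFree 2 4).imp (.eq 4 2))))))).imp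
    (.ex 3 (.all 1 ((ZFForm.mem 1 0).imp (.ex 2 ((ZFForm.mem 2 3).and φ))))))

/-- The replacement scheme. -/
def replScheme : Set ZFForm :=
  {A | ∃ φ : ZFForm, 3 ∉ φ.FV ∧ 4 ∉ φ.FV ∧ φ.freeFor 4 2 ∧ A = replAx φ}

/-- `∅ ∈ x`. -/
def emptyIn (x : ℕ) : ZFForm :=
  .ex 10 ((ZFForm.mem 10 x).and (.all 11 (ZFForm.mem 11 10).neg))

/-- `y ∪ {y} ∈ x`. -/
def succIn (y x : ℕ) : ZFForm :=
  .ex 12 ((ZFForm.mem 12 x).and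
    (.all 13 ((ZFForm.mem 13 12).biimp ((ZFForm.mem 13 y).or (.eq 13 y)))))

/-- `x` is inductive: `∅ ∈ x ∧ ∀y (y ∈ x → y ∪ {y} ∈ x)`. -/
def inductiveF (x : ℕ) : ZFForm :=
  (emptyIn x).and (.all 14 ((ZFForm.mem 14 x).imp (succIn 14 x)))

/-- Infinity: `∃x (∅ ∈ x ∧ ∀y (y ∈ x → y ∪ {y} ∈ x))`. -/
def infAx : ZFForm := .ex 0 (inductiveF 0)

/-- Strong infinity: there is a least inductive set. -/
def strongInfAx : ZFForm :=
  .ex 0 ((inductiveF 0).and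
    (.all 15 ((inductiveF 15).imp (.all 16 ((ZFForm.mem 16 0).imp (.mem 16 15))))))

/-- `q = {u}`. -/
def singEq (q u : ℕ) : ZFForm := .all 8 ((ZFForm.mem 8 q).biimp (.eq 8 u))

/-- `q = {u, v}`. -/
def pairEq (q u v : ℕ) : ZFForm :=
  .all 8 ((ZFForm.mem 8 q).biimp ((ZFForm.eq 8 u).or (.eq 8 v)))

/-- `p` is the (Kuratowski) ordered pair `⟨u, v⟩`. -/
def isOPair (p u v : ℕ) : ZFForm :=
  .all 7 ((ZFForm.mem 7 p).biimp ((singEq 7 u).or (pairEq 7 u v)))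

/-- `f` is a function from `a` to `b`. -/
def isFunc (f a b : ℕ) : ZFForm :=
  (ZFForm.all 4 ((ZFForm.mem 4 f).imp
      (.ex 5 (.ex 6 (((ZFForm.mem 5 a).and (.mem 6 b)).and (isOPair 4 5 6)))))).and
  (.all 5 ((ZFForm.mem 5 a).imp
      (.ex 6 ((ZFForm.mem 6 b).and
        ((ZFForm.ex 4 ((ZFForm.mem 4 f).and (isOPair 4 5 6))).and
          (.all 9 ((ZFForm.ex 4 ((ZFForm.mem 4 f).and (isOPair 4 5 9))).imp (.eq 9 6))))))))

/-- Exponentiation: `∀x ∀y ∃z ∀w (w ∈ z ↔ w is a function x → y)`. -/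
def expAx : ZFForm :=
  .all 0 (.all 1 (.ex 2 (.all 3 ((ZFForm.mem 3 2).biimp (isFunc 3 0 1)))))

/-- `IZF_R`: `IZF` with replacement instead of collection, i.e. extensionality, empty set,
union, pairing, infinity, separation, `∈`-induction, replacement and power set. -/
def IZF_R : Set ZFForm :=
  {extAx, empAx, unionAx, pairAx, infAx, powAx} ∪ sepScheme ∪ indScheme ∪ replScheme

/-- `CZF_ER`: `CZF` with exponentiation and replacement instead of strong collection and
subset collection, i.e. extensionality, empty set, union, pairing, strong infinity, bounded
separation, `∈`-induction, exponentiation and replacement. -/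
def CZF_ER : Set ZFForm :=
  {extAx, empAx, unionAx, pairAx, strongInfAx, expAx} ∪ d0sepScheme ∪ indScheme ∪ replScheme

/-- `ECST`: elementary constructive set theory, i.e. extensionality, empty set, pairing,
union, strong infinity, bounded separation and replacement. -/
def ECST : Set ZFForm :=
  {extAx, empAx, pairAx, unionAx, strongInfAx} ∪ d0sepScheme ∪ replScheme

/-- `BCST`: basic constructive set theory, i.e. extensionality, empty set, union, pairing,
replacement and bounded separation. -/
def BCST : Set ZFForm :=
  {extAx, empAx, unionAx, pairAx} ∪ d0sepScheme ∪ replScheme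

end ZFAxioms

/-! ## Provability for set theories, over intuitionistic first-order logic with equality -/

/-- Hilbert-style derivability in intuitionistic first-order logic (in the language of set
theory) from the set of axioms `Ax`, with modus ponens and generalisation. -/
inductive ZFProv (Ax : Set ZFForm) : ZFForm → Prop
  | axm {A : ZFForm} : A ∈ Ax → ZFProv Ax A
  | k {A B : ZFForm} : ZFProv Ax (A.imp (B.imp A))
  | s {A B C : ZFForm} : ZFProv Ax ((A.imp (B.imp C)).imp ((A.imp B).imp (A.imp C)))
  | andI {A B : ZFForm} : ZFProv Ax (A.imp (B.imp (A.and B)))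
  | andE1 {A B : ZFForm} : ZFProv Ax ((A.and B).imp A)
  | andE2 {A B : ZFForm} : ZFProv Ax ((A.and B).imp B)
  | orI1 {A B : ZFForm} : ZFProv Ax (A.imp (A.or B))
  | orI2 {A B : ZFForm} : ZFProv Ax (B.imp (A.or B))
  | orE {A B C : ZFForm} : ZFProv Ax ((A.imp C).imp ((B.imp C).imp ((A.or B).imp C)))
  | botE {A : ZFForm} : ZFProv Ax (ZFForm.bot.imp A)
  | topI : ZFProv Ax .top
  | allE {x y : ℕ} {A : ZFForm} : A.freeFor y x →
      ZFProv Ax ((ZFForm.all x A).imp (A.renameFree x y))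
  | exI {x y : ℕ} {A : ZFForm} : A.freeFor y x →
      ZFProv Ax ((A.renameFree x y).imp (.ex x A))
  | allShift {x : ℕ} {A B : ZFForm} : x ∉ A.FV →
      ZFProv Ax ((ZFForm.all x (A.imp B)).imp (A.imp (.all x B)))
  | exShift {x : ℕ} {A B : ZFForm} : x ∉ B.FV →
      ZFProv Ax ((ZFForm.all x (A.imp B)).imp ((ZFForm.ex x A).imp B))
  | mp {A B : ZFForm} : ZFProv Ax (A.imp B) → ZFProv Ax A → ZFProv Ax B
  | gen {x : ℕ} {A : ZFForm} : ZFProv Ax A → ZFProv Ax (.all x A)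

/-- The axioms of equality in the language of set theory. -/
def zfEqAxioms : Set ZFForm :=
  {A | (∃ i, A = ZFForm.eq i i) ∨
       (∃ i j, A = (ZFForm.eq i j).imp (.eq j i)) ∨
       (∃ i j k, A = (ZFForm.eq i j).imp ((ZFForm.eq j k).imp (.eq i k))) ∨
       (∃ i j k, A = (ZFForm.eq i j).imp ((ZFForm.mem i k).imp (.mem j k))) ∨
       (∃ i j k, A = (ZFForm.eq i j).imp ((ZFForm.mem k i).imp (.mem k j)))}

/-- `T ⊢ φ`: provability in the set theory `T` over intuitionistic first-order logic
with equality. -/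
def thyProv (T : Set ZFForm) (φ : ZFForm) : Prop := ZFProv (T ∪ zfEqAxioms) φ

/-! ## Propositional substitutions into the language of set theory -/

/-- Substitution of set-theoretic formulas for propositional letters. -/
def substZ (s : ℕ → ZFForm) : PropForm → ZFForm
  | .var n => s n
  | .bot => .bot
  | .top => .top
  | .and A B => (substZ s A).and (substZ s B)
  | .or A B => (substZ s A).or (substZ s B)
  | .imp A B => (substZ s A).imp (substZ s B)

/-- The propositional logic `L(T)` of a set theory with provability predicate `Pr`:
all propositional formulas `A` with `Pr (σ(A))` for every substitution `σ` of set-theoretic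
sentences for the propositional letters. -/
def LofPr (Pr : ZFForm → Prop) : Set PropForm :=
  {A | ∀ s : ℕ → ZFForm, (∀ n, (s n).IsSentence) → Pr (substZ s A)}

/-- The propositional rule `A / B` is admissible in a set theory: for every substitution of
set-theoretic sentences for the propositional letters, provability of `σ(A)` implies
provability of `σ(B)`. -/
def AdmZ (Pr : ZFForm → Prop) (A B : PropForm) : Prop :=
  ∀ s : ℕ → ZFForm, (∀ n, (s n).IsSentence) → Pr (substZ s A) → Pr (substZ s B)


/-! ## Deductively closed sets of propositional formulas -/

namespace PropProv

theorem mono {Ax : Set PropForm} {Γ Δ : Set PropForm} {A : PropForm}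
    (h : PropProv Ax Γ A) (hs : Γ ⊆ Δ) : PropProv Ax Δ A := by
  induction h generalizing Δ with
  | hyp h => exact .hyp (hs h)
  | axm h => exact .axm h
  | topI => exact .topI
  | botE _ ih => exact .botE (ih hs)
  | andI _ _ ih1 ih2 => exact .andI (ih1 hs) (ih2 hs)
  | andE1 _ ih => exact .andE1 (ih hs)
  | andE2 _ ih => exact .andE2 (ih hs)
  | orI1 _ ih => exact .orI1 (ih hs)
  | orI2 _ ih => exact .orI2 (ih hs)
  | orE _ _ _ ih ih1 ih2 =>
    exact .orE (ih hs) (ih1 (Set.insert_subset_insert hs)) (ih2 (Set.insert_subset_insert hs))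
  | impI _ ih => exact .impI (ih (Set.insert_subset_insert hs))
  | impE _ _ ih1 ih2 => exact .impE (ih1 hs) (ih2 hs)

theorem hyp0 {Ax Γ : Set PropForm} {A : PropForm} : PropProv Ax (insert A Γ) A :=
  .hyp (Set.mem_insert _ _)

theorem hyp1 {Ax Γ : Set PropForm} {A B : PropForm} : PropProv Ax (insert B (insert A Γ)) A :=
  .hyp (Set.mem_insert_of_mem _ (Set.mem_insert _ _))

theorem hyp2 {Ax Γ : Set PropForm} {A B C : PropForm} :
    PropProv Ax (insert C (insert B (insert A Γ))) A :=
  .hyp (Set.mem_insert_of_mem _ (Set.mem_insert_of_mem _ (Set.mem_insert _ _)))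

end PropProv

/-- A set of propositional formulas that contains `IPC` and is closed under modus ponens. -/
structure IsIPCTheory (Θ : Set PropForm) : Prop where
  ipc : ∀ {A : PropForm}, IPCProv ∅ A → A ∈ Θ
  mp : ∀ {A B : PropForm}, A.imp B ∈ Θ → A ∈ Θ → B ∈ Θ

theorem isIPCTheory_IPCThms : IsIPCTheory IPCThms := ⟨fun h => h, fun h1 h2 => .impE h1 h2⟩

namespace IsIPCTheory

variable {Θ : Set PropForm}

theorem relativize (h : IsIPCTheory Θ) (A : PropForm) : IsIPCTheory {E | A.imp E ∈ Θ} where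
  ipc hE := h.ipc (.impI (hE.mono (Set.empty_subset _)))
  mp {B C} h1 h2 := by
    have : IPCProv ∅ ((A.imp (B.imp C)).imp ((A.imp B).imp (A.imp C))) :=
      .impI (.impI (.impI (.impE (.impE .hyp2 .hyp0) (.impE .hyp1 .hyp0))))
    exact h.mp (h.mp (h.ipc this) h1) h2

theorem subset_relativize (h : IsIPCTheory Θ) (A : PropForm) : Θ ⊆ {E | A.imp E ∈ Θ} :=
  fun _ hE => h.mp (h.ipc (.impI (.impI .hyp1))) hE

theorem mem_relativize (h : IsIPCTheory Θ) (A : PropForm) : A ∈ {E | A.imp E ∈ Θ} :=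
  h.ipc (.impI .hyp0)

theorem closed {Γ : Set PropForm} {D : PropForm} (hD : PropProv ∅ Γ D) :
    ∀ {Θ : Set PropForm}, IsIPCTheory Θ → Γ ⊆ Θ → D ∈ Θ := by
  induction hD with
  | hyp h => exact fun _ hs => hs h
  | axm h => exact h.elim
  | topI => exact fun hT _ => hT.ipc .topI
  | botE _ ih => exact fun hT hs => hT.mp (hT.ipc (.impI (.botE .hyp0))) (ih hT hs)
  | andI _ _ ih1 ih2 =>
    exact fun hT hs => hT.mp (hT.mp (hT.ipc (.impI (.impI (.andI .hyp1 .hyp0)))) (ih1 hT hs))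
      (ih2 hT hs)
  | andE1 _ ih => exact fun hT hs => hT.mp (hT.ipc (.impI (.andE1 .hyp0))) (ih hT hs)
  | andE2 _ ih => exact fun hT hs => hT.mp (hT.ipc (.impI (.andE2 .hyp0))) (ih hT hs)
  | orI1 _ ih => exact fun hT hs => hT.mp (hT.ipc (.impI (.orI1 .hyp0))) (ih hT hs)
  | orI2 _ ih => exact fun hT hs => hT.mp (hT.ipc (.impI (.orI2 .hyp0))) (ih hT hs)
  | @orE Γ A B C _ _ _ ih ih1 ih2 =>
    intro Θ hT hs
    have h1 : C ∈ {E | A.imp E ∈ Θ} := ih1 (hT.relativize A)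
      (Set.insert_subset (hT.mem_relativize A) (hs.trans (hT.subset_relativize A)))
    have h2 : C ∈ {E | B.imp E ∈ Θ} := ih2 (hT.relativize B)
      (Set.insert_subset (hT.mem_relativize B) (hs.trans (hT.subset_relativize B)))
    have key : IPCProv ∅ ((A.imp C).imp ((B.imp C).imp ((A.or B).imp C))) :=
      .impI (.impI (.impI (.orE .hyp0
        (.impE (.hyp (by simp)) .hyp0) (.impE (.hyp (by simp)) .hyp0))))
    exact hT.mp (hT.mp (hT.mp (hT.ipc key) h1) h2) (ih hT hs)
  | @impI Γ A B _ ih =>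
    intro Θ hT hs
    exact ih (hT.relativize A)
      (Set.insert_subset (hT.mem_relativize A) (hs.trans (hT.subset_relativize A)))
  | impE _ _ ih1 ih2 => exact fun hT hs => hT.mp (ih1 hT hs) (ih2 hT hs)

theorem and_mem (h : IsIPCTheory Θ) {A B : PropForm} : A.and B ∈ Θ ↔ A ∈ Θ ∧ B ∈ Θ :=
  ⟨fun hAB => ⟨closed (.andE1 .hyp0) h (Set.insert_subset hAB (Set.empty_subset _)),
    closed (.andE2 .hyp0) h (Set.insert_subset hAB (Set.empty_subset _))⟩,
   fun ⟨hA, hB⟩ => closed (.andI .hyp0 .hyp1) h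
    (Set.insert_subset hA (Set.insert_subset hB (Set.empty_subset _)))⟩

theorem bigAnd_mem (h : IsIPCTheory Θ) {l : List PropForm} :
    bigAnd l ∈ Θ ↔ ∀ A ∈ l, A ∈ Θ := by
  induction l with
  | nil => simpa [bigAnd] using h.ipc .topI
  | cons A l ih =>
    have : bigAnd (A :: l) = A.and (bigAnd l) := rfl
    rw [this, h.and_mem, ih]; simp

theorem bigOr_mem (h : IsIPCTheory Θ) {l : List PropForm} {A : PropForm} (hA : A ∈ l)
    (hAT : A ∈ Θ) : bigOr l ∈ Θ := by
  induction l with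
  | nil => simp at hA
  | cons B l ih =>
    have e : bigOr (B :: l) = B.or (bigOr l) := rfl
    rw [e]
    rcases List.mem_cons.1 hA with rfl | hA
    · exact h.mp (h.ipc (.impI (.orI1 .hyp0))) hAT
    · exact h.mp (h.ipc (.impI (.orI2 .hyp0))) (ih hA)

theorem imp_bigOr_elim (h : IsIPCTheory Θ) {l : List PropForm} {C : PropForm}
    (hl : ∀ A ∈ l, A.imp C ∈ Θ) : (bigOr l).imp C ∈ Θ := by
  induction l with
  | nil => exact h.ipc (.impI (.botE .hyp0))
  | cons B l ih =>
    have h1 : B.imp C ∈ Θ := hl B (by simp)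
    have h2 : (bigOr l).imp C ∈ Θ := ih fun A hA => hl A (by simp [hA])
    exact closed (Γ := {B.imp C, (bigOr l).imp C}) (D := (B.or (bigOr l)).imp C)
      (.impI (.orE .hyp0 (.impE (.hyp (by simp)) .hyp0) (.impE (.hyp (by simp)) .hyp0))) h
      (by rintro x (rfl | rfl) <;> assumption)

end IsIPCTheory

/-! ## Types over a finite set of formulas -/

open Classical in
/-- The formula stating that the formulas of `Σ` that hold are not exactly those in `t`. -/
noncomputable def notExactly (F t : Finset PropForm) : PropForm :=
  (bigAnd t.toList).imp (bigOr (F \ t).toList)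

/-- The subsets of `F` that are compatible with `Θ`. -/
def thyTypes (Θ : Set PropForm) (F : Finset PropForm) : Set (Finset PropForm) :=
  {t | t ⊆ F ∧ notExactly F t ∉ Θ}

/-- A finite set of formulas closed under subformulas. -/
structure SubClosed (F : Finset PropForm) : Prop where
  and : ∀ {A B : PropForm}, A.and B ∈ F → A ∈ F ∧ B ∈ F
  or : ∀ {A B : PropForm}, A.or B ∈ F → A ∈ F ∧ B ∈ F
  imp : ∀ {A B : PropForm}, A.imp B ∈ F → A ∈ F ∧ B ∈ F

theorem exists_subClosed (A : PropForm) : ∃ F : Finset PropForm, SubClosed F ∧ A ∈ F := by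
  classical
  have bin : ∀ (C A B : PropForm), (∀ D E, C = PropForm.and D E → D = A ∧ E = B) →
      (∀ D E, C = PropForm.or D E → D = A ∧ E = B) →
      (∀ D E, C = PropForm.imp D E → D = A ∧ E = B) →
      (∃ F : Finset PropForm, SubClosed F ∧ A ∈ F) →
      (∃ F : Finset PropForm, SubClosed F ∧ B ∈ F) →
      ∃ F : Finset PropForm, SubClosed F ∧ C ∈ F := by
    rintro C A B h1 h2 h3 ⟨F, hF, hA⟩ ⟨G, hG, hB⟩
    refine ⟨insert C (F ∪ G), ⟨?_, ?_, ?_⟩, by simp⟩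
    · intro D E h
      simp only [Finset.mem_insert, Finset.mem_union] at h ⊢
      rcases h with h | h | h
      · obtain ⟨rfl, rfl⟩ := h1 D E h.symm; simp [hA, hB]
      · have := hF.and h; simp [this]
      · have := hG.and h; simp [this]
    · intro D E h
      simp only [Finset.mem_insert, Finset.mem_union] at h ⊢
      rcases h with h | h | h
      · obtain ⟨rfl, rfl⟩ := h2 D E h.symm; simp [hA, hB]
      · have := hF.or h; simp [this]
      · have := hG.or h; simp [this]
    · intro D E h
      simp only [Finset.mem_insert, Finset.mem_union] at h ⊢
      rcases h with h | h | h
      · obtain ⟨rfl, rfl⟩ := h3 D E h.symm; simp [hA, hB]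
      · have := hF.imp h; simp [this]
      · have := hG.imp h; simp [this]
  induction A with
  | var n => exact ⟨{.var n}, ⟨by simp, by simp, by simp⟩, by simp⟩
  | bot => exact ⟨{.bot}, ⟨by simp, by simp, by simp⟩, by simp⟩
  | top => exact ⟨{.top}, ⟨by simp, by simp, by simp⟩, by simp⟩
  | and A B ih1 ih2 =>
    exact bin _ A B (by rintro _ _ ⟨⟩; simp) (by rintro _ _ ⟨⟩) (by rintro _ _ ⟨⟩) ih1 ih2
  | or A B ih1 ih2 =>
    exact bin _ A B (by rintro _ _ ⟨⟩) (by rintro _ _ ⟨⟩; simp) (by rintro _ _ ⟨⟩) ih1 ih2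
  | imp A B ih1 ih2 =>
    exact bin _ A B (by rintro _ _ ⟨⟩) (by rintro _ _ ⟨⟩) (by rintro _ _ ⟨⟩; simp) ih1 ih2

section Types

variable {Θ : Set PropForm} {F t : Finset PropForm}

theorem mem_of_mem_thyTypes (hΘ : IsIPCTheory Θ) (ht : t ∈ thyTypes Θ F) {D : PropForm}
    (hD : (bigAnd t.toList).imp D ∈ Θ) (hDF : D ∈ F) : D ∈ t := by
  classical
  by_contra hDt
  exact ht.2 ((hΘ.relativize _).bigOr_mem (A := D) (by simp [hDF, hDt]) hD)

theorem imp_mem_of_mem (hΘ : IsIPCTheory Θ) {D : PropForm} (hD : D ∈ t) :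
    (bigAnd t.toList).imp D ∈ Θ :=
  ((hΘ.relativize _).bigAnd_mem.1 (hΘ.mem_relativize _)) D (by simpa using hD)

theorem mem_iff_of_mem_thyTypes (hΘ : IsIPCTheory Θ) (ht : t ∈ thyTypes Θ F) {D : PropForm}
    (hDF : D ∈ F) : D ∈ t ↔ (bigAnd t.toList).imp D ∈ Θ :=
  ⟨imp_mem_of_mem hΘ, fun h => mem_of_mem_thyTypes hΘ ht h hDF⟩

theorem notExactly_notMem_of_prime (hΘ : IsIPCTheory Θ) (hbot : PropForm.bot ∉ Θ)
    (hor : ∀ A B, PropForm.or A B ∈ Θ → A ∈ Θ ∨ B ∈ Θ)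
    (ht : ∀ D ∈ F, D ∈ t ↔ D ∈ Θ) (htF : t ⊆ F) : notExactly F t ∉ Θ := by
  classical
  intro h
  have h1 := hΘ.mp h (hΘ.bigAnd_mem.2 fun A hA => by
    have hA : A ∈ t := by simpa using hA
    exact (ht A (htF hA)).1 hA)
  have : ∀ l : List PropForm, bigOr l ∈ Θ → ∃ A ∈ l, A ∈ Θ := by
    intro l
    induction l with
    | nil => exact fun h => (hbot h).elim
    | cons B l ih =>
      intro h
      rcases hor _ _ h with h | h
      · exact ⟨B, by simp, h⟩
      · obtain ⟨A, hA, h⟩ := ih h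
        exact ⟨A, by simp [hA], h⟩
  obtain ⟨A, hA, hAT⟩ := this _ h1
  simp only [Finset.mem_toList, Finset.mem_sdiff] at hA
  exact hA.2 ((ht A hA.1).2 hAT)

/-- Lindenbaum's lemma inside the finite set `F`. -/
theorem exists_type_extending (hΘ : IsIPCTheory Θ) {E : PropForm} {t₀ : Finset PropForm}
    (h₀ : t₀ ⊆ F) (hE : (bigAnd t₀.toList).imp E ∉ Θ) :
    ∃ t ∈ thyTypes Θ F, t₀ ⊆ t ∧ E ∉ t := by
  classical
  let S := F.powerset.filter fun t => t₀ ⊆ t ∧ (bigAnd t.toList).imp E ∉ Θ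
  obtain ⟨t, htS, hmax⟩ := S.exists_maximal ⟨t₀, by simp [S, h₀, hE]⟩
  simp only [S, Finset.mem_filter, Finset.mem_powerset] at htS hmax
  obtain ⟨htF, ht0, htE⟩ := htS
  refine ⟨t, ⟨htF, fun hne => htE ?_⟩, ht0, fun h => htE (imp_mem_of_mem hΘ h)⟩
  have hT := hΘ.relativize (bigAnd t.toList)
  refine hT.mp (hT.imp_bigOr_elim fun D hD => ?_) hne
  simp only [Finset.mem_toList, Finset.mem_sdiff] at hD
  by_contra hcon
  have h1 : (bigAnd (insert D t).toList).imp E ∉ Θ := fun h => hcon <| by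
    have h2 := hT.subset_relativize D (hΘ.subset_relativize _ h)
    refine (hT.relativize D).mp h2 ((hT.relativize D).bigAnd_mem.2 fun A hA => ?_)
    rcases Finset.mem_insert.1 (Finset.mem_toList.1 hA) with rfl | hA
    · exact hT.mem_relativize A
    · exact hT.subset_relativize D (imp_mem_of_mem hΘ hA)
  have := hmax ⟨Finset.insert_subset hD.1 htF, ht0.trans (Finset.subset_insert _ _), h1⟩
    (Finset.subset_insert _ _)
  exact hD.2 (this (Finset.mem_insert_self _ _))

end Types

/-! ## Kripke semantics and finite completeness for `IPC` -/

/-- Forcing of propositional formulas in a Kripke frame. -/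
def pforce {K : Type*} [Preorder K] (val : K → ℕ → Prop) : PropForm → K → Prop
  | .var n, k => val k n
  | .bot, _ => False
  | .top, _ => True
  | .and A B, k => pforce val A k ∧ pforce val B k
  | .or A B, k => pforce val A k ∨ pforce val B k
  | .imp A B, k => ∀ k' ≥ k, pforce val A k' → pforce val B k'

section Kripke

variable {K : Type*} [Preorder K] {val : K → ℕ → Prop}

theorem pforce_mono (hv : ∀ k k' n, k ≤ k' → val k n → val k' n) (A : PropForm) {k k' : K}
    (h : k ≤ k') (hA : pforce val A k) : pforce val A k' := by
  induction A with
  | var n => exact hv _ _ n h hA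
  | bot => exact hA
  | top => trivial
  | and A B ih1 ih2 => exact ⟨ih1 hA.1, ih2 hA.2⟩
  | or A B ih1 ih2 => exact hA.imp ih1 ih2
  | imp A B _ _ => exact fun k'' hk => hA k'' (h.trans hk)

theorem pforce_congr_cone {val' : K → ℕ → Prop} (A : PropForm) {k : K}
    (h : ∀ k' ≥ k, ∀ n, val k' n ↔ val' k' n) : pforce val A k ↔ pforce val' A k := by
  induction A generalizing k with
  | var n => exact h k le_rfl n
  | bot => rfl
  | top => rfl
  | and A B ih1 ih2 => exact and_congr (ih1 h) (ih2 h)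
  | or A B ih1 ih2 => exact or_congr (ih1 h) (ih2 h)
  | imp A B ih1 ih2 =>
    refine forall₂_congr fun k' hk => ?_
    rw [ih1 fun k'' h' => h k'' (hk.le.trans h'), ih2 fun k'' h' => h k'' (hk.le.trans h')]

theorem pforce_substProp (s : ℕ → PropForm) (A : PropForm) (k : K) :
    pforce val (substProp s A) k ↔ pforce (fun k n => pforce val (s n) k) A k := by
  induction A generalizing k with
  | var n => rfl
  | bot => rfl
  | top => rfl
  | and A B ih1 ih2 => exact and_congr (ih1 k) (ih2 k)
  | or A B ih1 ih2 => exact or_congr (ih1 k) (ih2 k)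
  | imp A B ih1 ih2 =>
    simp only [substProp, pforce, ih1, ih2]

theorem pforce_bigAnd {l : List PropForm} {k : K} :
    pforce val (bigAnd l) k ↔ ∀ A ∈ l, pforce val A k := by
  induction l with
  | nil => simp [bigAnd, pforce]
  | cons A l ih =>
    have : bigAnd (A :: l) = A.and (bigAnd l) := rfl
    rw [this]; simp [pforce, ih]

theorem pforce_bigOr {l : List PropForm} {k : K} :
    pforce val (bigOr l) k ↔ ∃ A ∈ l, pforce val A k := by
  induction l with
  | nil => simp [bigOr, pforce]
  | cons A l ih =>
    have : bigOr (A :: l) = A.or (bigOr l) := rfl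
    rw [this]; simp [pforce, ih]

end Kripke

/-- Completeness of `IPC` with respect to finite partially ordered Kripke models. -/
theorem exists_finite_countermodel {C : PropForm} (hC : ¬ IPCProv ∅ C) :
    ∃ (K : Type) (_ : PartialOrder K) (_ : Finite K) (val : K → ℕ → Prop),
      (∀ k k' n, k ≤ k' → val k n → val k' n) ∧ ∃ k, ¬ pforce val C k := by
  classical
  obtain ⟨F, hF, hCF⟩ := exists_subClosed C
  have hΘ := isIPCTheory_IPCThms
  let K := {t : Finset PropForm // t ∈ thyTypes IPCThms F}
  let val : K → ℕ → Prop := fun t n => PropForm.var n ∈ t.1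
  have hfin : Finite K := by
    refine Finite.of_injective (β := F.powerset) (fun t => ⟨t.1, by simpa using t.2.1⟩) ?_
    intro t t' h
    exact Subtype.ext (by simpa using h)
  have truth : ∀ A ∈ F, ∀ t : K, pforce val A t ↔ A ∈ t.1 := by
    intro A
    induction A with
    | var n => exact fun _ t => Iff.rfl
    | bot =>
      refine fun hA t => ⟨fun h => h.elim, fun h => t.2.2 ?_⟩
      have h1 := imp_mem_of_mem hΘ h
      exact (hΘ.relativize _).mp ((hΘ.relativize _).ipc (.impI (.botE .hyp0))) h1
    | top =>
      exact fun hA t => ⟨fun _ => mem_of_mem_thyTypes hΘ t.2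
        ((hΘ.relativize _).ipc .topI) hA, fun _ => trivial⟩
    | and A B ih1 ih2 =>
      intro hA t
      have h := hF.and hA
      have := (hΘ.relativize (bigAnd t.1.toList)).and_mem (A := A) (B := B)
      simp only [Set.mem_ofPred_eq] at this
      rw [mem_iff_of_mem_thyTypes hΘ t.2 hA, this, ← mem_iff_of_mem_thyTypes hΘ t.2 h.1,
        ← mem_iff_of_mem_thyTypes hΘ t.2 h.2, ← ih1 h.1, ← ih2 h.2]
      rfl
    | or A B ih1 ih2 =>
      intro hA t
      have h := hF.or hA
      have hT := hΘ.relativize (bigAnd t.1.toList)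
      simp only [pforce, ih1 h.1, ih2 h.2]
      constructor
      · rintro (h' | h')
        · exact mem_of_mem_thyTypes hΘ t.2
            (hT.mp (hT.ipc (.impI (.orI1 .hyp0))) (imp_mem_of_mem hΘ h')) hA
        · exact mem_of_mem_thyTypes hΘ t.2
            (hT.mp (hT.ipc (.impI (.orI2 .hyp0))) (imp_mem_of_mem hΘ h')) hA
      · intro h'
        by_contra hcon
        push Not at hcon
        refine t.2.2 (hT.mp ?_ (imp_mem_of_mem hΘ h'))
        have hsub : ∀ D ∈ F, D ∉ t.1 → D ∈ (F \ t.1).toList := by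
          intro D h1 h2; simp [h1, h2]
        have key : ∀ D ∈ F, D ∉ t.1 → IPCProv ∅ (D.imp (bigOr (F \ t.1).toList)) := fun D h1 h2 =>
          (hΘ.relativize D).bigOr_mem (hsub D h1 h2) (hΘ.mem_relativize D)
        exact hT.ipc (.impI (.orE .hyp0
          (.impE ((key A h.1 hcon.1).mono (Set.empty_subset _)) .hyp0)
          (.impE ((key B h.2 hcon.2).mono (Set.empty_subset _)) .hyp0)))
    | imp A B ih1 ih2 =>
      intro hA t
      have h := hF.imp hA
      constructor
      · intro hf
        by_contra hcon
        have hn : (bigAnd (insert A t.1).toList).imp B ∉ IPCThms := fun hp => hcon <| by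
          refine mem_of_mem_thyTypes hΘ t.2 ?_ hA
          have hT := hΘ.relativize (bigAnd t.1.toList)
          refine (hT.relativize A).mp (A := bigAnd (insert A t.1).toList)
            (hT.subset_relativize A (hΘ.subset_relativize _ hp)) ?_
          refine (hT.relativize A).bigAnd_mem.2 fun D hD => ?_
          rcases Finset.mem_insert.1 (Finset.mem_toList.1 hD) with rfl | hD
          · exact hT.mem_relativize D
          · exact hT.subset_relativize A (imp_mem_of_mem hΘ hD)
        obtain ⟨t', ht', hsub, hB⟩ := exists_type_extending hΘ
          (Finset.insert_subset h.1 t.2.1) hn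
        refine hB ((ih2 h.2 ⟨t', ht'⟩).1 (hf ⟨t', ht'⟩ ?_ ?_))
        · exact (Finset.subset_insert _ _).trans hsub
        · exact (ih1 h.1 _).2 (hsub (Finset.mem_insert_self _ _))
      · intro hAt t' htt' hAf
        refine (ih2 h.2 t').2 (mem_of_mem_thyTypes hΘ t'.2 ?_ h.2)
        exact (hΘ.relativize _).mp (imp_mem_of_mem hΘ (htt' hAt))
          (imp_mem_of_mem hΘ ((ih1 h.1 t').1 hAf))
  obtain ⟨t, ht, -, hCt⟩ := exists_type_extending (F := F) (t₀ := ∅) (E := C) hΘ (by simp)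
    (fun h => hC (hΘ.mp h (by simpa [bigAnd] using hΘ.ipc .topI)))
  exact ⟨K, inferInstance, hfin, val, fun k k' n h hn => h hn, ⟨t, ht⟩,
    fun h => hCt ((truth C hCF ⟨t, ht⟩).1 h)⟩

/-! ## Projective approximation: rules admissible in `IPC` preserve extensible theories -/

open Classical in
/-- The formula stating that at all worlds above the types over `F` belong to `W`. -/
noncomputable def onlyTypes (F : Finset PropForm) (W : Set (Finset PropForm)) : PropForm :=
  bigAnd ((F.powerset.filter (· ∉ W)).toList.map (notExactly F))

open Classical in
/-- The substitution that forces the atomic part of the type `t` outside of `P`. -/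
noncomputable def typeSubst (P : PropForm) (t : Finset PropForm) (n : ℕ) : PropForm :=
  if PropForm.var n ∈ t then P.imp (.var n) else P.and (.var n)

/-- The composition of the substitutions `typeSubst P t` for `t` in a list. -/
noncomputable def typeSubstList (P : PropForm) : List (Finset PropForm) → ℕ → PropForm
  | [] => .var
  | t :: L => fun n => substProp (typeSubst P t) (typeSubstList P L n)

section Projective

variable {K : Type*} [Preorder K]

open Classical in
/-- The type of a world: the set of formulas in `F` that are forced. -/
noncomputable def worldType (F : Finset PropForm) (val : K → ℕ → Prop) (k : K) :
    Finset PropForm := F.filter fun D => pforce val D k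

/-- A world is good if all types above it belong to `W`. -/
def GoodWorld (F : Finset PropForm) (W : Set (Finset PropForm)) (val : K → ℕ → Prop) (k : K) :
    Prop := ∀ k' ≥ k, worldType F val k' ∈ W

open Classical in
/-- The types of the good worlds above `k`. -/
noncomputable def goodTypes (F : Finset PropForm) (W : Set (Finset PropForm))
    (val : K → ℕ → Prop) (k : K) : Finset (Finset PropForm) :=
  F.powerset.filter fun t => ∃ k' ≥ k, GoodWorld F W val k' ∧ worldType F val k' = t

variable {F : Finset PropForm} {W : Set (Finset PropForm)} {val val' val'' : K → ℕ → Prop}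

theorem mem_worldType {k : K} {D : PropForm} :
    D ∈ worldType F val k ↔ D ∈ F ∧ pforce val D k := by
  classical
  simp [worldType]

theorem pforce_notExactly {t : Finset PropForm} (ht : t ⊆ F) {k : K} :
    pforce val (notExactly F t) k ↔ ∀ k' ≥ k, worldType F val k' ≠ t := by
  classical
  refine forall₂_congr fun k' _ => ?_
  rw [pforce_bigAnd, pforce_bigOr]
  constructor
  · intro h heq
    obtain ⟨A, hA, hf⟩ := h fun A hA => by
      rw [Finset.mem_toList, ← heq, mem_worldType] at hA
      exact hA.2
    simp only [Finset.mem_toList, Finset.mem_sdiff, ← heq, mem_worldType] at hA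
    exact hA.2 ⟨hA.1, hf⟩
  · intro hne hall
    by_contra hcon
    push Not at hcon
    refine hne (Finset.ext fun D => ?_)
    rw [mem_worldType]
    constructor
    · rintro ⟨hD, hf⟩
      by_contra hDt
      exact hcon D (by simp [hD, hDt]) hf
    · exact fun hD => ⟨ht hD, hall D (by simpa using hD)⟩

theorem pforce_onlyTypes {k : K} : pforce val (onlyTypes F W) k ↔ GoodWorld F W val k := by
  classical
  simp only [onlyTypes, pforce_bigAnd, List.mem_map, Finset.mem_toList, Finset.mem_filter,
    Finset.mem_powerset, forall_exists_index, and_imp]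
  constructor
  · intro h k' hk'
    by_contra hW
    have hs : worldType F val k' ⊆ F := Finset.filter_subset _ _
    exact (pforce_notExactly hs).1 (h _ _ hs hW rfl) k' hk' rfl
  · rintro h _ t ht hW rfl
    exact (pforce_notExactly ht).2 fun k' hk' he => hW (he ▸ h k' hk')

theorem GoodWorld.mono {k k' : K} (h : GoodWorld F W val k) (hk : k ≤ k') :
    GoodWorld F W val k' := fun _ h' => h _ (hk.trans h')

/-- `val'` is a monotone valuation that agrees with `val` at the good worlds. -/
def AgreesOnGood (F : Finset PropForm) (W : Set (Finset PropForm)) (val val' : K → ℕ → Prop) :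
    Prop :=
  (∀ k k' n, k ≤ k' → val' k n → val' k' n) ∧
    ∀ k, GoodWorld F W val k → ∀ n, val k n ↔ val' k n

theorem AgreesOnGood.pforce_iff (h : AgreesOnGood F W val val') {k : K}
    (hk : GoodWorld F W val k) (A : PropForm) : pforce val A k ↔ pforce val' A k :=
  pforce_congr_cone A fun k' hk' => h.2 k' (hk.mono hk')

theorem AgreesOnGood.worldType_eq (h : AgreesOnGood F W val val') {k : K}
    (hk : GoodWorld F W val k) : worldType F val k = worldType F val' k := by
  ext D
  rw [mem_worldType, mem_worldType, h.pforce_iff hk]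

theorem AgreesOnGood.good (h : AgreesOnGood F W val val') {k : K}
    (hk : GoodWorld F W val k) : GoodWorld F W val' k := fun k' hk' => by
  rw [← h.worldType_eq (hk.mono hk')]; exact hk k' hk'

theorem AgreesOnGood.trans (h : AgreesOnGood F W val val') (h' : AgreesOnGood F W val' val'') :
    AgreesOnGood F W val val'' :=
  ⟨h'.1, fun k hk n => (h.2 k hk n).trans (h'.2 k (h.good hk) n)⟩

theorem AgreesOnGood.goodTypes_subset (h : AgreesOnGood F W val val') (k : K) :
    goodTypes F W val k ⊆ goodTypes F W val' k := by
  classical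
  intro t ht
  simp only [goodTypes, Finset.mem_filter] at ht ⊢
  obtain ⟨h1, k', hk', hg, rfl⟩ := ht
  exact ⟨h1, k', hk', h.good hg, (h.worldType_eq hg).symm⟩

theorem goodTypes_anti {k k' : K} (h : k ≤ k') :
    goodTypes F W val k' ⊆ goodTypes F W val k := by
  classical
  intro t ht
  simp only [goodTypes, Finset.mem_filter] at ht ⊢
  obtain ⟨h1, k'', hk', hg, rfl⟩ := ht
  exact ⟨h1, k'', h.trans hk', hg, rfl⟩

theorem goodTypes_subset {k : K} {t : Finset PropForm} (ht : t ∈ goodTypes F W val k) :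
    t ∈ W := by
  classical
  simp only [goodTypes, Finset.mem_filter] at ht
  obtain ⟨h1, k'', hk', hg, rfl⟩ := ht
  exact hg _ le_rfl

theorem worldType_mem_goodTypes {k k' : K} (hk : k ≤ k') (hg : GoodWorld F W val k') :
    worldType F val k' ∈ goodTypes F W val k := by
  classical
  simp only [goodTypes, Finset.mem_filter, Finset.mem_powerset]
  exact ⟨Finset.filter_subset _ _, k', hk, hg, rfl⟩

/-- The valuation obtained by a substitution. -/
def substVal (s : ℕ → PropForm) (val : K → ℕ → Prop) (k : K) (n : ℕ) : Prop := pforce val (s n) k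

theorem substVal_mono (s : ℕ → PropForm) (hv : ∀ k k' n, k ≤ k' → val k n → val k' n) :
    ∀ k k' n, k ≤ k' → substVal s val k n → substVal s val k' n :=
  fun _ _ n h => pforce_mono hv (s n) h

theorem substVal_typeSubst (hv : ∀ k k' n, k ≤ k' → val k n → val k' n)
    (t : Finset PropForm) (k : K) (n : ℕ) :
    substVal (typeSubst (onlyTypes F W) t) val k n ↔
      (GoodWorld F W val k ∨ PropForm.var n ∈ t) ∧
        ∀ k' ≥ k, GoodWorld F W val k' → val k' n := by
  classical
  unfold substVal typeSubst
  split_ifs with h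
  · simp only [pforce, pforce_onlyTypes, h, or_true, true_and]
  · simp only [pforce, pforce_onlyTypes, h, or_false]
    exact and_congr_right fun hg => ⟨fun hn k' hk _ => hv _ _ _ hk hn, fun H => H k le_rfl hg⟩

theorem agreesOnGood_typeSubst (hv : ∀ k k' n, k ≤ k' → val k n → val k' n)
    (t : Finset PropForm) :
    AgreesOnGood F W val (substVal (typeSubst (onlyTypes F W) t) val) := by
  refine ⟨substVal_mono _ hv, fun k hk n => ?_⟩
  rw [substVal_typeSubst hv]
  exact ⟨fun h => ⟨.inl hk, fun k' hk' _ => hv _ _ _ hk' h⟩, fun h => h.2 k le_rfl hk⟩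

theorem substVal_typeSubstList_cons (P : PropForm) (t : Finset PropForm)
    (L : List (Finset PropForm)) (val : K → ℕ → Prop) :
    substVal (typeSubstList P (t :: L)) val =
      substVal (typeSubstList P L) (substVal (typeSubst P t) val) := by
  funext k n
  exact propext (pforce_substProp _ _ _)

theorem substVal_typeSubstList_append (P : PropForm) (L L' : List (Finset PropForm))
    (val : K → ℕ → Prop) :
    substVal (typeSubstList P (L ++ L')) val =
      substVal (typeSubstList P L') (substVal (typeSubstList P L) val) := by
  induction L generalizing val with
  | nil => rfl
  | cons t L ih => rw [List.cons_append, substVal_typeSubstList_cons, ih,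
      substVal_typeSubstList_cons]

theorem agreesOnGood_typeSubstList (hv : ∀ k k' n, k ≤ k' → val k n → val k' n)
    (L : List (Finset PropForm)) :
    AgreesOnGood F W val (substVal (typeSubstList (onlyTypes F W) L) val) := by
  induction L generalizing val with
  | nil => exact ⟨hv, fun _ _ _ => Iff.rfl⟩
  | cons t L ih =>
    rw [substVal_typeSubstList_cons]
    exact (agreesOnGood_typeSubst hv t).trans (ih (substVal_mono _ hv))

/-- `t` is a type that can be attached below a set `T` of types. -/
structure IsTypeBelow (F : Finset PropForm) (T : Finset (Finset PropForm))
    (t : Finset PropForm) : Prop where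
  sub : t ⊆ F
  var : ∀ n, PropForm.var n ∈ t → ∀ t' ∈ T, PropForm.var n ∈ t'
  bot : PropForm.bot ∉ t
  top : PropForm.top ∈ F → PropForm.top ∈ t
  and : ∀ A B, A.and B ∈ F → (A.and B ∈ t ↔ A ∈ t ∧ B ∈ t)
  or : ∀ A B, A.or B ∈ F → (A.or B ∈ t ↔ A ∈ t ∨ B ∈ t)
  imp : ∀ A B, A.imp B ∈ F →
    (A.imp B ∈ t ↔ (∀ t' ∈ T, A.imp B ∈ t') ∧ (A ∈ t → B ∈ t))

theorem good_of_isTypeBelow (hF : SubClosed F) (hv : ∀ k k' n, k ≤ k' → val k n → val k' n)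
    {T : Finset (Finset PropForm)} {t : Finset PropForm} (ht : IsTypeBelow F T t) (htW : t ∈ W)
    {k : K} (hT : ∀ k' ≥ k, ¬ GoodWorld F W val k' → goodTypes F W val k' = T) :
    GoodWorld F W (substVal (typeSubst (onlyTypes F W) t) val) k := by
  have hA := agreesOnGood_typeSubst (F := F) (W := W) hv t
  set val' := substVal (typeSubst (onlyTypes F W) t) val with hval'
  have key : ∀ D ∈ F, ∀ k' ≥ k, ¬ GoodWorld F W val k' → (pforce val' D k' ↔ D ∈ t) := by
    intro D
    induction D with
    | var n =>
      intro hD k' hk' hng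
      change substVal _ val k' n ↔ _
      rw [substVal_typeSubst hv]
      refine ⟨fun h => h.1.resolve_left hng, fun h => ⟨.inr h, fun k'' hk'' hg => ?_⟩⟩
      have h1 := worldType_mem_goodTypes hk'' hg
      rw [hT k' hk' hng] at h1
      exact (mem_worldType.1 (ht.var n h _ h1)).2
    | bot => exact fun _ _ _ _ => ⟨fun h => h.elim, fun h => (ht.bot h).elim⟩
    | top => exact fun hD _ _ _ => ⟨fun _ => ht.top hD, fun _ => trivial⟩
    | and A B ih1 ih2 =>
      intro hD k' hk' hng
      rw [ht.and A B hD, ← ih1 (hF.and hD).1 k' hk' hng, ← ih2 (hF.and hD).2 k' hk' hng]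
      rfl
    | or A B ih1 ih2 =>
      intro hD k' hk' hng
      rw [ht.or A B hD, ← ih1 (hF.or hD).1 k' hk' hng, ← ih2 (hF.or hD).2 k' hk' hng]
      rfl
    | imp A B ih1 ih2 =>
      intro hD k' hk' hng
      rw [ht.imp A B hD]
      constructor
      · intro h
        constructor
        · intro t' ht'
          classical
          rw [← hT k' hk' hng] at ht'
          simp only [goodTypes, Finset.mem_filter] at ht'
          obtain ⟨-, k'', hk'', hg, rfl⟩ := ht'
          exact mem_worldType.2 ⟨hD, (hA.pforce_iff hg _).2 fun k₃ h₃ => h k₃ (le_trans hk'' h₃)⟩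
        · rw [← ih1 (hF.imp hD).1 k' hk' hng, ← ih2 (hF.imp hD).2 k' hk' hng]
          exact h k' le_rfl
      · rintro ⟨h1, h2⟩ k'' hk'' hAf
        by_cases hg : GoodWorld F W val k''
        · have h3 := worldType_mem_goodTypes hk'' hg
          rw [hT k' hk' hng] at h3
          exact (hA.pforce_iff hg _).1 ((mem_worldType.1 (h1 _ h3)).2 k'' le_rfl
            ((hA.pforce_iff hg _).2 hAf))
        · have hkk : k'' ≥ k := le_trans hk' hk''
          exact (ih2 (hF.imp hD).2 k'' hkk hg).2 (h2 ((ih1 (hF.imp hD).1 k'' hkk hg).1 hAf))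
  intro k' hk'
  by_cases hg : GoodWorld F W val k'
  · exact hA.good hg k' le_rfl
  · have : worldType F val' k' = t := by
      ext D
      rw [mem_worldType]
      exact ⟨fun h => (key D h.1 k' hk' hg).1 h.2,
        fun h => ⟨ht.sub h, (key D (ht.sub h) k' hk' hg).2 h⟩⟩
    rwa [this]

theorem exists_stage_of_mem {t : Finset PropForm} {L : List (Finset PropForm)} (ht : t ∈ L)
    (hv : ∀ k k' n, k ≤ k' → val k n → val k' n) :
    ∃ v : K → ℕ → Prop, AgreesOnGood F W val v ∧
      AgreesOnGood F W (substVal (typeSubst (onlyTypes F W) t) v)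
        (substVal (typeSubstList (onlyTypes F W) L) val) := by
  obtain ⟨L₁, L₂, rfl⟩ := List.append_of_mem ht
  refine ⟨substVal (typeSubstList (onlyTypes F W) L₁) val, agreesOnGood_typeSubstList hv _, ?_⟩
  rw [substVal_typeSubstList_append, substVal_typeSubstList_cons]
  exact agreesOnGood_typeSubstList (substVal_mono _ (substVal_mono _ hv)) _

theorem goodTypes_card_lt (hF : SubClosed F) (hv : ∀ k k' n, k ≤ k' → val k n → val k' n)
    (hW : ∀ T : Finset (Finset PropForm), (∀ t ∈ T, t ∈ W) → ∃ t ∈ W, IsTypeBelow F T t) {j : ℕ}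
    (hj : ∀ k, ¬ GoodWorld F W val k → j ≤ (goodTypes F W val k).card) {k : K}
    (hk : ¬ GoodWorld F W (substVal (typeSubstList (onlyTypes F W) F.powerset.toList) val) k) :
    j < (goodTypes F W
      (substVal (typeSubstList (onlyTypes F W) F.powerset.toList) val) k).card := by
  set vf := substVal (typeSubstList (onlyTypes F W) F.powerset.toList) val with hvf
  by_contra hle
  push Not at hle
  obtain ⟨t, htW, ht⟩ := hW (goodTypes F W vf k) fun _ h => goodTypes_subset h
  obtain ⟨v, h1, h2⟩ := exists_stage_of_mem (F := F) (W := W) (t := t) (L := F.powerset.toList)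
    (by simpa using ht.sub) hv
  refine hk (h2.good (good_of_isTypeBelow hF h1.1 ht htW fun k' hk' hng => ?_))
  have h3 : goodTypes F W v k' ⊆ goodTypes F W vf k :=
    (((agreesOnGood_typeSubst h1.1 t).trans h2).goodTypes_subset k').trans (goodTypes_anti hk')
  exact Finset.eq_of_subset_of_card_le h3 (hle.trans ((hj k' fun hg => hng (h1.good hg)).trans
    (Finset.card_le_card (h1.goodTypes_subset k'))))

theorem exists_all_good (hF : SubClosed F)
    (hW : ∀ T : Finset (Finset PropForm), (∀ t ∈ T, t ∈ W) → ∃ t ∈ W, IsTypeBelow F T t) (j : ℕ) :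
    ∃ L : List (Finset PropForm), ∀ (K : Type) [PartialOrder K] (val : K → ℕ → Prop),
      (∀ k k' n, k ≤ k' → val k n → val k' n) →
      ∀ k, ¬ GoodWorld F W (substVal (typeSubstList (onlyTypes F W) L) val) k →
        j ≤ (goodTypes F W (substVal (typeSubstList (onlyTypes F W) L) val) k).card := by
  induction j with
  | zero => exact ⟨[], fun _ _ _ _ _ _ => Nat.zero_le _⟩
  | succ j ih =>
    obtain ⟨L, hL⟩ := ih
    refine ⟨L ++ F.powerset.toList, fun K _ val hv k hk => ?_⟩
    rw [substVal_typeSubstList_append] at hk ⊢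
    exact goodTypes_card_lt hF (substVal_mono _ hv) hW (hL K val hv) hk

end Projective

/-- Below every family of theories extending `Θ` there is a slashed theory extending `Θ`. -/
def HasSlash (Θ : Set PropForm) : Prop :=
  ∀ G : Set PropForm, IsIPCTheory G → Θ ⊆ G → ∃ X : Set PropForm, Θ ⊆ X ∧ X ⊆ G ∧
    IsIPCTheory X ∧ PropForm.bot ∉ X ∧ (∀ A B, PropForm.or A B ∈ X → A ∈ X ∨ B ∈ X) ∧
    ∀ A B, A.imp B ∈ X ↔ A.imp B ∈ G ∧ (A ∈ X → B ∈ X)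

theorem HasSlash.exists_isTypeBelow {Θ : Set PropForm} (hS : HasSlash Θ) (hΘ : IsIPCTheory Θ)
    {F : Finset PropForm} (hF : SubClosed F) (T : Finset (Finset PropForm))
    (hT : ∀ t ∈ T, t ∈ thyTypes Θ F) : ∃ t ∈ thyTypes Θ F, IsTypeBelow F T t := by
  classical
  obtain ⟨X, hX1, hX2, hX3, hX4, hX5, hX6⟩ := hS
    {D | ∀ t ∈ T, (bigAnd t.toList).imp D ∈ Θ}
    ⟨fun h t _ => (hΘ.relativize _).ipc h, fun h1 h2 t ht => (hΘ.relativize _).mp (h1 t ht)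
      (h2 t ht)⟩ (fun D hD t _ => hΘ.subset_relativize _ hD)
  have hmem : ∀ D ∈ F, D ∈ F.filter (· ∈ X) ↔ D ∈ X := fun D hD => by simp [hD]
  have hG : ∀ D ∈ F, (∀ t ∈ T, (bigAnd t.toList).imp D ∈ Θ) ↔ ∀ t ∈ T, D ∈ t := fun D hD =>
    forall₂_congr fun t ht => (mem_iff_of_mem_thyTypes hΘ (hT t ht) hD).symm
  refine ⟨F.filter (· ∈ X), ⟨Finset.filter_subset _ _, fun h =>
    notExactly_notMem_of_prime hX3 hX4 hX5 hmem (Finset.filter_subset _ _) (hX1 h)⟩,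
    Finset.filter_subset _ _, ?_, ?_, ?_, ?_, ?_, ?_⟩
  · intro n hn
    rw [Finset.mem_filter] at hn
    exact (hG _ hn.1).1 (hX2 hn.2)
  · simp [hX4]
  · intro h
    rw [hmem _ h]
    exact hX3.ipc .topI
  · intro A B h
    rw [hmem _ h, hmem _ (hF.and h).1, hmem _ (hF.and h).2, hX3.and_mem]
  · intro A B h
    rw [hmem _ h, hmem _ (hF.or h).1, hmem _ (hF.or h).2]
    exact ⟨hX5 A B, fun h => h.elim (hX3.mp (hX3.ipc (.impI (.orI1 .hyp0))))
      (hX3.mp (hX3.ipc (.impI (.orI2 .hyp0))))⟩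
  · intro A B h
    rw [hmem _ h, hmem _ (hF.imp h).1, hmem _ (hF.imp h).2, hX6, ← hG _ h]
    rfl

theorem ipcProv_of_forall_kripke {C : PropForm}
    (h : ∀ (K : Type) [PartialOrder K] (val : K → ℕ → Prop),
      (∀ k k' n, k ≤ k' → val k n → val k' n) → ∀ k, pforce val C k) : IPCProv ∅ C := by
  by_contra hC
  obtain ⟨K, _, _, val, hv, k, hk⟩ := exists_finite_countermodel hC
  exact hk (h K val hv k)

/-- An `IPC`-theory that has slashes is closed under the admissible rules of `IPC`. -/
theorem HasSlash.mem_of_admIPC {Θ : Set PropForm} (hS : HasSlash Θ) (hΘ : IsIPCTheory Θ)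
    {A B : PropForm} (hAB : AdmIPC A B) (hA : A ∈ Θ) : B ∈ Θ := by
  classical
  obtain ⟨F, hF, hAF⟩ := exists_subClosed A
  set W := thyTypes Θ F with hWdef
  obtain ⟨L, hL⟩ := exists_all_good hF (fun T hT => hS.exists_isTypeBelow hΘ hF T hT)
    (F.powerset.card + 1)
  set P := onlyTypes F W with hP
  have hgood : ∀ (K : Type) [PartialOrder K] (val : K → ℕ → Prop),
      (∀ k k' n, k ≤ k' → val k n → val k' n) →
      ∀ k, GoodWorld F W (substVal (typeSubstList P L) val) k := by
    intro K _ val hv k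
    by_contra hng
    have h1 := hL K val hv k hng
    have h2 : (goodTypes F W (substVal (typeSubstList P L) val) k).card ≤ F.powerset.card :=
      Finset.card_le_card (Finset.filter_subset _ _)
    exact Nat.not_succ_le_self _ (h1.trans h2)
  have hPΘ : P ∈ Θ := by
    refine hΘ.bigAnd_mem.2 fun D hD => ?_
    simp only [List.mem_map, Finset.mem_toList, Finset.mem_filter, Finset.mem_powerset] at hD
    obtain ⟨t, ⟨ht, htW⟩, rfl⟩ := hD
    by_contra hcon
    exact htW ⟨ht, hcon⟩
  have hθA : IPCProv ∅ (substProp (typeSubstList P L) A) :=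
    ipcProv_of_forall_kripke fun K _ val hv k => by
      rw [pforce_substProp]
      have h1 := hgood K val hv k k le_rfl
      exact (mem_worldType.1 (mem_of_mem_thyTypes hΘ h1 (hΘ.subset_relativize _ hA) hAF)).2
  have hθB : IPCProv ∅ (substProp (typeSubstList P L) B) := hAB _ hθA
  have hPB : IPCProv ∅ (P.imp ((substProp (typeSubstList P L) B).imp B)) :=
    ipcProv_of_forall_kripke fun K _ val hv k k₁ _ hk₁ k₂ hk₂ hB => by
      rw [pforce_substProp] at hB
      have hg : GoodWorld F W val k₂ := (pforce_onlyTypes.1 hk₁).mono hk₂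
      exact ((agreesOnGood_typeSubstList hv L).pforce_iff hg B).2 hB
  exact hΘ.mp (hΘ.mp (hΘ.ipc hPB) hPΘ) (hΘ.ipc hθB)

/-! ## Derivability from hypotheses in first-order logic -/

/-- Derivability from a set of hypotheses, whose free variables are treated as constants. -/
inductive Der (Ax Γ : Set ZFForm) : ZFForm → Prop
  | hyp {A : ZFForm} : A ∈ Γ → Der Ax Γ A
  | thm {A : ZFForm} : ZFProv Ax A → Der Ax Γ A
  | mp {A B : ZFForm} : Der Ax Γ (A.imp B) → Der Ax Γ A → Der Ax Γ B

section Syntactic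

open ZFForm

theorem ZFForm.renameFree_of_notMem {x y : ℕ} {A : ZFForm} (h : x ∉ A.FV) :
    A.renameFree x y = A := by
  induction A with
  | mem i j => simp only [FV, Finset.mem_insert, Finset.mem_singleton] at h
               simp only [renameFree]; rw [if_neg (by tauto), if_neg (by tauto)]
  | eq i j => simp only [FV, Finset.mem_insert, Finset.mem_singleton] at h
              simp only [renameFree]; rw [if_neg (by tauto), if_neg (by tauto)]
  | bot => rfl
  | top => rfl
  | and A B ih1 ih2 | or A B ih1 ih2 | imp A B ih1 ih2 =>
    simp only [FV, Finset.mem_union, not_or] at h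
    simp only [renameFree, ih1 h.1, ih2 h.2]
  | all z A ih | ex z A ih =>
    simp only [FV, Finset.mem_erase, not_and] at h
    simp only [renameFree]
    split_ifs with hz
    · rfl
    · rw [ih (h (Ne.symm hz))]

theorem ZFForm.renameFree_self (x : ℕ) (A : ZFForm) : A.renameFree x x = A := by
  induction A with
  | mem i j | eq i j =>
    simp only [renameFree]; congr <;> split_ifs <;> simp_all
  | bot | top => rfl
  | and A B ih1 ih2 | or A B ih1 ih2 | imp A B ih1 ih2 => simp only [renameFree, ih1, ih2]
  | all z A ih | ex z A ih => simp only [renameFree, ih, ite_self]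

theorem ZFForm.freeFor_self (x : ℕ) (A : ZFForm) : A.freeFor x x := by
  induction A with
  | mem i j | eq i j | bot | top => trivial
  | and A B ih1 ih2 | or A B ih1 ih2 | imp A B ih1 ih2 => exact ⟨ih1, ih2⟩
  | all z A ih | ex z A ih =>
    by_cases h : x = z
    · left; simp [FV, h]
    · right; exact ⟨h, ih⟩

namespace Der

variable {Ax Γ Δ : Set ZFForm} {A B C : ZFForm}

theorem mono (h : Der Ax Γ A) (hs : Γ ⊆ Δ) : Der Ax Δ A := by
  induction h with
  | hyp h => exact .hyp (hs h)
  | thm h => exact .thm h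
  | mp _ _ ih1 ih2 => exact .mp ih1 ih2

theorem toZF (h : Der Ax ∅ A) : ZFProv Ax A := by
  induction h with
  | hyp h => exact h.elim
  | thm h => exact h
  | mp _ _ ih1 ih2 => exact .mp ih1 ih2

theorem weak (h : Der Ax Γ A) : Der Ax (insert B Γ) A := h.mono (Set.subset_insert _ _)

theorem hyp0 : Der Ax (insert A Γ) A := .hyp (Set.mem_insert _ _)

theorem hyp1 : Der Ax (insert B (insert A Γ)) A := hyp0.weak

theorem ded (h : Der Ax (insert A Γ) B) : Der Ax Γ (A.imp B) := by
  induction h with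
  | hyp h =>
    rcases h with rfl | h
    · exact .thm (.mp (.mp .s .k) (.k (B := .top)))
    · exact .mp (.thm .k) (.hyp h)
  | thm h => exact .mp (.thm .k) (.thm h)
  | mp _ _ ih1 ih2 => exact .mp (.mp (.thm .s) ih1) ih2

theorem andI (h1 : Der Ax Γ A) (h2 : Der Ax Γ B) : Der Ax Γ (A.and B) :=
  .mp (.mp (.thm .andI) h1) h2

theorem andE1 (h : Der Ax Γ (A.and B)) : Der Ax Γ A := .mp (.thm .andE1) h

theorem andE2 (h : Der Ax Γ (A.and B)) : Der Ax Γ B := .mp (.thm .andE2) h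

theorem orI1 (h : Der Ax Γ A) : Der Ax Γ (A.or B) := .mp (.thm .orI1) h

theorem orI2 (h : Der Ax Γ B) : Der Ax Γ (A.or B) := .mp (.thm .orI2) h

theorem orE (h : Der Ax Γ (A.or B)) (h1 : Der Ax (insert A Γ) C) (h2 : Der Ax (insert B Γ) C) :
    Der Ax Γ C := .mp (.mp (.mp (.thm .orE) h1.ded) h2.ded) h

theorem botE (h : Der Ax Γ .bot) : Der Ax Γ A := .mp (.thm .botE) h

theorem iffI (h1 : Der Ax (insert A Γ) B) (h2 : Der Ax (insert B Γ) A) :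
    Der Ax Γ (A.biimp B) := .andI h1.ded h2.ded

theorem iff1 (h : Der Ax Γ (A.biimp B)) (h1 : Der Ax Γ A) : Der Ax Γ B := .mp h.andE1 h1

theorem iff2 (h : Der Ax Γ (A.biimp B)) (h1 : Der Ax Γ B) : Der Ax Γ A := .mp h.andE2 h1

theorem allE {x y : ℕ} (hf : A.freeFor y x) (h : Der Ax Γ (.all x A)) :
    Der Ax Γ (A.renameFree x y) := .mp (.thm (.allE hf)) h

theorem allE_self {x : ℕ} (h : Der Ax Γ (.all x A)) : Der Ax Γ A := by
  simpa [renameFree_self] using allE (freeFor_self x A) h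

theorem exI {x y : ℕ} (hf : A.freeFor y x) (h : Der Ax Γ (A.renameFree x y)) :
    Der Ax Γ (.ex x A) := .mp (.thm (.exI hf)) h

theorem exI_self {x : ℕ} (h : Der Ax Γ A) : Der Ax Γ (.ex x A) :=
  exI (freeFor_self x A) (by rwa [renameFree_self])

theorem gen {x : ℕ} (h : Der Ax Γ A) (hx : ∀ B ∈ Γ, x ∉ B.FV) : Der Ax Γ (.all x A) := by
  induction h with
  | @hyp A h =>
    exact .mp (.thm (.mp (.allShift (hx _ h)) (.gen (ded (Γ := ∅) hyp0).toZF))) (.hyp h)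
  | thm h => exact .thm (.gen h)
  | @mp A B _ _ ih1 ih2 =>
    have key : ZFProv Ax ((ZFForm.all x (A.imp B)).imp ((ZFForm.all x A).imp (.all x B))) := by
      have h1 : ZFProv Ax (((ZFForm.all x (A.imp B)).and (.all x A)).imp B) :=
        (ded (Γ := ∅) (.mp (allE_self (andE1 hyp0)) (allE_self (andE2 hyp0)))).toZF
      have h2 := ZFProv.mp (.allShift (by simp [FV])) (.gen (x := x) h1)
      exact (ded (Γ := ∅) (ded (.mp (.thm h2) (andI hyp1 hyp0)))).toZF
    exact .mp (.mp (.thm key) ih1) ih2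

theorem exE {x : ℕ} (h : Der Ax Γ (.ex x A)) (h1 : Der Ax (insert A Γ) C)
    (hx : ∀ B ∈ Γ, x ∉ B.FV) (hC : x ∉ C.FV) : Der Ax Γ C :=
  .mp (.mp (.thm (.exShift hC)) (gen h1.ded hx)) h

/-- Soundness of substitution instances of intuitionistic propositional logic. -/
theorem of_propProv {σ : ℕ → ZFForm} {Θ : Set PropForm} {D : PropForm}
    (hD : PropProv ∅ Θ D) : ∀ {Γ : Set ZFForm}, (∀ E ∈ Θ, Der Ax Γ (substZ σ E)) →
      Der Ax Γ (substZ σ D) := by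
  have aux : ∀ {Θ : Set PropForm} {Γ : Set ZFForm} {A : PropForm},
      (∀ E ∈ Θ, Der Ax Γ (substZ σ E)) →
      ∀ E ∈ insert A Θ, Der Ax (insert (substZ σ A) Γ) (substZ σ E) := by
    rintro Θ Γ A h E (rfl | hE)
    · exact hyp0
    · exact (h E hE).weak
  induction hD with
  | hyp h => exact fun hΓ => hΓ _ h
  | axm h => exact h.elim
  | topI => exact fun _ => .thm .topI
  | botE _ ih => exact fun hΓ => botE (ih hΓ)
  | andI _ _ ih1 ih2 => exact fun hΓ => andI (ih1 hΓ) (ih2 hΓ)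
  | andE1 _ ih => exact fun hΓ => andE1 (ih hΓ)
  | andE2 _ ih => exact fun hΓ => andE2 (ih hΓ)
  | orI1 _ ih => exact fun hΓ => orI1 (ih hΓ)
  | orI2 _ ih => exact fun hΓ => orI2 (ih hΓ)
  | orE _ _ _ ih ih1 ih2 => exact fun hΓ => orE (ih hΓ) (ih1 (aux hΓ)) (ih2 (aux hΓ))
  | impI _ ih => exact fun hΓ => ded (ih (aux hΓ))
  | impE _ _ ih1 ih2 => exact fun hΓ => .mp (ih1 hΓ) (ih2 hΓ)

end Der

/-! ## Renaming of variables -/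

namespace ZFForm

/-- The variable occurs in the formula, free, bound or as a binder. -/
def Occurs (y : ℕ) : ZFForm → Prop
  | .mem i j => y = i ∨ y = j
  | .eq i j => y = i ∨ y = j
  | .bot => False
  | .top => False
  | .and A B => A.Occurs y ∨ B.Occurs y
  | .or A B => A.Occurs y ∨ B.Occurs y
  | .imp A B => A.Occurs y ∨ B.Occurs y
  | .all z A => y = z ∨ A.Occurs y
  | .ex z A => y = z ∨ A.Occurs y

/-- The number of connectives and quantifiers. -/
def size : ZFForm → ℕ
  | .mem _ _ => 0
  | .eq _ _ => 0
  | .bot => 0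
  | .top => 0
  | .and A B => A.size + B.size + 1
  | .or A B => A.size + B.size + 1
  | .imp A B => A.size + B.size + 1
  | .all _ A => A.size + 1
  | .ex _ A => A.size + 1

variable {x y c : ℕ} {A : ZFForm}

theorem size_renameFree (x y : ℕ) (A : ZFForm) : (A.renameFree x y).size = A.size := by
  induction A with
  | mem i j | eq i j | bot | top => rfl
  | and A B ih1 ih2 | or A B ih1 ih2 | imp A B ih1 ih2 => simp only [renameFree, size, ih1, ih2]
  | all z A ih | ex z A ih => simp only [renameFree]; split_ifs <;> simp [size, ih]

theorem occurs_of_mem_FV (h : y ∈ A.FV) : A.Occurs y := by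
  induction A with
  | mem i j | eq i j => simpa [FV, Occurs] using h
  | bot | top => simp [FV] at h
  | and A B ih1 ih2 | or A B ih1 ih2 | imp A B ih1 ih2 =>
    exact (Finset.mem_union.1 h).imp ih1 ih2
  | all z A ih | ex z A ih => exact .inr (ih (Finset.mem_of_mem_erase h))

theorem exists_occurs_lt (A : ZFForm) : ∃ N, ∀ y, A.Occurs y → y < N := by
  induction A with
  | mem i j | eq i j => exact ⟨i + j + 1, by rintro y (rfl | rfl) <;> omega⟩
  | bot | top => exact ⟨0, fun _ h => h.elim⟩
  | and A B ih1 ih2 | or A B ih1 ih2 | imp A B ih1 ih2 =>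
    obtain ⟨N, hN⟩ := ih1
    obtain ⟨M, hM⟩ := ih2
    exact ⟨max N M, fun y hy => hy.elim (fun h => lt_max_of_lt_left (hN y h))
      (fun h => lt_max_of_lt_right (hM y h))⟩
  | all z A ih | ex z A ih =>
    obtain ⟨N, hN⟩ := ih
    exact ⟨max (z + 1) N, fun y hy => hy.elim (fun h => lt_max_of_lt_left (by omega))
      (fun h => lt_max_of_lt_right (hN y h))⟩

theorem freeFor_of_not_occurs (h : ¬ A.Occurs c) : A.freeFor c x := by
  induction A with
  | mem i j | eq i j | bot | top => trivial
  | and A B ih1 ih2 | or A B ih1 ih2 | imp A B ih1 ih2 =>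
    exact ⟨ih1 fun h' => h (.inl h'), ih2 fun h' => h (.inr h')⟩
  | all z A ih | ex z A ih => exact .inr ⟨fun h' => h (.inl h'), ih fun h' => h (.inr h')⟩

theorem renameFree_renameFree (h : ¬ A.Occurs c) :
    (A.renameFree x c).renameFree c x = A := by
  induction A with
  | mem i j | eq i j =>
    simp only [Occurs, not_or] at h
    simp only [renameFree]
    congr <;> split_ifs <;> simp_all
  | bot | top => rfl
  | and A B ih1 ih2 | or A B ih1 ih2 | imp A B ih1 ih2 =>
    simp only [renameFree, ih1 fun h' => h (.inl h'), ih2 fun h' => h (.inr h')]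
  | all z A ih | ex z A ih =>
    simp only [Occurs, not_or] at h
    simp only [renameFree]
    split_ifs with hz
    · simp only [renameFree]
      rw [if_neg (Ne.symm h.1), renameFree_of_notMem fun h' => h.2 (occurs_of_mem_FV h')]
    · simp only [renameFree, ih h.2]
      rw [if_neg (Ne.symm h.1)]

theorem mem_FV_renameFree {z : ℕ} (h : z ∈ (A.renameFree x y).FV) :
    z = y ∨ (z ∈ A.FV ∧ z ≠ x) := by
  induction A with
  | mem i j | eq i j =>
    simp only [renameFree, FV, Finset.mem_insert, Finset.mem_singleton] at h ⊢
    split_ifs at h <;> grind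
  | bot | top => simp [renameFree, FV] at h
  | and A B ih1 ih2 | or A B ih1 ih2 | imp A B ih1 ih2 =>
    simp only [renameFree, FV, Finset.mem_union] at h ⊢
    grind
  | all w A ih | ex w A ih =>
    simp only [renameFree] at h
    split_ifs at h with hz
    · simp only [FV, Finset.mem_erase] at h ⊢
      grind
    · simp only [FV, Finset.mem_erase] at h ⊢
      grind

theorem freeFor_renameFree (h : ¬ A.Occurs c) : (A.renameFree x c).freeFor x c := by
  induction A with
  | mem i j | eq i j | bot | top => trivial
  | and A B ih1 ih2 | or A B ih1 ih2 | imp A B ih1 ih2 =>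
    exact ⟨ih1 fun h' => h (.inl h'), ih2 fun h' => h (.inr h')⟩
  | all z A ih | ex z A ih =>
    simp only [Occurs, not_or] at h
    simp only [renameFree]
    split_ifs with hz
    · left
      simp only [FV, Finset.mem_erase, not_and]
      exact fun _ h' => h.2 (occurs_of_mem_FV h')
    · exact .inr ⟨Ne.symm hz, ih h.2⟩

end ZFForm

namespace Der

variable {Ax Γ Δ : Set ZFForm} {A B C : ZFForm}

theorem allFresh {z y : ℕ} (hy : ¬ A.Occurs y) :
    ZFProv Ax ((ZFForm.all z A).biimp (.all y (A.renameFree z y))) := by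
  refine (iffI (Γ := ∅) (gen (allE (freeFor_of_not_occurs hy) hyp0) ?_) (gen ?_ ?_)).toZF
  · rintro B (rfl | h)
    · exact fun h => hy (occurs_of_mem_FV (Finset.mem_of_mem_erase h))
    · exact h.elim
  · have := allE (freeFor_renameFree (x := z) hy) (hyp0 (Ax := Ax) (Γ := ∅))
    rwa [renameFree_renameFree hy] at this
  · rintro B (rfl | h)
    · intro h
      rcases mem_FV_renameFree (Finset.mem_of_mem_erase h) with rfl | h
      · exact (Finset.notMem_erase _ _) (by assumption)
      · exact h.2 rfl
    · exact h.elim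

theorem exFresh {z y : ℕ} (hy : ¬ A.Occurs y) :
    ZFProv Ax ((ZFForm.ex z A).biimp (.ex y (A.renameFree z y))) := by
  refine (iffI (Γ := ∅) (exE hyp0 (A := A) (x := z) ?_ ?_ ?_)
    (exE hyp0 (exI (freeFor_of_not_occurs hy) hyp0) ?_ ?_)).toZF
  · refine exI (freeFor_renameFree hy) ?_
    rw [renameFree_renameFree hy]
    exact hyp0
  · rintro B (rfl | h)
    · simp [FV]
    · exact h.elim
  · intro h
    rcases mem_FV_renameFree (Finset.mem_of_mem_erase h) with rfl | h
    · exact (Finset.notMem_erase _ _) (by assumption)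
    · exact h.2 rfl
  · rintro B (rfl | h)
    · simp [FV]
    · exact h.elim
  · exact fun h => hy (occurs_of_mem_FV (Finset.mem_of_mem_erase h))

theorem allCongr {x : ℕ} (h : ZFProv Ax (A.biimp B)) :
    ZFProv Ax ((ZFForm.all x A).biimp (.all x B)) := by
  refine (iffI (Γ := ∅) (gen (iff1 (.thm h) (allE_self hyp0)) ?_)
    (gen (iff2 (.thm h) (allE_self hyp0)) ?_)).toZF <;>
  · rintro B (rfl | h)
    · simp [FV]
    · exact h.elim

theorem exCongr {x : ℕ} (h : ZFProv Ax (A.biimp B)) :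
    ZFProv Ax ((ZFForm.ex x A).biimp (.ex x B)) := by
  refine (iffI (Γ := ∅) (exE hyp0 (exI_self (iff1 (.thm h) hyp0)) ?_ ?_)
    (exE hyp0 (exI_self (iff2 (.thm h) hyp0)) ?_ ?_)).toZF <;>
  first
  | rintro B (rfl | h)
    · simp [FV]
    · exact h.elim
  | simp [FV]

theorem iffTrans (h1 : ZFProv Ax (A.biimp B)) (h2 : ZFProv Ax (B.biimp C)) :
    ZFProv Ax (A.biimp C) :=
  (iffI (Γ := ∅) (iff1 (.thm h2) (iff1 (.thm h1) hyp0))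
    (iff2 (.thm h1) (iff2 (.thm h2) hyp0))).toZF

theorem iffSymm (h1 : ZFProv Ax (A.biimp B)) : ZFProv Ax (B.biimp A) :=
  (andI (Γ := ∅) (andE2 (.thm h1)) (andE1 (.thm h1))).toZF

end Der

end Syntactic

/-! ## Substitution of parameters -/

section Parameters

open ZFForm

namespace ZFForm

/-- Simultaneous substitution of variables for the free variables; bound variables become odd. -/
def sub (τ : ℕ → ℕ) : ZFForm → ZFForm
  | .mem i j => .mem (τ i) (τ j)
  | .eq i j => .eq (τ i) (τ j)
  | .bot => .bot
  | .top => .top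
  | .and A B => .and (A.sub τ) (B.sub τ)
  | .or A B => .or (A.sub τ) (B.sub τ)
  | .imp A B => .imp (A.sub τ) (B.sub τ)
  | .all z A => .all (2 * z + 1) (A.sub (Function.update τ z (2 * z + 1)))
  | .ex z A => .ex (2 * z + 1) (A.sub (Function.update τ z (2 * z + 1)))

variable {x y c : ℕ} {A : ZFForm}

theorem sub_congr {τ τ' : ℕ → ℕ} (h : ∀ z ∈ A.FV, τ z = τ' z) : A.sub τ = A.sub τ' := by
  induction A generalizing τ τ' with
  | mem i j | eq i j => simp only [sub, h i (by simp [FV]), h j (by simp [FV])]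
  | bot | top => rfl
  | and A B ih1 ih2 | or A B ih1 ih2 | imp A B ih1 ih2 =>
    simp only [sub]
    rw [ih1 fun z hz => h z (by simp [FV, hz]), ih2 fun z hz => h z (by simp [FV, hz])]
  | all w A ih | ex w A ih =>
    simp only [sub]
    congr 1
    refine ih fun z hz => ?_
    by_cases hzw : z = w
    · subst hzw; simp
    · simp [Function.update_of_ne hzw, h z (by simp [FV, hz, hzw])]

theorem sub_renameFree {τ : ℕ → ℕ} (h : A.freeFor y x) :
    (A.renameFree x y).sub τ = A.sub (Function.update τ x (τ y)) := by
  induction A generalizing τ with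
  | mem i j | eq i j =>
    simp only [renameFree, sub, Function.update_apply]
    congr <;> split_ifs <;> rfl
  | bot | top => rfl
  | and A B ih1 ih2 | or A B ih1 ih2 | imp A B ih1 ih2 =>
    simp only [renameFree, sub, ih1 h.1, ih2 h.2]
  | all w A ih | ex w A ih =>
    simp only [renameFree]
    split_ifs with hw
    · refine sub_congr fun z hz => ?_
      rw [Function.update_of_ne]
      rintro rfl
      simp [FV, hw] at hz
    · rcases h with h | ⟨h1, h2⟩
      · have hxA : x ∉ A.FV := fun h' => h (by simp [FV, h', Ne.symm hw])
        rw [renameFree_of_notMem hxA]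
        refine sub_congr fun z hz => ?_
        rw [Function.update_of_ne]
        rintro rfl
        exact h hz
      · simp only [sub, ih h2]
        rw [Function.update_of_ne h1, Function.update_comm hw]

theorem sub_update_renameFree {τ : ℕ → ℕ} (h : ∀ z ∈ A.FV, z ≠ x → τ z ≠ 2 * x + 1) :
    (A.sub (Function.update τ x (2 * x + 1))).renameFree (2 * x + 1) c =
      A.sub (Function.update τ x c) := by
  induction A generalizing τ with
  | mem i j | eq i j =>
    have aux : ∀ i, (i ≠ x → τ i ≠ 2 * x + 1) →
        (if Function.update τ x (2 * x + 1) i = 2 * x + 1 then c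
          else Function.update τ x (2 * x + 1) i) = Function.update τ x c i := by
      intro i hi
      by_cases hx : i = x
      · subst hx; simp
      · simp [Function.update_of_ne hx, hi hx]
    simp only [renameFree, sub]
    rw [aux i (h i (by simp [FV])), aux j (h j (by simp [FV]))]
  | bot | top => rfl
  | and A B ih1 ih2 | or A B ih1 ih2 | imp A B ih1 ih2 =>
    simp only [renameFree, sub]
    rw [ih1 fun z hz => h z (by simp [FV, hz]), ih2 fun z hz => h z (by simp [FV, hz])]
  | all w A ih | ex w A ih =>
    simp only [sub, renameFree]
    by_cases hw : w = x
    · subst hw; simp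
    · rw [if_neg (by omega), Function.update_comm (Ne.symm hw), ih,
        Function.update_comm hw]
      intro z hz hzx
      by_cases hzw : z = w
      · subst hzw; simp; omega
      · rw [Function.update_of_ne hzw]
        exact h z (by simp [FV, hz, hzw]) hzx

theorem freeFor_sub (c : ℕ) (τ : ℕ → ℕ) : (A.sub τ).freeFor (2 * c) x := by
  induction A generalizing τ with
  | mem i j | eq i j | bot | top => trivial
  | and A B ih1 ih2 | or A B ih1 ih2 | imp A B ih1 ih2 => exact ⟨ih1 _, ih2 _⟩
  | all w A ih | ex w A ih => exact .inr ⟨by omega, ih _⟩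

theorem occurs_sub {τ : ℕ → ℕ} (h : (A.sub τ).Occurs y) : Odd y ∨ ∃ z ∈ A.FV, y = τ z := by
  induction A generalizing τ with
  | mem i j | eq i j =>
    rcases h with rfl | rfl
    · exact .inr ⟨i, by simp [FV], rfl⟩
    · exact .inr ⟨j, by simp [FV], rfl⟩
  | bot | top => exact h.elim
  | and A B ih1 ih2 | or A B ih1 ih2 | imp A B ih1 ih2 =>
    rcases h with h | h
    · exact (ih1 h).imp id fun ⟨z, hz, e⟩ => ⟨z, by simp [FV, hz], e⟩
    · exact (ih2 h).imp id fun ⟨z, hz, e⟩ => ⟨z, by simp [FV, hz], e⟩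
  | all w A ih | ex w A ih =>
    rcases h with rfl | h
    · exact .inl ⟨w, rfl⟩
    · rcases ih h with h | ⟨z, hz, e⟩
      · exact .inl h
      · by_cases hzw : z = w
        · subst hzw
          rw [Function.update_self] at e
          exact .inl ⟨z, e⟩
        · rw [Function.update_of_ne hzw] at e
          exact .inr ⟨z, by simp [FV, hz, hzw], e⟩

theorem exists_fresh (A : ZFForm) (s : Finset ℕ) : ∃ y, ¬ A.Occurs (2 * y) ∧ 2 * y ∉ s ∧
    ¬ A.Occurs y ∧ y ∉ s := by
  obtain ⟨N, hN⟩ := exists_occurs_lt A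
  have key : ∀ x ∈ s, x ≤ s.sup id := fun x hx => Finset.le_sup (f := id) hx
  exact ⟨N + s.sup id + 1, fun h => by have := hN _ h; omega, fun h => by have := key _ h; omega,
    fun h => by have := hN _ h; omega, fun h => by have := key _ h; omega⟩

end ZFForm

namespace Der

variable {Ax Γ Δ : Set ZFForm} {A B C : ZFForm}

theorem andCongr {A' B' : ZFForm} (h1 : ZFProv Ax (A.biimp A')) (h2 : ZFProv Ax (B.biimp B')) :
    ZFProv Ax ((A.and B).biimp (A'.and B')) :=
  (iffI (Γ := ∅) (andI (iff1 (.thm h1) (andE1 hyp0)) (iff1 (.thm h2) (andE2 hyp0)))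
    (andI (iff2 (.thm h1) (andE1 hyp0)) (iff2 (.thm h2) (andE2 hyp0)))).toZF

theorem orCongr {A' B' : ZFForm} (h1 : ZFProv Ax (A.biimp A')) (h2 : ZFProv Ax (B.biimp B')) :
    ZFProv Ax ((A.or B).biimp (A'.or B')) :=
  (iffI (Γ := ∅) (orE hyp0 (orI1 (iff1 (.thm h1) hyp0)) (orI2 (iff1 (.thm h2) hyp0)))
    (orE hyp0 (orI1 (iff2 (.thm h1) hyp0)) (orI2 (iff2 (.thm h2) hyp0)))).toZF

theorem impCongr {A' B' : ZFForm} (h1 : ZFProv Ax (A.biimp A')) (h2 : ZFProv Ax (B.biimp B')) :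
    ZFProv Ax ((A.imp B).biimp (A'.imp B')) :=
  (iffI (Γ := ∅) (ded (iff1 (.thm h2) (.mp hyp1 (iff2 (.thm h1) hyp0))))
    (ded (iff2 (.thm h2) (.mp hyp1 (iff1 (.thm h1) hyp0))))).toZF

theorem iffRefl : ZFProv Ax (A.biimp A) := (iffI (Γ := ∅) hyp0 hyp0).toZF

/-- A formula all of whose free variables are even is equivalent to its variant with odd bound
variables. -/
theorem iff_sub {τ : ℕ → ℕ} (h : ∀ z ∈ A.FV, τ z = z ∧ Even z) :
    ZFProv Ax (A.biimp (A.sub τ)) := by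
  obtain ⟨n, hn⟩ : ∃ n, A.size = n := ⟨_, rfl⟩
  induction n using Nat.strong_induction_on generalizing A τ with
  | _ n ih =>
  subst hn
  cases A with
  | mem i j | eq i j =>
    simp only [sub, h i (by simp [FV]), h j (by simp [FV])]
    exact iffRefl
  | bot | top => exact iffRefl
  | and A B =>
    exact andCongr (ih _ (by simp only [size]; omega) (fun z hz => h z (by simp [FV, hz])) rfl)
      (ih _ (by simp only [size]; omega) (fun z hz => h z (by simp [FV, hz])) rfl)
  | or A B =>
    exact orCongr (ih _ (by simp only [size]; omega) (fun z hz => h z (by simp [FV, hz])) rfl)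
      (ih _ (by simp only [size]; omega) (fun z hz => h z (by simp [FV, hz])) rfl)
  | imp A B =>
    exact impCongr (ih _ (by simp only [size]; omega) (fun z hz => h z (by simp [FV, hz])) rfl)
      (ih _ (by simp only [size]; omega) (fun z hz => h z (by simp [FV, hz])) rfl)
  | all z A | ex z A =>
    obtain ⟨y, hy, hyF, -⟩ := exists_fresh A A.FV
    have hsub : (A.renameFree z (2 * y)).sub (Function.update τ (2 * y) (2 * y)) =
        (A.sub (Function.update τ z (2 * z + 1))).renameFree (2 * z + 1) (2 * y) := by
      rw [sub_renameFree (freeFor_of_not_occurs hy), sub_update_renameFree]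
      · refine sub_congr fun w hw => ?_
        by_cases hwz : w = z
        · subst hwz; simp
        · rw [Function.update_of_ne hwz, Function.update_of_ne hwz, Function.update_of_ne]
          rintro rfl
          exact hyF hw
      · intro w hw hwz e
        obtain ⟨h1, m, h2⟩ := h w (by simp [FV, hw, hwz])
        omega
    have h1 := ih (A.renameFree z (2 * y)).size (by rw [size_renameFree]; simp only [size]; omega)
      (A := A.renameFree z (2 * y)) (τ := Function.update τ (2 * y) (2 * y)) (fun w hw => by
        by_cases hwy : w = 2 * y
        · subst hwy; simp
        · rw [Function.update_of_ne hwy]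
          rcases mem_FV_renameFree hw with h' | h'
          · exact absurd h' hwy
          · exact h w (by simp [FV, h'])) rfl
    rw [hsub] at h1
    have h2 : ¬ (A.sub (Function.update τ z (2 * z + 1))).Occurs (2 * y) := by
      intro ho
      rcases occurs_sub ho with ⟨m, hm⟩ | ⟨w, hw, e⟩
      · omega
      · by_cases hwz : w = z
        · subst hwz
          rw [Function.update_self] at e
          omega
        · rw [Function.update_of_ne hwz, (h w (by simp [FV, hw, hwz])).1] at e
          exact hyF (e ▸ hw)
    first
    | exact iffTrans (allFresh hy) (iffTrans (allCongr h1) (iffSymm (allFresh h2)))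
    | exact iffTrans (exFresh hy) (iffTrans (exCongr h1) (iffSymm (exFresh h2)))

theorem sub_of_prov (h : ZFProv Ax A) (τ : ℕ → ℕ) :
    ZFProv Ax (A.sub fun n => 2 * τ n) := by
  obtain ⟨n, hn⟩ : ∃ n, A.FV.card = n := ⟨_, rfl⟩
  induction n generalizing A with
  | zero =>
    rw [Finset.card_eq_zero] at hn
    exact (iff1 (Γ := ∅) (.thm (iff_sub (by simp [hn]))) (.thm h)).toZF
  | succ n ih =>
    obtain ⟨x, hx⟩ : A.FV.Nonempty := Finset.card_pos.1 (by omega)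
    have h1 := ih (A := .all x A) (.gen h) (by simp [FV, Finset.card_erase_of_mem hx, hn])
    have h2 := allE (Γ := ∅) (freeFor_sub (τ x) _) (.thm h1)
    rw [sub_update_renameFree (fun z _ _ => by omega)] at h2
    have : Function.update (fun n => 2 * τ n) x (2 * τ x) = fun n => 2 * τ n :=
      Function.update_eq_self x _
    rw [this] at h2
    exact h2.toZF

/-- Equal objects have the same properties. -/
theorem leibniz (hAx : zfEqAxioms ⊆ Ax) {x y : ℕ} (hf : A.freeFor y x) :
    ZFProv Ax ((ZFForm.eq x y).imp (A.biimp (A.renameFree x y))) := by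
  have symm : ∀ i j, ZFProv Ax ((ZFForm.eq i j).imp (.eq j i)) := fun i j =>
    .axm (hAx (.inr (.inl ⟨i, j, rfl⟩)))
  have trans : ∀ i j k, ZFProv Ax ((ZFForm.eq i j).imp ((ZFForm.eq j k).imp (.eq i k))) :=
    fun i j k => .axm (hAx (.inr (.inr (.inl ⟨i, j, k, rfl⟩))))
  have memL : ∀ i j k, ZFProv Ax ((ZFForm.eq i j).imp ((ZFForm.mem i k).imp (.mem j k))) :=
    fun i j k => .axm (hAx (.inr (.inr (.inr (.inl ⟨i, j, k, rfl⟩)))))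
  have memR : ∀ i j k, ZFProv Ax ((ZFForm.eq i j).imp ((ZFForm.mem k i).imp (.mem k j))) :=
    fun i j k => .axm (hAx (.inr (.inr (.inr (.inr ⟨i, j, k, rfl⟩)))))
  have refl : ∀ i, ZFProv Ax (.eq i i) := fun i => .axm (hAx (.inl ⟨i, rfl⟩))
  have ren : ∀ i, Der Ax {ZFForm.eq x y} (.eq i (if i = x then y else i)) := by
    intro i
    split_ifs with h
    · subst h; exact .hyp rfl
    · exact .thm (refl i)
  suffices h : Der Ax {ZFForm.eq x y} (A.biimp (A.renameFree x y)) by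
    refine (ded (Γ := ∅) ?_).toZF
    simpa using h
  induction A with
  | mem i j =>
    simp only [renameFree]
    refine iffI ?_ ?_
    · exact .mp (.mp (.thm (memR _ _ _)) (ren j).weak) (.mp (.mp (.thm (memL _ _ _)) (ren i).weak)
        hyp0)
    · exact .mp (.mp (.thm (memR _ _ _)) (.mp (.thm (symm _ _)) (ren j).weak))
        (.mp (.mp (.thm (memL _ _ _)) (.mp (.thm (symm _ _)) (ren i).weak)) hyp0)
  | eq i j =>
    simp only [renameFree]
    refine iffI ?_ ?_
    · exact .mp (.mp (.thm (trans _ _ _)) (.mp (.thm (symm _ _)) (ren i).weak))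
        (.mp (.mp (.thm (trans _ _ _)) hyp0) (ren j).weak)
    · exact .mp (.mp (.thm (trans _ _ _)) (ren i).weak)
        (.mp (.mp (.thm (trans _ _ _)) hyp0) (.mp (.thm (symm _ _)) (ren j).weak))
  | bot | top => exact .thm iffRefl
  | and A B ih1 ih2 =>
    have h1 := ih1 hf.1
    have h2 := ih2 hf.2
    exact iffI (andI (iff1 h1.weak (andE1 hyp0)) (iff1 h2.weak (andE2 hyp0)))
      (andI (iff2 h1.weak (andE1 hyp0)) (iff2 h2.weak (andE2 hyp0)))
  | or A B ih1 ih2 =>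
    have h1 := ih1 hf.1
    have h2 := ih2 hf.2
    exact iffI (orE hyp0 (orI1 (iff1 h1.weak.weak hyp0)) (orI2 (iff1 h2.weak.weak hyp0)))
      (orE hyp0 (orI1 (iff2 h1.weak.weak hyp0)) (orI2 (iff2 h2.weak.weak hyp0)))
  | imp A B ih1 ih2 =>
    have h1 := ih1 hf.1
    have h2 := ih2 hf.2
    exact iffI (ded (iff1 h2.weak.weak (.mp hyp1 (iff2 h1.weak.weak hyp0))))
      (ded (iff2 h2.weak.weak (.mp hyp1 (iff1 h1.weak.weak hyp0))))
  | all z A ih =>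
    by_cases hx : x ∈ (ZFForm.all z A).FV
    · have hzx : z ≠ x := by rintro rfl; simp [FV] at hx
      obtain ⟨h1, h2⟩ := hf.resolve_left (not_not.2 hx)
      have h3 := ih h2
      simp only [renameFree, if_neg hzx]
      refine iffI (gen (iff1 h3.weak (allE_self hyp0)) ?_) (gen (iff2 h3.weak (allE_self hyp0)) ?_)
      all_goals
        rintro B (rfl | rfl)
        · simp [FV]
        · simp [FV, hzx, Ne.symm h1]
    · rw [renameFree_of_notMem hx]
      exact .thm iffRefl
  | ex z A ih =>
    by_cases hx : x ∈ (ZFForm.ex z A).FV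
    · have hzx : z ≠ x := by rintro rfl; simp [FV] at hx
      obtain ⟨h1, h2⟩ := hf.resolve_left (not_not.2 hx)
      have h3 := ih h2
      simp only [renameFree, if_neg hzx]
      refine iffI (exE hyp0 (exI_self (iff1 h3.weak.weak hyp0)) ?_ (by simp [FV]))
        (exE hyp0 (exI_self (iff2 h3.weak.weak hyp0)) ?_ (by simp [FV]))
      all_goals
        rintro B (rfl | rfl)
        · simp [FV]
        · simp [FV, hzx, Ne.symm h1]
    · rw [renameFree_of_notMem hx]
      exact .thm iffRefl

end Der

end Parameters

/-! ## Henkin theories -/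

/-- A set of statements about parameters (natural numbers) that contains the theorems of `Ax`, is
closed under modus ponens, and in which existential statements have witnesses. -/
structure HenkinTheory (Ax : Set ZFForm) where
  V : ZFForm → (ℕ → ℕ) → Prop
  vmem : ℕ → ℕ → Prop
  veq : ℕ → ℕ → Prop
  mem_iff : ∀ {i j τ}, V (.mem i j) τ ↔ vmem (τ i) (τ j)
  eq_iff : ∀ {i j τ}, V (.eq i j) τ ↔ veq (τ i) (τ j)
  thm : ∀ {A τ}, ZFProv Ax A → V A τ
  mp : ∀ {A B τ}, V (A.imp B) τ → V A τ → V B τ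
  congr : ∀ {A τ τ'}, (∀ z ∈ A.FV, τ z = τ' z) → (V A τ ↔ V A τ')
  rename : ∀ {A x y τ}, A.freeFor y x →
    (V (A.renameFree x y) τ ↔ V A (Function.update τ x (τ y)))
  inst : ∀ {A x τ}, V (.all x A) τ → ∀ c, V A (Function.update τ x c)
  wit : ∀ {A x τ}, V (.ex x A) τ → ∃ c, V A (Function.update τ x c)

/-- The inconsistent Henkin theory. -/
def HenkinTheory.trivial (Ax : Set ZFForm) : HenkinTheory Ax where
  V _ _ := True
  vmem _ _ := True
  veq _ _ := True
  mem_iff := Iff.rfl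
  eq_iff := Iff.rfl
  thm _ := True.intro
  mp _ _ := True.intro
  congr _ := Iff.rfl
  rename _ := Iff.rfl
  inst _ _ := True.intro
  wit _ := ⟨0, True.intro⟩

section Henkin

open ZFForm

/-- An injective coding of formulas. -/
def ZFForm.code : ZFForm → ℕ
  | .mem i j => 9 * Nat.pair i j
  | .eq i j => 9 * Nat.pair i j + 1
  | .bot => 2
  | .top => 3
  | .and A B => 9 * Nat.pair A.code B.code + 4
  | .or A B => 9 * Nat.pair A.code B.code + 5
  | .imp A B => 9 * Nat.pair A.code B.code + 6
  | .all x A => 9 * Nat.pair x A.code + 7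
  | .ex x A => 9 * Nat.pair x A.code + 8

theorem ZFForm.code_injective : Function.Injective ZFForm.code := by
  intro A
  induction A with
  | mem i j | eq i j | bot | top =>
    intro B h
    cases B <;> simp only [code] at h <;>
      first
      | rfl
      | (exfalso; omega)
      | obtain ⟨rfl, rfl⟩ := Nat.pair_eq_pair.1 (Nat.eq_of_mul_eq_mul_left (Nat.succ_pos 8) h)
        rfl
      | obtain ⟨rfl, rfl⟩ := Nat.pair_eq_pair.1
          (Nat.eq_of_mul_eq_mul_left (Nat.succ_pos 8) (Nat.add_right_cancel h))
        rfl
  | and A B ih1 ih2 | or A B ih1 ih2 | imp A B ih1 ih2 =>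
    intro C h
    cases C <;> simp only [code] at h <;>
      first
      | (exfalso; omega)
      | obtain ⟨h1, h2⟩ := Nat.pair_eq_pair.1
          (Nat.eq_of_mul_eq_mul_left (Nat.succ_pos 8) (Nat.add_right_cancel h))
        rw [ih1 h1, ih2 h2]
  | all x A ih | ex x A ih =>
    intro C h
    cases C <;> simp only [code] at h <;>
      first
      | (exfalso; omega)
      | obtain ⟨h1, h2⟩ := Nat.pair_eq_pair.1
          (Nat.eq_of_mul_eq_mul_left (Nat.succ_pos 8) (Nat.add_right_cancel h))
        rw [h1, ih h2]

instance : Countable ZFForm := ZFForm.code_injective.countable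

instance : Nonempty ZFForm := ⟨.top⟩

namespace Der

variable {Ax : Set ZFForm}

/-- The free variables of the formulas in `Γ` are bounded. -/
def BoundedFV (Γ : Set ZFForm) : Prop := ∃ N, ∀ B ∈ Γ, ∀ x ∈ B.FV, x < N

theorem exists_henkin_step (Γ : Set ZFForm) (hΓ : BoundedFV Γ) (A : ZFForm) :
    ∃ Γ' : Set ZFForm, Γ ⊆ Γ' ∧ BoundedFV Γ' ∧
      (∀ B : ZFForm, B.FV = ∅ → Der Ax Γ' B → Der Ax Γ B) ∧
      ∀ x C, A = .ex x C → Der Ax Γ A → ∃ c, Der Ax Γ' (C.renameFree x (2 * c)) := by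
  by_cases h : ∃ x C, A = .ex x C ∧ Der Ax Γ A
  · obtain ⟨x, C, rfl, hd⟩ := h
    obtain ⟨N, hN⟩ := hΓ
    obtain ⟨c, hc, hcs, -⟩ := exists_fresh C (Finset.range N)
    refine ⟨insert (C.renameFree x (2 * c)) Γ, Set.subset_insert _ _, ?_, ?_, ?_⟩
    · refine ⟨N + (C.renameFree x (2 * c)).FV.sup id + 1, ?_⟩
      rintro B (rfl | hB) y hy
      · have : y ≤ (C.renameFree x (2 * c)).FV.sup id := Finset.le_sup (f := id) hy
        omega
      · have := hN B hB y hy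
        omega
    · intro B hB hd'
      refine exE (iff1 (.thm (exFresh hc)) hd) hd' ?_ (by simp [hB])
      intro D hD hcD
      exact hcs (Finset.mem_range.2 (hN D hD _ hcD))
    · rintro _ _ ⟨⟩ _
      exact ⟨c, hyp0⟩
  · push Not at h
    exact ⟨Γ, subset_rfl, hΓ, fun _ _ h => h, fun x C e hd => (h x C e hd).elim⟩

/-- Every set of sentences has a conservative Henkin extension. -/
theorem exists_henkin (Γ : Set ZFForm) (hΓ : ∀ B ∈ Γ, B.FV = ∅) :
    ∃ Δ : Set ZFForm, Γ ⊆ Δ ∧ (∀ B : ZFForm, B.FV = ∅ → Der Ax Δ B → Der Ax Γ B) ∧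
      ∀ x C, Der Ax Δ (.ex x C) → ∃ c, Der Ax Δ (C.renameFree x (2 * c)) := by
  obtain ⟨e, he⟩ := exists_surjective_nat ZFForm
  choose! f hf1 hf2 hf3 hf4 using exists_henkin_step (Ax := Ax)
  let G : ℕ → Set ZFForm := fun n => Nat.rec Γ (fun n S => f S (e n.unpair.1)) n
  have hb : ∀ n, BoundedFV (G n) := by
    intro n
    induction n with
    | zero => exact ⟨0, fun B hB x hx => by
        have hB' : B ∈ Γ := hB
        simp [hΓ B hB'] at hx⟩
    | succ n ih => exact hf2 _ ih _
  have hmono : Monotone G := monotone_nat_of_le_succ fun n => hf1 _ (hb n) _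
  have hcomp : ∀ {A}, Der Ax (⋃ n, G n) A → ∃ n, Der Ax (G n) A := by
    intro A h
    induction h with
    | hyp h => obtain ⟨n, hn⟩ := Set.mem_iUnion.1 h; exact ⟨n, .hyp hn⟩
    | thm h => exact ⟨0, .thm h⟩
    | mp _ _ ih1 ih2 =>
      obtain ⟨n, hn⟩ := ih1
      obtain ⟨m, hm⟩ := ih2
      exact ⟨max n m, .mp (hn.mono (hmono (le_max_left _ _))) (hm.mono (hmono (le_max_right _ _)))⟩
  refine ⟨⋃ n, G n, Set.subset_iUnion G 0, ?_, ?_⟩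
  · intro B hB h
    obtain ⟨n, hn⟩ := hcomp h
    induction n with
    | zero => exact hn
    | succ n ih => exact ih (hf3 _ (hb n) _ B hB hn)
  · intro x C h
    obtain ⟨n, hn⟩ := hcomp h
    obtain ⟨m, hm⟩ := he (.ex x C)
    have h1 : n ≤ Nat.pair m n := Nat.right_le_pair _ _
    have hd : Der Ax (G (Nat.pair m n)) (e (Nat.pair m n).unpair.1) := by
      rw [Nat.unpair_pair]
      simp only [hm]
      exact hn.mono (hmono h1)
    obtain ⟨c, hc⟩ := hf4 _ (hb _) _ x C (by rw [Nat.unpair_pair]; exact hm) hd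
    exact ⟨c, hc.mono (Set.subset_iUnion G (Nat.pair m n + 1))⟩

end Der

/-- Every set of sentences is contained in a conservative Henkin theory. -/
theorem HenkinTheory.exists_conservative (Ax Γ : Set ZFForm) (hΓ : ∀ B ∈ Γ, B.FV = ∅) :
    ∃ H : HenkinTheory Ax, ∀ B : ZFForm, B.FV = ∅ → ∀ τ, H.V B τ ↔ Der Ax Γ B := by
  obtain ⟨Δ, h1, h2, h3⟩ := Der.exists_henkin (Ax := Ax) Γ hΓ
  have upd : ∀ (τ : ℕ → ℕ) x c, (fun n => 2 * Function.update τ x c n) =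
      Function.update (fun n => 2 * τ n) x (2 * c) := fun τ x c => by
    funext n
    by_cases h : n = x
    · subst h; simp
    · simp [Function.update_of_ne h]
  refine ⟨{ V := fun A τ => Der Ax Δ (A.sub fun n => 2 * τ n)
            vmem := fun a b => Der Ax Δ (.mem (2 * a) (2 * b))
            veq := fun a b => Der Ax Δ (.eq (2 * a) (2 * b))
            mem_iff := Iff.rfl
            eq_iff := Iff.rfl
            thm := fun h => .thm (Der.sub_of_prov h _)
            mp := fun h h' => .mp h h'
            congr := fun h => by rw [sub_congr fun z hz => by rw [h z hz]]
            rename := fun h => by rw [sub_renameFree h, upd]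
            inst := ?_
            wit := ?_ }, ?_⟩
  · intro A x τ h c
    have := Der.allE (freeFor_sub c _) h
    rwa [sub_update_renameFree (fun z _ _ => by omega), ← upd] at this
  · intro A x τ h
    obtain ⟨c, hc⟩ := h3 _ _ h
    refine ⟨c, ?_⟩
    rwa [sub_update_renameFree (fun z _ _ => by omega), ← upd] at hc
  · intro B hB τ
    have hi : ∀ Θ, Der Ax Θ (B.biimp (B.sub fun n => 2 * τ n)) := fun Θ =>
      .thm (Der.iff_sub (by simp [hB]))
    exact ⟨fun h => h2 B hB (Der.iff2 (hi _) h), fun h => Der.iff1 (hi _) (h.mono h1)⟩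

namespace HenkinTheory

variable {Ax : Set ZFForm} (H : HenkinTheory Ax) {A B C : ZFForm} {τ : ℕ → ℕ} {x : ℕ}

/-- The statements of a Henkin theory are closed under derivability. -/
theorem of_der {Γ : Set ZFForm} (h : Der Ax Γ A) (hΓ : ∀ B ∈ Γ, H.V B τ) : H.V A τ := by
  induction h with
  | hyp h => exact hΓ _ h
  | thm h => exact H.thm h
  | mp _ _ ih1 ih2 => exact H.mp ih1 ih2

theorem and_iff : H.V (A.and B) τ ↔ H.V A τ ∧ H.V B τ :=
  ⟨fun h => ⟨H.mp (H.thm .andE1) h, H.mp (H.thm .andE2) h⟩,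
    fun h => H.mp (H.mp (H.thm .andI) h.1) h.2⟩

theorem or_left (h : H.V A τ) : H.V (A.or B) τ := H.mp (H.thm .orI1) h

theorem or_right (h : H.V B τ) : H.V (A.or B) τ := H.mp (H.thm .orI2) h

theorem biimp1 (h : H.V (A.biimp B) τ) (hA : H.V A τ) : H.V B τ := H.mp (H.and_iff.1 h).1 hA

theorem biimp2 (h : H.V (A.biimp B) τ) (hB : H.V B τ) : H.V A τ := H.mp (H.and_iff.1 h).2 hB

theorem ex_intro {c : ℕ} (h : H.V A (Function.update τ x c)) : H.V (.ex x A) τ := by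
  have h1 : H.V (.ex x A) (Function.update τ x c) :=
    H.mp (H.thm (.exI (y := x) (freeFor_self x A))) (by rwa [renameFree_self])
  refine (H.congr fun z hz => ?_).1 h1
  rw [Function.update_of_ne]
  rintro rfl
  simp [FV] at hz

theorem congr_eq (hAx : zfEqAxioms ⊆ Ax) {a b : ℕ} (hab : H.veq a b)
    (h : H.V A (Function.update τ x a)) : H.V A (Function.update τ x b) := by
  obtain ⟨y, -, -, hy, hyx⟩ := exists_fresh A (insert x A.FV)
  simp only [Finset.mem_insert, not_or] at hyx
  set τ' := Function.update (Function.update τ x a) y b with hτ'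
  have hzy : ∀ z ∈ A.FV, z ≠ y := fun z hz e => hyx.2 (e ▸ hz)
  have e1 : τ' x = a := by simp [hτ', Function.update_of_ne (Ne.symm hyx.1)]
  have e2 : τ' y = b := by simp [hτ']
  have h1 : H.V A τ' := (H.congr (τ := Function.update τ x a) fun z hz => by
    rw [hτ', Function.update_of_ne (hzy z hz)]).1 h
  have h2 : H.V (.eq x y) τ' := H.eq_iff.2 (by rwa [e1, e2])
  have h3 := H.biimp1 (H.mp (H.thm (Der.leibniz hAx (freeFor_of_not_occurs hy))) h2) h1
  rw [H.rename (freeFor_of_not_occurs hy), e2] at h3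
  refine (H.congr fun z hz => ?_).1 h3
  by_cases hzx : z = x
  · subst hzx; simp
  · rw [Function.update_of_ne hzx, Function.update_of_ne hzx, hτ',
      Function.update_of_ne (hzy z hz), Function.update_of_ne hzx]

theorem veq_refl (hAx : zfEqAxioms ⊆ Ax) (a : ℕ) : H.veq a a :=
  (H.eq_iff (i := 0) (j := 0) (τ := fun _ => a)).1 (H.thm (.axm (hAx (.inl ⟨0, rfl⟩))))

theorem veq_symm (hAx : zfEqAxioms ⊆ Ax) {a b : ℕ} (h : H.veq a b) : H.veq b a := by
  have := H.congr_eq hAx (A := .eq 0 1) (x := 0) (τ := fun _ => a) h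
    (H.eq_iff.2 (by simpa using H.veq_refl hAx a))
  simpa [H.eq_iff] using this

theorem veq_trans (hAx : zfEqAxioms ⊆ Ax) {a b c : ℕ} (h : H.veq a b) (h' : H.veq b c) :
    H.veq a c := by
  have := H.congr_eq hAx (A := .eq 0 1) (x := 1) (τ := fun _ => a) h'
    (H.eq_iff.2 (by simpa using h))
  simpa [H.eq_iff] using this

theorem vmem_congr (hAx : zfEqAxioms ⊆ Ax) {a a' b b' : ℕ} (h : H.veq a a') (h' : H.veq b b')
    (hm : H.vmem a b) : H.vmem a' b' := by
  have h1 := H.congr_eq hAx (A := .mem 0 1) (x := 1) (τ := fun _ => a) h'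
    (H.mem_iff.2 (by simpa using hm))
  have h2 := H.congr_eq hAx (A := .mem 0 1) (x := 0) (τ := fun _ => b') h
    (H.mem_iff.2 (by simpa [H.mem_iff] using h1))
  simpa [H.mem_iff] using h2

end HenkinTheory

end Henkin

/-! ## Kripke names and forcing over a Henkin theory -/

/-- Names for sets in a Kripke model over `P` above whose nodes a Henkin theory is placed: a family
of members, each present on an upper set of nodes, and the parameter that denotes the set in the
Henkin theory. -/
inductive Nm (P : Type) [Preorder P] : Type 1
  | mk (ι : Type) (f : ι → Nm P) (U : ι → UpperSet P) (a : ℕ) : Nm P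

section Forcing

open ZFForm

variable {P : Type} [Preorder P] {Ax : Set ZFForm}

namespace Nm

/-- The index type of the members of a name. -/
def I : Nm P → Type
  | mk ι _ _ _ => ι

/-- The members of a name. -/
def fam : (x : Nm P) → x.I → Nm P
  | mk _ f _ _ => f

/-- The nodes at which a member is present. -/
def dom : (x : Nm P) → x.I → UpperSet P
  | mk _ _ U _ => U

/-- The parameter of a name. -/
def a : Nm P → ℕ
  | mk _ _ _ a => a

/-- Forced equality of names at a node. -/
def Eqv (H : HenkinTheory Ax) : Nm P → Nm P → P → Prop
  | mk ι f U a, mk κ g W b, v => H.veq a b ∧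
      (∀ w, v ≤ w → ∀ i, w ∈ U i → H.vmem (f i).a a →
        ∃ j, w ∈ W j ∧ H.vmem (g j).a b ∧ Eqv H (f i) (g j) w) ∧
      (∀ w, v ≤ w → ∀ j, w ∈ W j → H.vmem (g j).a b →
        ∃ i, w ∈ U i ∧ H.vmem (f i).a a ∧ Eqv H (f i) (g j) w)

/-- Forced membership of names at a node. -/
def Mem (H : HenkinTheory Ax) (x y : Nm P) (v : P) : Prop :=
  ∃ j, v ∈ y.dom j ∧ H.vmem (y.fam j).a y.a ∧ Eqv H x (y.fam j) v

variable {H : HenkinTheory Ax} {x y z : Nm P} {v w : P}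

theorem Eqv.mono (h : Eqv H x y v) (hw : v ≤ w) : Eqv H x y w := by
  obtain ⟨ι, f, U, a⟩ := x
  obtain ⟨κ, g, W, b⟩ := y
  simp only [Eqv] at h ⊢
  exact ⟨h.1, fun u hu => h.2.1 u (hw.trans hu), fun u hu => h.2.2 u (hw.trans hu)⟩

theorem Eqv.veq (h : Eqv H x y v) : H.veq x.a y.a := by
  obtain ⟨ι, f, U, a⟩ := x
  obtain ⟨κ, g, W, b⟩ := y
  simp only [Eqv] at h
  exact h.1

theorem Mem.mono (h : Mem H x y v) (hw : v ≤ w) : Mem H x y w := by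
  obtain ⟨j, h1, h2, h3⟩ := h
  exact ⟨j, (y.dom j).upper hw h1, h2, h3.mono hw⟩

theorem Eqv.refl (hE : zfEqAxioms ⊆ Ax) (x : Nm P) (v : P) : Eqv H x x v := by
  induction x generalizing v with
  | mk ι f U a ih =>
    simp only [Eqv]
    exact ⟨H.veq_refl hE a, fun w _ i h1 h2 => ⟨i, h1, h2, ih i w⟩,
      fun w _ i h1 h2 => ⟨i, h1, h2, ih i w⟩⟩

theorem Eqv.symm (hE : zfEqAxioms ⊆ Ax) (h : Eqv H x y v) : Eqv H y x v := by
  induction x generalizing y v with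
  | mk ι f U a ih =>
    obtain ⟨κ, g, W, b⟩ := y
    simp only [Eqv] at h ⊢
    refine ⟨H.veq_symm hE h.1, fun w hw j h1 h2 => ?_, fun w hw i h1 h2 => ?_⟩
    · obtain ⟨i, h3, h4, h5⟩ := h.2.2 w hw j h1 h2
      exact ⟨i, h3, h4, ih i h5⟩
    · obtain ⟨j, h3, h4, h5⟩ := h.2.1 w hw i h1 h2
      exact ⟨j, h3, h4, ih i h5⟩

theorem Eqv.trans (hE : zfEqAxioms ⊆ Ax) (h : Eqv H x y v) (h' : Eqv H y z v) :
    Eqv H x z v := by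
  induction x generalizing y z v with
  | mk ι f U a ih =>
    obtain ⟨κ, g, W, b⟩ := y
    obtain ⟨μ, k, X, c⟩ := z
    simp only [Eqv] at h h' ⊢
    refine ⟨H.veq_trans hE h.1 h'.1, fun w hw i h1 h2 => ?_, fun w hw l h1 h2 => ?_⟩
    · obtain ⟨j, h3, h4, h5⟩ := h.2.1 w hw i h1 h2
      obtain ⟨l, h6, h7, h8⟩ := h'.2.1 w hw j h3 h4
      exact ⟨l, h6, h7, ih i h5 h8⟩
    · obtain ⟨j, h3, h4, h5⟩ := h'.2.2 w hw l h1 h2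
      obtain ⟨i, h6, h7, h8⟩ := h.2.2 w hw j h3 h4
      exact ⟨i, h6, h7, ih i h8 h5⟩

theorem Mem.vmem (hE : zfEqAxioms ⊆ Ax) (h : Mem H x y v) : H.vmem x.a y.a := by
  obtain ⟨j, h1, h2, h3⟩ := h
  exact H.vmem_congr hE (H.veq_symm hE h3.veq) (H.veq_refl hE _) h2

theorem Mem.congr_left (hE : zfEqAxioms ⊆ Ax) (h : Mem H x y v) (hx : Eqv H x z v) :
    Mem H z y v := by
  obtain ⟨j, h1, h2, h3⟩ := h
  exact ⟨j, h1, h2, (hx.symm hE).trans hE h3⟩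

theorem Mem.congr_right (hE : zfEqAxioms ⊆ Ax) (h : Mem H x y v) (hy : Eqv H y z v) :
    Mem H x z v := by
  obtain ⟨κ, g, W, b⟩ := y
  obtain ⟨μ, k, X, c⟩ := z
  obtain ⟨j, h1, h2, h3⟩ := h
  simp only [Eqv] at hy
  obtain ⟨l, h4, h5, h6⟩ := hy.2.1 v le_rfl j h1 h2
  exact ⟨l, h4, h5, h3.trans hE h6⟩

/-- Names are equal as soon as their parameters are equal and they have the same members. -/
theorem Eqv.of_mem (hE : zfEqAxioms ⊆ Ax) (h0 : H.veq x.a y.a)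
    (h1 : ∀ w, v ≤ w → ∀ d, Mem H d x w → Mem H d y w)
    (h2 : ∀ w, v ≤ w → ∀ d, Mem H d y w → Mem H d x w) : Eqv H x y v := by
  obtain ⟨ι, f, U, a⟩ := x
  obtain ⟨κ, g, W, b⟩ := y
  simp only [Eqv]
  refine ⟨h0, fun w hw i h3 h4 => ?_, fun w hw j h3 h4 => ?_⟩
  · exact h1 w hw (f i) ⟨i, h3, h4, Eqv.refl hE _ _⟩
  · obtain ⟨i, h5, h6, h7⟩ := h2 w hw (g j) ⟨j, h3, h4, Eqv.refl hE _ _⟩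
    exact ⟨i, h5, h6, h7.symm hE⟩

/-- The parameters of the values of an assignment. -/
def par (ρ : ℕ → Nm P) : ℕ → ℕ := fun n => (ρ n).a

@[simp] theorem par_update (ρ : ℕ → Nm P) (x : ℕ) (d : Nm P) :
    par (Function.update ρ x d) = Function.update (par ρ) x d.a := by
  funext n
  by_cases h : n = x
  · subst h; simp [par]
  · simp [par, Function.update_of_ne h]

end Nm

open Nm

/-- Forcing over a Henkin theory. -/
def RF (H : HenkinTheory Ax) : ZFForm → P → (ℕ → Nm P) → Prop
  | .mem i j, v, ρ => Mem H (ρ i) (ρ j) v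
  | .eq i j, v, ρ => Eqv H (ρ i) (ρ j) v
  | .bot, _, _ => False
  | .top, _, _ => True
  | .and A B, v, ρ => RF H A v ρ ∧ RF H B v ρ
  | .or A B, v, ρ => RF H A v ρ ∨ RF H B v ρ
  | .imp A B, v, ρ => H.V (A.imp B) (par ρ) ∧ ∀ w, v ≤ w → RF H A w ρ → RF H B w ρ
  | .all x A, v, ρ => H.V (.all x A) (par ρ) ∧ ∀ d, RF H A v (Function.update ρ x d)
  | .ex x A, v, ρ => ∃ d, RF H A v (Function.update ρ x d)

variable {H : HenkinTheory Ax} {A B C : ZFForm} {v w : P} {ρ ρ' : ℕ → Nm P} {x y : ℕ}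

theorem RF.mono (h : RF H A v ρ) (hw : v ≤ w) : RF H A w ρ := by
  induction A generalizing ρ with
  | mem i j => exact Nm.Mem.mono h hw
  | eq i j => exact Nm.Eqv.mono h hw
  | bot => exact h
  | top => exact h
  | and A B ih1 ih2 => exact ⟨ih1 h.1, ih2 h.2⟩
  | or A B ih1 ih2 => exact h.imp ih1 ih2
  | imp A B _ _ => exact ⟨h.1, fun u hu => h.2 u (hw.trans hu)⟩
  | all x A ih => exact ⟨h.1, fun d => ih (h.2 d)⟩
  | ex x A ih => exact h.imp fun d => ih

theorem RF.toV (hE : zfEqAxioms ⊆ Ax) (h : RF H A v ρ) : H.V A (par ρ) := by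
  induction A generalizing ρ with
  | mem i j => exact H.mem_iff.2 (Nm.Mem.vmem hE h)
  | eq i j => exact H.eq_iff.2 (Nm.Eqv.veq h)
  | bot => exact h.elim
  | top => exact H.thm .topI
  | and A B ih1 ih2 => exact H.and_iff.2 ⟨ih1 h.1, ih2 h.2⟩
  | or A B ih1 ih2 => exact h.elim (fun h => H.or_left (ih1 h)) fun h => H.or_right (ih2 h)
  | imp A B _ _ => exact h.1
  | all x A ih => exact h.1
  | ex x A ih =>
    obtain ⟨d, hd⟩ := h
    exact H.ex_intro (by simpa using ih hd)

theorem update_congr_FV {X : Type*} {ρ ρ' : ℕ → X} {s : Finset ℕ} {x : ℕ}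
    (h : ∀ z ∈ s.erase x, ρ z = ρ' z) (d : X) :
    ∀ z ∈ s, Function.update ρ x d z = Function.update ρ' x d z := by
  intro z hz
  by_cases hzx : z = x
  · subst hzx; simp
  · rw [Function.update_of_ne hzx, Function.update_of_ne hzx, h z (Finset.mem_erase.2 ⟨hzx, hz⟩)]

theorem RF.congr (h : ∀ z ∈ A.FV, ρ z = ρ' z) : RF H A v ρ ↔ RF H A v ρ' := by
  have hV : H.V A (par ρ) ↔ H.V A (par ρ') :=
    H.congr fun z hz => by simp only [par, h z hz]
  induction A generalizing ρ ρ' v with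
  | mem i j => simp only [RF, h i (by simp [FV]), h j (by simp [FV])]
  | eq i j => simp only [RF, h i (by simp [FV]), h j (by simp [FV])]
  | bot => exact Iff.rfl
  | top => exact Iff.rfl
  | and A B ih1 ih2 =>
    have h1 : ∀ z ∈ A.FV, ρ z = ρ' z := fun z hz => h z (by simp [FV, hz])
    have h2 : ∀ z ∈ B.FV, ρ z = ρ' z := fun z hz => h z (by simp [FV, hz])
    exact and_congr (ih1 h1 (H.congr fun z hz => by simp only [par, h1 z hz]))
      (ih2 h2 (H.congr fun z hz => by simp only [par, h2 z hz]))
  | or A B ih1 ih2 =>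
    have h1 : ∀ z ∈ A.FV, ρ z = ρ' z := fun z hz => h z (by simp [FV, hz])
    have h2 : ∀ z ∈ B.FV, ρ z = ρ' z := fun z hz => h z (by simp [FV, hz])
    exact or_congr (ih1 h1 (H.congr fun z hz => by simp only [par, h1 z hz]))
      (ih2 h2 (H.congr fun z hz => by simp only [par, h2 z hz]))
  | imp A B ih1 ih2 =>
    have h1 : ∀ z ∈ A.FV, ρ z = ρ' z := fun z hz => h z (by simp [FV, hz])
    have h2 : ∀ z ∈ B.FV, ρ z = ρ' z := fun z hz => h z (by simp [FV, hz])
    exact and_congr hV (forall_congr' fun w => imp_congr_right fun _ =>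
      imp_congr (ih1 h1 (H.congr fun z hz => by simp only [par, h1 z hz]))
        (ih2 h2 (H.congr fun z hz => by simp only [par, h2 z hz])))
  | all x A ih =>
    refine and_congr hV (forall_congr' fun d => ?_)
    have h1 := update_congr_FV h d
    exact ih h1 (H.congr fun z hz => by simp only [par, h1 z hz])
  | ex x A ih =>
    refine exists_congr fun d => ?_
    have h1 := update_congr_FV h d
    exact ih h1 (H.congr fun z hz => by simp only [par, h1 z hz])

theorem RF.update_iff (h : x ∉ A.FV) (d : Nm P) :
    RF H A v (Function.update ρ x d) ↔ RF H A v ρ :=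
  RF.congr fun z hz => Function.update_of_ne (fun e : z = x => h (e ▸ hz)) _ _

theorem RF.renameFree (hf : A.freeFor y x) :
    RF H (A.renameFree x y) v ρ ↔ RF H A v (Function.update ρ x (ρ y)) := by
  have hV := H.rename (τ := par ρ) hf
  induction A generalizing ρ v with
  | mem i j =>
    simp only [ZFForm.renameFree, RF, Function.update_apply]
    split_ifs <;> rfl
  | eq i j =>
    simp only [ZFForm.renameFree, RF, Function.update_apply]
    split_ifs <;> rfl
  | bot => exact Iff.rfl
  | top => exact Iff.rfl
  | and A B ih1 ih2 =>
    exact and_congr (ih1 hf.1 (H.rename hf.1)) (ih2 hf.2 (H.rename hf.2))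
  | or A B ih1 ih2 =>
    exact or_congr (ih1 hf.1 (H.rename hf.1)) (ih2 hf.2 (H.rename hf.2))
  | imp A B ih1 ih2 =>
    refine and_congr ?_ (forall_congr' fun w => imp_congr_right fun _ =>
      imp_congr (ih1 hf.1 (H.rename hf.1)) (ih2 hf.2 (H.rename hf.2)))
    rw [par_update]
    exact hV
  | all z A ih =>
    by_cases hx : x ∉ (ZFForm.all z A).FV
    · rw [ZFForm.renameFree_of_notMem hx, RF.update_iff hx]
    have hz : z ≠ x := fun e => hx (by simp [FV, e])
    obtain ⟨hyz, hf'⟩ := (show x ∉ (ZFForm.all z A).FV ∨ _ from hf).resolve_left hx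
    simp only [ZFForm.renameFree, if_neg hz] at hV ⊢
    refine and_congr (by rw [par_update]; exact hV) (forall_congr' fun d => ?_)
    refine (ih (ρ := Function.update ρ z d) hf' (H.rename hf')).trans ?_
    rw [Function.update_of_ne hyz, Function.update_comm hz]
  | ex z A ih =>
    by_cases hx : x ∉ (ZFForm.ex z A).FV
    · rw [ZFForm.renameFree_of_notMem hx, RF.update_iff hx]
    have hz : z ≠ x := fun e => hx (by simp [FV, e])
    obtain ⟨hyz, hf'⟩ := (show x ∉ (ZFForm.ex z A).FV ∨ _ from hf).resolve_left hx
    simp only [ZFForm.renameFree, if_neg hz] at hV ⊢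
    refine exists_congr fun d => ?_
    refine (ih (ρ := Function.update ρ z d) hf' (H.rename hf')).trans ?_
    rw [Function.update_of_ne hyz, Function.update_comm hz]

theorem RF.congr_eqv (hE : zfEqAxioms ⊆ Ax) {d e : Nm P} (hd : Eqv H d e v)
    (h : RF H A v (Function.update ρ x d)) : RF H A v (Function.update ρ x e) := by
  induction A generalizing ρ v d e with
  | mem i j =>
    have hu : ∀ i, Eqv H (Function.update ρ x d i) (Function.update ρ x e i) v := fun i => by
      by_cases hi : i = x
      · subst hi; simpa using hd
      · simpa [Function.update_of_ne hi] using Eqv.refl hE _ _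
    exact (Nm.Mem.congr_left hE h (hu i)).congr_right hE (hu j)
  | eq i j =>
    have hu : ∀ i, Eqv H (Function.update ρ x d i) (Function.update ρ x e i) v := fun i => by
      by_cases hi : i = x
      · subst hi; simpa using hd
      · simpa [Function.update_of_ne hi] using Eqv.refl hE _ _
    exact (((hu i).symm hE).trans hE h).trans hE (hu j)
  | bot => exact h.elim
  | top => exact h
  | and A B ih1 ih2 => exact ⟨ih1 hd h.1, ih2 hd h.2⟩
  | or A B ih1 ih2 => exact h.imp (ih1 hd) (ih2 hd)
  | imp A B ih1 ih2 =>
    refine ⟨?_, fun w hw hA => ?_⟩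
    · rw [par_update]
      exact H.congr_eq hE hd.veq (by rw [← par_update]; exact h.1)
    · exact ih2 (hd.mono hw) (h.2 w hw (ih1 ((hd.mono hw).symm hE) hA))
  | all z A ih =>
    refine ⟨?_, fun c => ?_⟩
    · rw [par_update]
      exact H.congr_eq hE hd.veq (by rw [← par_update]; exact h.1)
    · have := h.2 c
      by_cases hz : z = x
      · subst hz
        simpa using this
      · rw [Function.update_comm (Ne.symm hz)] at this ⊢
        exact ih hd this
  | ex z A ih =>
    obtain ⟨c, this⟩ := h
    refine ⟨c, ?_⟩
    by_cases hz : z = x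
    · subst hz
      simpa using this
    · rw [Function.update_comm (Ne.symm hz)] at this ⊢
      exact ih hd this

/-- Forcing is sound for derivability. -/
theorem RF.of_prov (hE : zfEqAxioms ⊆ Ax)
    (hAx : ∀ A ∈ Ax, ∀ (v : P) (ρ : ℕ → Nm P), RF H A v ρ) (h : ZFProv Ax A) (v : P)
    (ρ : ℕ → Nm P) : RF H A v ρ := by
  induction h generalizing v ρ with
  | axm h => exact hAx _ h v ρ
  | k =>
    exact ⟨H.thm .k, fun w _ hA => ⟨H.mp (H.thm .k) (hA.toV hE), fun u hu _ => hA.mono hu⟩⟩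
  | s =>
    refine ⟨H.thm .s, fun w _ h1 => ⟨H.mp (H.thm .s) (h1.toV hE), fun u hu h2 =>
      ⟨H.mp (H.mp (H.thm .s) (h1.toV hE)) (h2.toV hE), fun t ht h3 => ?_⟩⟩⟩
    exact (h1.2 t (hu.trans ht) h3).2 t le_rfl (h2.2 t ht h3)
  | andI =>
    exact ⟨H.thm .andI, fun w _ h1 => ⟨H.mp (H.thm .andI) (h1.toV hE),
      fun u hu h2 => ⟨h1.mono hu, h2⟩⟩⟩
  | andE1 => exact ⟨H.thm .andE1, fun w _ h1 => h1.1⟩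
  | andE2 => exact ⟨H.thm .andE2, fun w _ h1 => h1.2⟩
  | orI1 => exact ⟨H.thm .orI1, fun w _ h1 => .inl h1⟩
  | orI2 => exact ⟨H.thm .orI2, fun w _ h1 => .inr h1⟩
  | orE =>
    exact ⟨H.thm .orE, fun w _ h1 => ⟨H.mp (H.thm .orE) (h1.toV hE), fun u hu h2 =>
      ⟨H.mp (H.mp (H.thm .orE) (h1.toV hE)) (h2.toV hE), fun t ht h3 =>
        h3.elim (h1.2 t (hu.trans ht)) (h2.2 t ht)⟩⟩⟩
  | botE => exact ⟨H.thm .botE, fun w _ h1 => h1.elim⟩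
  | topI => trivial
  | allE hf => exact ⟨H.thm (.allE hf), fun w _ h1 => (RF.renameFree hf).2 (h1.2 _)⟩
  | exI hf => exact ⟨H.thm (.exI hf), fun w _ h1 => ⟨_, (RF.renameFree hf).1 h1⟩⟩
  | allShift hx =>
    refine ⟨H.thm (.allShift hx), fun w _ h1 => ⟨H.mp (H.thm (.allShift hx)) (h1.toV hE),
      fun u hu h2 => ⟨H.mp (H.mp (H.thm (.allShift hx)) (h1.toV hE)) (h2.toV hE), fun d => ?_⟩⟩⟩
    exact (h1.2 d).2 u hu ((RF.update_iff hx d).2 h2)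
  | exShift hx =>
    refine ⟨H.thm (.exShift hx), fun w _ h1 => ⟨H.mp (H.thm (.exShift hx)) (h1.toV hE),
      fun u hu h2 => ?_⟩⟩
    obtain ⟨d, hd⟩ := h2
    exact (RF.update_iff hx d).1 ((h1.2 d).2 u hu hd)
  | mp _ _ ih1 ih2 => exact (ih1 v ρ).2 v le_rfl (ih2 v ρ)
  | gen h ih => exact ⟨H.thm (.gen h), fun d => ih v _⟩

/-- The equality axioms are forced. -/
theorem RF.of_mem_zfEqAxioms (hE : zfEqAxioms ⊆ Ax) (hA : A ∈ zfEqAxioms) (v : P)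
    (ρ : ℕ → Nm P) : RF H A v ρ := by
  have hV : H.V A (par ρ) := H.thm (.axm (hE hA))
  rcases hA with ⟨i, rfl⟩ | ⟨i, j, rfl⟩ | ⟨i, j, k, rfl⟩ | ⟨i, j, k, rfl⟩ | ⟨i, j, k, rfl⟩
  · exact Eqv.refl hE _ _
  · exact ⟨hV, fun w _ h => Eqv.symm hE h⟩
  · exact ⟨hV, fun w _ h => ⟨H.mp hV (h.toV hE), fun u hu h' =>
      Eqv.trans hE (Eqv.mono h hu) h'⟩⟩
  · exact ⟨hV, fun w _ h => ⟨H.mp hV (h.toV hE), fun u hu h' =>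
      Nm.Mem.congr_left hE h' (Eqv.mono h hu)⟩⟩
  · exact ⟨hV, fun w _ h => ⟨H.mp hV (h.toV hE), fun u hu h' =>
      Nm.Mem.congr_right hE h' (Eqv.mono h hu)⟩⟩

end Forcing

/-! ## Forcing the axioms of set theory -/

section Axioms

open ZFForm ZFAxioms Nm

variable {P : Type} [Preorder P] {Ax : Set ZFForm} {H : HenkinTheory Ax}
  {v w : P} {ρ : ℕ → Nm P} {d : Nm P}

namespace Nm

/-- `d` is forced to be equal to a member of the small family `G` of names. -/
def Bdd (H : HenkinTheory Ax) {κ : Type} (G : κ → Nm P) (v : P) (d : Nm P) : Prop :=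
  ∃ k, Eqv H d (G k) v

/-- The names whose members are taken from the family `G`. -/
def pow {κ : Type} (G : κ → Nm P) : (κ → UpperSet P) × ℕ → Nm P := fun Y => mk κ G Y.1 Y.2

theorem Bdd.pow (hE : zfEqAxioms ⊆ Ax) {κ : Type} {G : κ → Nm P}
    (h : ∀ w, v ≤ w → ∀ e, Mem H e d w → Bdd H G w e) : Bdd H (pow G) v d := by
  refine ⟨(fun k => ⟨{w | v ≤ w ∧ Mem H (G k) d w}, fun w u hwu hw =>
    ⟨hw.1.trans hwu, hw.2.mono hwu⟩⟩, d.a), Eqv.of_mem hE (H.veq_refl hE _) ?_ ?_⟩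
  · intro w hw e he
    obtain ⟨k, hk⟩ := h w hw e he
    have := he.congr_left hE hk
    have hm := this.vmem hE
    exact ⟨k, ⟨hw, this⟩, hm, hk⟩
  · rintro w hw e ⟨k, hk, -, he⟩
    exact hk.2.congr_left hE (he.symm hE)

theorem Bdd.of_mem {x : Nm P} (h : Mem H d x v) : Bdd H x.fam v d := by
  obtain ⟨j, -, -, hj⟩ := h
  exact ⟨j, hj⟩

end Nm

/-- Comprehension for a formula whose solutions are taken from a small family of names. -/
theorem RF.comprehension (hE : zfEqAxioms ⊆ Ax) {ψ : ZFForm} {z x : ℕ} (hz : z ∉ ψ.FV)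
    (hzx : z ≠ x) (hV : H.V (.ex z (.all x ((ZFForm.mem x z).biimp ψ))) (par ρ)) {κ : Type}
    (G : κ → Nm P)
    (hG : ∀ w, v ≤ w → ∀ d, RF H ψ w (Function.update ρ x d) → Bdd H G w d) :
    RF H (.ex z (.all x ((ZFForm.mem x z).biimp ψ))) v ρ := by
  obtain ⟨c, hc⟩ := H.wit hV
  set y : Nm P := mk κ G (fun k => ⟨{w | v ≤ w ∧ RF H ψ w (Function.update ρ x (G k))},
    fun w u hwu hw => ⟨hw.1.trans hwu, hw.2.mono hwu⟩⟩) c with hy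
  have hya : y.a = c := rfl
  have key : ∀ w d, RF H ψ w (Function.update (Function.update ρ z y) x d) ↔
      RF H ψ w (Function.update ρ x d) := fun w d => by
    rw [Function.update_comm hzx, RF.update_iff hz]
  refine ⟨y, by rw [par_update]; exact hc, fun d => ?_⟩
  have hV' := H.and_iff.1 (H.inst hc d.a)
  refine ⟨⟨by simpa [hya] using hV'.1, fun w hw h => ?_⟩,
    ⟨by simpa [hya] using hV'.2, fun w hw h => ?_⟩⟩
  · rw [key]
    simp only [RF, Function.update_self, Function.update_of_ne hzx] at h
    obtain ⟨k, hk, -, he⟩ := h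
    exact RF.congr_eqv hE (he.symm hE) hk.2
  · rw [key] at h
    simp only [RF, Function.update_self, Function.update_of_ne hzx]
    obtain ⟨k, hk⟩ := hG w hw d h
    have h1 := RF.congr_eqv hE hk h
    refine ⟨k, ⟨hw, h1⟩, ?_, hk⟩
    have h2 := H.inst hc (G k).a
    have h3 := H.biimp2 h2 (by
      have := ((key w (G k)).2 h1).toV hE
      simpa [hya] using this)
    rw [H.mem_iff, Function.update_self, Function.update_of_ne hzx, Function.update_self] at h3
    exact h3

theorem RF.pairAx (hE : zfEqAxioms ⊆ Ax) (hT : pairAx ∈ Ax) : RF H pairAx v ρ := by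
  have hV := H.thm (τ := par ρ) (.axm hT)
  refine ⟨hV, fun d => ?_⟩
  have hV1 := H.inst hV d.a
  refine ⟨by simpa using hV1, fun e => ?_⟩
  have hV2 := H.inst hV1 e.a
  refine RF.comprehension hE (by simp [FV]) (by decide) (by simpa using hV2)
    (fun b : Bool => if b then d else e) fun w _ s h => ?_
  simp only [RF, Function.update_self, Function.update_apply, Bdd] at h ⊢
  rcases h with h | h
  · exact ⟨true, by simpa using h⟩
  · exact ⟨false, by simpa using h⟩

theorem RF.unionAx (hE : zfEqAxioms ⊆ Ax) (hT : unionAx ∈ Ax) : RF H unionAx v ρ := by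
  have hV := H.thm (τ := par ρ) (.axm hT)
  refine ⟨hV, fun d => ?_⟩
  have hV1 := H.inst hV d.a
  refine RF.comprehension hE (by simp [FV]) (by decide) (by simpa using hV1)
    (fun p : Σ i : d.I, (d.fam i).I => (d.fam p.1).fam p.2) fun w _ s h => ?_
  obtain ⟨e, h1, h2⟩ := h
  simp only [RF, Function.update_self, Function.update_apply, Bdd] at h1 h2 ⊢
  norm_num at h1 h2
  obtain ⟨i, -, -, hi⟩ := h1
  obtain ⟨j, -, -, hj⟩ := h2.congr_right hE hi
  exact ⟨⟨i, j⟩, hj⟩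

theorem RF.powAx (hE : zfEqAxioms ⊆ Ax) (hT : powAx ∈ Ax) : RF H powAx v ρ := by
  have hV := H.thm (τ := par ρ) (.axm hT)
  refine ⟨hV, fun d => ?_⟩
  have hV1 := H.inst hV d.a
  refine RF.comprehension hE (by simp [FV]) (by decide) (by simpa using hV1)
    (pow d.fam) fun w _ s h => Bdd.pow hE fun u hu e he => Bdd.of_mem (x := d) ?_
  have := (h.2 e).2 u hu
  simp only [RF, Function.update_apply] at this
  norm_num at this
  exact this he

theorem RF.sepAx (hE : zfEqAxioms ⊆ Ax) {φ : ZFForm} (hφ : 1 ∉ φ.FV) (hT : sepAx φ ∈ Ax) :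
    RF H (sepAx φ) v ρ := by
  have hV := H.thm (τ := par ρ) (.axm hT)
  refine ⟨hV, fun d => ?_⟩
  have hV1 := H.inst hV d.a
  refine RF.comprehension hE (by simp [FV, hφ]) (by decide) (by simpa using hV1)
    d.fam fun w _ s h => Bdd.of_mem ?_
  have := h.1
  simp only [RF, Function.update_apply] at this
  norm_num at this
  exact this

theorem RF.expAx (hE : zfEqAxioms ⊆ Ax) (hT : expAx ∈ Ax) : RF H expAx v ρ := by
  have hV := H.thm (τ := par ρ) (.axm hT)
  refine ⟨hV, fun d => ?_⟩
  have hV1 := H.inst hV d.a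
  refine ⟨by simpa using hV1, fun e => ?_⟩
  have hV2 := H.inst hV1 e.a
  refine RF.comprehension hE (by decide) (by decide) (by simpa using hV2)
    (pow (pow (pow (Sum.elim d.fam e.fam)))) fun w _ s h => Bdd.pow hE fun w1 hw1 q hq =>
      Bdd.pow hE fun w2 hw2 r hr => Bdd.pow hE fun w3 hw3 t ht => ?_
  have h1 := (h.1.2 q).2 w1 hw1 (by simpa [RF, Function.update_apply] using hq)
  obtain ⟨u, p, ⟨hu, hp⟩, h2⟩ := h1
  simp only [RF, Function.update_apply] at hu hp
  norm_num at hu hp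
  have h3 := (h2.2 r).1.2 w2 hw2 (by simpa [RF, Function.update_apply] using hr)
  have key : Eqv H t u w3 ∨ Eqv H t p w3 := by
    rcases h3 with h3 | h3
    · have := (h3.2 t).1.2 w3 hw3 (by simpa [RF, Function.update_apply] using ht)
      simp only [RF, Function.update_apply] at this
      norm_num at this
      exact .inl this
    · have := (h3.2 t).1.2 w3 hw3 (by simpa [RF, Function.update_apply] using ht)
      simp only [RF, Function.update_apply] at this
      norm_num at this
      exact this
  rcases key with key | key
  · obtain ⟨j, -, -, hj⟩ := (hu.mono (hw2.trans hw3)).congr_left hE (key.symm hE)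
    exact ⟨.inl j, hj⟩
  · obtain ⟨j, -, -, hj⟩ := (hp.mono (hw2.trans hw3)).congr_left hE (key.symm hE)
    exact ⟨.inr j, hj⟩

theorem RF.empAx (hT : empAx ∈ Ax) : RF H empAx v ρ := by
  obtain ⟨c, hc⟩ := H.wit (H.thm (τ := par ρ) (.axm hT))
  refine ⟨mk Empty Empty.elim Empty.elim c, by simpa [a] using hc, fun d => ⟨?_, fun w _ h => ?_⟩⟩
  · rw [par_update, par_update]
    exact H.inst hc d.a
  · simp only [RF, Function.update_apply] at h
    norm_num at h
    obtain ⟨j, -⟩ := h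
    exact j.elim

theorem RF.extAx (hE : zfEqAxioms ⊆ Ax) (hT : extAx ∈ Ax) : RF H extAx v ρ := by
  have hV := H.thm (τ := par ρ) (.axm hT)
  refine ⟨hV, fun d => ?_⟩
  have hV1 := H.inst hV d.a
  refine ⟨by simpa using hV1, fun e => ?_⟩
  have hV2 := H.and_iff.1 (H.inst hV1 e.a)
  refine ⟨⟨by simpa using hV2.1, fun w hw h => ?_⟩, ⟨by simpa using hV2.2, fun w hw h => ?_⟩⟩
  · have hVa := H.mp (by simpa using hV2.1) (h.toV hE)
    refine ⟨hVa, fun s => ?_⟩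
    have hVb := H.and_iff.1 (H.inst hVa s.a)
    simp only [RF, Function.update_apply] at h
    norm_num at h
    refine ⟨⟨by simpa using hVb.1, fun u hu h' => ?_⟩, ⟨by simpa using hVb.2, fun u hu h' => ?_⟩⟩
    · simp only [RF, Function.update_apply] at h' ⊢
      norm_num at h' ⊢
      exact h'.congr_right hE (h.mono hu)
    · simp only [RF, Function.update_apply] at h' ⊢
      norm_num at h' ⊢
      exact h'.congr_right hE ((h.mono hu).symm hE)
  · have hVa := H.mp (by simpa using hV2.2) (h.toV hE)
    rw [H.eq_iff] at hVa
    simp only [RF, Function.update_apply]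
    norm_num
    refine Eqv.of_mem hE (by simpa [Function.update_apply] using hVa) (fun u hu s hs => ?_)
      fun u hu s hs => ?_
    · have := (h.2 s).1.2 u hu (by simpa [RF, Function.update_apply] using hs)
      simpa [RF, Function.update_apply] using this
    · have := (h.2 s).2.2 u hu (by simpa [RF, Function.update_apply] using hs)
      simpa [RF, Function.update_apply] using this

theorem RF.indAx (hE : zfEqAxioms ⊆ Ax) {φ : ZFForm} (hφ : 1 ∉ φ.FV) (hf : φ.freeFor 1 0)
    (hT : indAx φ ∈ Ax) : RF H (indAx φ) v ρ := by
  have hV := H.thm (τ := par ρ) (.axm hT)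
  refine ⟨hV, fun w hw h => ⟨H.mp hV (h.toV hE), fun d => ?_⟩⟩
  suffices ∀ w, v ≤ w → RF H (.all 0 ((ZFForm.all 1 ((ZFForm.mem 1 0).imp
      (φ.renameFree 0 1))).imp φ)) w ρ → RF H φ w (Function.update ρ 0 d) from this w hw h
  clear h hw w
  induction d with
  | mk ι f U a ih =>
    intro w hw h
    have hall : H.V (.all 1 ((ZFForm.mem 1 0).imp (φ.renameFree 0 1)))
        (par (Function.update ρ 0 (mk ι f U a))) := by
      have h0 : H.V (.all 0 φ) (par (Function.update ρ 0 (mk ι f U a))) := by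
        rw [par_update]
        exact (H.congr fun z hz => (Function.update_of_ne (Finset.ne_of_mem_erase hz) _ _).symm).1
          (H.mp hV (h.toV hE))
      refine H.of_der (Γ := {.all 0 φ}) (.gen (.ded (.allE hf (Der.hyp (by simp)))) ?_)
        (by simpa using h0)
      simp [FV, hφ]
    refine (h.2 (mk ι f U a)).2 w le_rfl ⟨hall, fun e => ⟨?_, fun u hu h1 => ?_⟩⟩
    · rw [par_update]
      exact H.inst hall e.a
    · rw [RF.renameFree hf, Function.update_self, Function.update_comm (by decide),
        Function.update_idem, RF.update_iff hφ]
      simp only [RF, Function.update_apply] at h1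
      norm_num at h1
      obtain ⟨i, -, -, hi⟩ := h1
      exact RF.congr_eqv hE (hi.symm hE) (ih i u (hw.trans hu) (h.mono hu))

end Axioms

/-! ## Forcing infinity -/

section Infinity

open ZFForm ZFAxioms Nm

variable {P : Type} [Preorder P] {Ax : Set ZFForm} {H : HenkinTheory Ax}
  {v w : P} {ρ : ℕ → Nm P} {d : Nm P}

theorem HenkinTheory.veq_of_der (H : HenkinTheory Ax) (hT : extAx ∈ Ax) {A : ZFForm} {x : ℕ}
    {τ : ℕ → ℕ} {a b : ℕ} (h0 : 0 ∉ A.FV) (h1 : 1 ∉ A.FV) (hf0 : A.freeFor 0 x)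
    (hf1 : A.freeFor 1 x)
    (hd : Der Ax {A.renameFree x 0, A.renameFree x 1}
      (.all 2 ((ZFForm.mem 2 0).biimp (.mem 2 1))))
    (ha : H.V A (Function.update τ x a)) (hb : H.V A (Function.update τ x b)) : H.veq a b := by
  set τ' := Function.update (Function.update τ 0 a) 1 b with hτ'
  have key : ∀ c, H.V A (Function.update τ x c) → H.V A (Function.update τ' x c) := fun c hc => by
    refine (H.congr fun z hz => ?_).1 hc
    by_cases hzx : z = x
    · subst hzx; simp
    · have e0 : z ≠ 0 := fun e => h0 (e ▸ hz)
      have e1 : z ≠ 1 := fun e => h1 (e ▸ hz)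
      simp [hτ', Function.update_of_ne, hzx, e0, e1]
  have hext : H.V _ τ' := H.inst (H.inst (H.thm (τ := τ) (.axm hT)) a) b
  have h2 := H.biimp2 hext (H.of_der hd (by
    rintro B (rfl | rfl)
    · exact (H.rename hf0).2 (key _ (by simpa [hτ', Function.update_apply] using ha))
    · exact (H.rename hf1).2 (key _ (by simpa [hτ', Function.update_apply] using hb))))
  rw [H.eq_iff] at h2
  simpa [hτ', Function.update_apply] using h2

/-- `x₁₀` is empty. -/
def emptyF : ZFForm := .all 11 (ZFForm.mem 11 10).neg

/-- `x₁₂` is the successor of `x₁₄`. -/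
def succF : ZFForm := .all 13 ((ZFForm.mem 13 12).biimp ((ZFForm.mem 13 14).or (.eq 13 14)))

namespace HenkinTheory

/-- The Henkin theory proves that `e` is empty. -/
def IsEmp (H : HenkinTheory Ax) (e : ℕ) : Prop := H.V emptyF fun _ => e

/-- The Henkin theory proves that `s` is the successor of `b`. -/
def IsSucc (H : HenkinTheory Ax) (b s : ℕ) : Prop := H.V succF (Function.update (fun _ => b) 12 s)

variable (H)

theorem emptyF_iff {τ : ℕ → ℕ} : H.V emptyF τ ↔ H.IsEmp (τ 10) :=
  H.congr fun z hz => by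
    have : z = 10 := by revert z; decide
    rw [this]

theorem succF_iff {τ : ℕ → ℕ} : H.V succF τ ↔ H.IsSucc (τ 14) (τ 12) :=
  H.congr fun z hz => by
    have : z = 12 ∨ z = 14 := by revert z; decide
    rcases this with rfl | rfl <;> simp

variable {H} {a b s t e : ℕ}

theorem IsEmp.unique (hT : extAx ∈ Ax) (ha : H.IsEmp a) (hb : H.IsEmp b) : H.veq a b := by
  refine H.veq_of_der hT (A := emptyF) (x := 10) (τ := fun _ => 0) (by decide) (by decide)
    (by simp [emptyF, neg, freeFor]) (by simp [emptyF, neg, freeFor]) ?_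
    (H.emptyF_iff.2 (by simpa using ha)) (H.emptyF_iff.2 (by simpa using hb))
  refine .gen (.iffI (.botE (.mp ?_ .hyp0)) (.botE (.mp ?_ .hyp0))) (by
    rintro B (rfl | rfl) <;> decide)
  · exact Der.allE (x := 11) (y := 2) (A := (ZFForm.mem 11 0).neg) (by simp [neg, freeFor])
      (.hyp (by simp [emptyF, neg, renameFree]))
  · exact Der.allE (x := 11) (y := 2) (A := (ZFForm.mem 11 1).neg) (by simp [neg, freeFor])
      (.hyp (by simp [emptyF, neg, renameFree]))

theorem IsSucc.unique (hE : zfEqAxioms ⊆ Ax) (hT : extAx ∈ Ax) (ha : H.IsSucc a s)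
    (hb : H.IsSucc b t) (hab : H.veq a b) : H.veq s t := by
  have hat : H.IsSucc a t := by
    have := H.congr_eq hE (A := succF) (x := 14) (τ := fun _ => t) (H.veq_symm hE hab)
      (H.succF_iff.2 (by simpa using hb))
    simpa [H.succF_iff] using this
  have key : ∀ i : ℕ, i < 2 → Der Ax {succF.renameFree 12 0, succF.renameFree 12 1}
      ((ZFForm.mem 2 i).biimp ((ZFForm.mem 2 14).or (.eq 2 14))) := fun i hi => by
    have h := Der.allE (x := 13) (y := 2) (Ax := Ax)
      (Γ := {succF.renameFree 12 0, succF.renameFree 12 1})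
      (A := (ZFForm.mem 13 i).biimp ((ZFForm.mem 13 14).or (.eq 13 14)))
      (by simp [biimp, freeFor]) (.hyp (by interval_cases i <;> simp [succF, biimp, renameFree]))
    have e : i ≠ 13 := by omega
    simpa [biimp, renameFree, e] using h
  refine H.veq_of_der hT (A := succF) (x := 12) (τ := fun _ => a) (by decide) (by decide)
    (by simp [succF, biimp, freeFor]) (by simp [succF, biimp, freeFor]) ?_
    (H.succF_iff.2 (by simpa using ha)) (H.succF_iff.2 (by simpa using hat))
  refine .gen (.iffI (.iff2 (key 1 (by decide)).weak (.iff1 (key 0 (by decide)).weak .hyp0))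
    (.iff2 (key 0 (by decide)).weak (.iff1 (key 1 (by decide)).weak .hyp0))) (by
    rintro B (rfl | rfl) <;> decide)

theorem IsSucc.vmem_self (hE : zfEqAxioms ⊆ Ax) (h : H.IsSucc a s) : H.vmem a s := by
  have h1 := H.biimp2 (H.inst h a) (H.or_right (H.eq_iff.2 (by simpa using H.veq_refl hE a)))
  simpa [H.mem_iff] using h1

theorem IsSucc.vmem (h : H.IsSucc a s) (hb : H.vmem b a) : H.vmem b s := by
  have h1 := H.biimp2 (H.inst h b) (H.or_left (H.mem_iff.2 (by simpa using hb)))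
  simpa [H.mem_iff] using h1

end HenkinTheory

/-- `e` is forced to be empty. -/
def EmpAt (H : HenkinTheory Ax) (v : P) (e : Nm P) : Prop :=
  H.IsEmp e.a ∧ ∀ d w, v ≤ w → ¬ Mem H d e w

/-- `s` is forced to be the successor of `d`. -/
def SuccAt (H : HenkinTheory Ax) (v : P) (d s : Nm P) : Prop :=
  H.IsSucc d.a s.a ∧ ∀ e w, v ≤ w → (Mem H e s w ↔ Mem H e d w ∨ Eqv H e d w)

theorem RF.emptyF_iff : RF H emptyF v ρ ↔ EmpAt H v (ρ 10) := by
  constructor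
  · rintro ⟨h1, h2⟩
    refine ⟨H.emptyF_iff.1 h1, fun d w hw hd => (h2 d).2 w hw ?_⟩
    simpa [RF, Function.update_apply] using hd
  · rintro ⟨h1, h2⟩
    have hV := H.emptyF_iff (τ := par ρ).2 h1
    refine ⟨hV, fun d => ⟨?_, fun w hw hd => h2 d w hw ?_⟩⟩
    · rw [par_update]
      exact H.inst hV d.a
    · simpa [RF, Function.update_apply] using hd

theorem RF.succF_iff : RF H succF v ρ ↔ SuccAt H v (ρ 14) (ρ 12) := by
  constructor
  · rintro ⟨h1, h2⟩
    refine ⟨H.succF_iff.1 h1, fun d w hw => ⟨fun hd => ?_, fun hd => ?_⟩⟩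
    · have := (h2 d).1.2 w hw (by simpa [RF, Function.update_apply] using hd)
      simpa [RF, Function.update_apply] using this
    · have := (h2 d).2.2 w hw (by simpa [RF, Function.update_apply] using hd)
      simpa [RF, Function.update_apply] using this
  · rintro ⟨h1, h2⟩
    have hV := H.succF_iff (τ := par ρ).2 h1
    refine ⟨hV, fun d => ?_⟩
    have hVd := H.and_iff.1 (H.inst hV d.a)
    refine ⟨⟨by rw [par_update]; exact hVd.1, fun w hw hd => ?_⟩,
      ⟨by rw [par_update]; exact hVd.2, fun w hw hd => ?_⟩⟩
    · have := (h2 d w hw).1 (by simpa [RF, Function.update_apply] using hd)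
      simpa [RF, Function.update_apply] using this
    · have := (h2 d w hw).2 (by simpa [RF, Function.update_apply] using hd)
      simpa [RF, Function.update_apply] using this

theorem RF.inductiveF_iff {x : ℕ} (h10 : x ≠ 10) (h12 : x ≠ 12) (h14 : x ≠ 14) :
    RF H (inductiveF x) v ρ ↔ (∃ e, Mem H e (ρ x) v ∧ EmpAt H v e) ∧
      H.V (.all 14 ((ZFForm.mem 14 x).imp (succIn 14 x))) (par ρ) ∧
      ∀ d w, v ≤ w → Mem H d (ρ x) w → ∃ s, Mem H s (ρ x) w ∧ SuccAt H w d s := by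
  have h1 : RF H (emptyIn x) v ρ ↔ ∃ e, Mem H e (ρ x) v ∧ EmpAt H v e := by
    refine exists_congr fun e => ?_
    refine (and_congr_right' RF.emptyF_iff).trans ?_
    simp [RF, Function.update_of_ne h10]
  have h2 : ∀ w d, RF H (succIn 14 x) w (Function.update ρ 14 d) ↔
      ∃ s, Mem H s (ρ x) w ∧ SuccAt H w d s := fun w d => by
    refine exists_congr fun e => ?_
    refine (and_congr_right' RF.succF_iff).trans ?_
    simp [RF, Function.update_of_ne h12, Function.update_of_ne h14]
  refine and_congr h1 ⟨fun h => ⟨h.1, fun d w hw hd => ?_⟩, fun h => ⟨h.1, fun d => ⟨?_, ?_⟩⟩⟩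
  · exact (h2 w d).1 ((h.2 d).2 w hw (by simpa [RF, Function.update_of_ne h14] using hd))
  · rw [par_update]
    exact H.inst h.1 d.a
  · exact fun w hw hd => (h2 w d).2 (h.2 d w hw (by simpa [RF, Function.update_of_ne h14] using hd))

/-- The name of `x ∪ {x}`. -/
def insertNm (H : HenkinTheory Ax) (x : Nm P) (b : ℕ) : Nm P :=
  mk (Option {i : x.I // H.vmem (x.fam i).a x.a}) (fun o => o.elim x fun i => x.fam i)
    (fun o => o.elim ⟨Set.univ, isUpperSet_univ⟩ fun i => x.dom i) b

theorem mem_insertNm {x e : Nm P} {b : ℕ} (hE : zfEqAxioms ⊆ Ax) (hb : H.IsSucc x.a b) :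
    Mem H e (insertNm H x b) w ↔ Mem H e x w ∨ Eqv H e x w := by
  constructor
  · rintro ⟨_ | i, h1, h2, h3⟩
    · exact .inr h3
    · exact .inl ⟨i.1, h1, i.2, h3⟩
  · rintro (⟨i, h1, h2, h3⟩ | h)
    · exact ⟨some ⟨i, h2⟩, h1, hb.vmem h2, h3⟩
    · exact ⟨none, Set.mem_univ _, hb.vmem_self hE, h⟩

/-- The names of the numerals with parameters `p`. -/
def numNm (P : Type) [Preorder P] (H : HenkinTheory Ax) (p : ℕ → ℕ) : ℕ → Nm P
  | 0 => mk Empty Empty.elim Empty.elim (p 0)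
  | n + 1 => insertNm H (numNm P H p n) (p (n + 1))

theorem numNm_a (p : ℕ → ℕ) (n : ℕ) : (numNm P H p n).a = p n := by cases n <;> rfl

/-- The name of the set of numerals with parameters `p`. -/
def omegaNm (P : Type) [Preorder P] (H : HenkinTheory Ax) (p : ℕ → ℕ) (c : ℕ) : Nm P :=
  mk ℕ (numNm P H p) (fun _ => ⟨Set.univ, isUpperSet_univ⟩) c

/-- `p` enumerates numerals that are members of `c`. -/
structure IsNumerals (H : HenkinTheory Ax) (p : ℕ → ℕ) (c : ℕ) : Prop where
  emp : H.IsEmp (p 0)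
  succ : ∀ n, H.IsSucc (p n) (p (n + 1))
  mem : ∀ n, H.vmem (p n) c

theorem exists_isNumerals {τ : ℕ → ℕ} (h : H.V (inductiveF 0) τ) : ∃ p, IsNumerals H p (τ 0) := by
  obtain ⟨h1, h2⟩ := H.and_iff.1 h
  obtain ⟨e, he⟩ := H.wit h1
  obtain ⟨he1, he2⟩ := H.and_iff.1 he
  have hs : ∀ b, ∃ s, H.vmem b (τ 0) → H.vmem s (τ 0) ∧ H.IsSucc b s := fun b => by
    by_cases hb : H.vmem b (τ 0)
    · obtain ⟨s, hs⟩ := H.wit (H.mp (H.inst h2 b)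
        (H.mem_iff.2 (by simpa [Function.update_apply] using hb)))
      obtain ⟨hs1, hs2⟩ := H.and_iff.1 hs
      refine ⟨s, fun _ => ⟨?_, ?_⟩⟩
      · simpa [H.mem_iff, Function.update_apply] using hs1
      · have := H.succF_iff.1 hs2
        simpa [Function.update_apply] using this
    · exact ⟨0, fun h => (hb h).elim⟩
  choose s hs using hs
  have hm : ∀ n, H.vmem (Nat.rec e (fun _ b => s b) n) (τ 0) := fun n => by
    induction n with
    | zero => simpa [H.mem_iff, Function.update_apply] using he1
    | succ n ih => exact (hs _ ih).1
  exact ⟨fun n => Nat.rec e (fun _ b => s b) n, ⟨by simpa using H.emptyF_iff.1 he2,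
    fun n => (hs _ (hm n)).2, hm⟩⟩

theorem IsNumerals.mem_omega {p : ℕ → ℕ} {c : ℕ} (hp : IsNumerals H p c) (hE : zfEqAxioms ⊆ Ax)
    (n : ℕ) : Mem H (numNm P H p n) (omegaNm P H p c) v :=
  ⟨n, Set.mem_univ _, show H.vmem (numNm P H p n).a c by rw [numNm_a]; exact hp.mem n,
    Eqv.refl hE _ _⟩

theorem IsNumerals.succAt {p : ℕ → ℕ} {c : ℕ} (hp : IsNumerals H p c) (hE : zfEqAxioms ⊆ Ax)
    (n : ℕ) : SuccAt H v (numNm P H p n) (numNm P H p (n + 1)) :=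
  ⟨by rw [numNm_a, numNm_a]; exact hp.succ n,
    fun e w _ => mem_insertNm hE (by rw [numNm_a]; exact hp.succ n)⟩

theorem not_mem_numNm_zero {p : ℕ → ℕ} {e : Nm P} : ¬ Mem H e (numNm P H p 0) w :=
  fun ⟨j, _⟩ => j.elim

theorem IsNumerals.inductiveF {p : ℕ → ℕ} (hE : zfEqAxioms ⊆ Ax)
    (hp : IsNumerals H p (ρ 0).a) (h0 : ρ 0 = omegaNm P H p (ρ 0).a)
    (hV : H.V (inductiveF 0) (par ρ)) : RF H (inductiveF 0) v ρ := by
  refine (RF.inductiveF_iff (by decide) (by decide) (by decide)).2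
    ⟨⟨numNm P H p 0, ?_, ?_, fun d w _ h => not_mem_numNm_zero h⟩, (H.and_iff.1 hV).2,
      fun d w hw hd => ?_⟩
  · rw [h0]
    exact hp.mem_omega hE 0
  · rw [numNm_a]
    exact hp.emp
  · rw [h0] at hd ⊢
    obtain ⟨n, hn⟩ : ∃ n : ℕ, Eqv H d (numNm P H p n) w := hd.imp fun n h => h.2.2
    refine ⟨numNm P H p (n + 1), hp.mem_omega hE _, ?_⟩
    have h1 : RF H succF w (Function.update (fun _ => numNm P H p (n + 1)) 14 (numNm P H p n)) :=
      RF.succF_iff.2 (by simpa using hp.succAt hE n)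
    simpa using RF.succF_iff.1 (RF.congr_eqv hE (hn.symm hE) h1)

theorem IsNumerals.mem_of_inductive {p : ℕ → ℕ} {c : ℕ} (hp : IsNumerals H p c)
    (hE : zfEqAxioms ⊆ Ax) (hT : extAx ∈ Ax) (h : RF H (ZFAxioms.inductiveF 15) v ρ) (n : ℕ) :
    Mem H (numNm P H p n) (ρ 15) v := by
  obtain ⟨⟨e, he, he1, he2⟩, -, h2⟩ :=
    (RF.inductiveF_iff (by decide) (by decide) (by decide)).1 h
  induction n with
  | zero =>
    refine he.congr_left hE (Eqv.of_mem hE ?_ (fun w hw d hd => (he2 d w hw hd).elim)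
      fun w hw d hd => (not_mem_numNm_zero hd).elim)
    rw [numNm_a]
    exact he1.unique hT hp.emp
  | succ n ih =>
    obtain ⟨s, hs, hs1, hs2⟩ := h2 _ v le_rfl ih
    obtain ⟨hn1, hn2⟩ := hp.succAt (P := P) (v := v) hE n
    refine hs.congr_left hE (Eqv.of_mem hE ?_ (fun w hw d hd => ?_) fun w hw d hd => ?_)
    · exact hs1.unique hE hT hn1 (H.veq_refl hE _)
    · exact (hn2 d w hw).2 ((hs2 d w hw).1 hd)
    · exact (hs2 d w hw).2 ((hn2 d w hw).1 hd)

theorem RF.infAx (hE : zfEqAxioms ⊆ Ax) (hT : infAx ∈ Ax) : RF H infAx v ρ := by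
  obtain ⟨c, hc⟩ := H.wit (H.thm (τ := par ρ) (.axm hT))
  obtain ⟨p, hp⟩ := exists_isNumerals hc
  rw [Function.update_self] at hp
  refine ⟨omegaNm P H p c, hp.inductiveF hE ?_ ?_⟩
  · rfl
  · rw [par_update]
    exact hc

theorem RF.strongInfAx (hE : zfEqAxioms ⊆ Ax) (hX : ZFAxioms.extAx ∈ Ax) (hT : strongInfAx ∈ Ax) :
    RF H strongInfAx v ρ := by
  obtain ⟨c, hc⟩ := H.wit (H.thm (τ := par ρ) (.axm hT))
  obtain ⟨hc1, hc2⟩ := H.and_iff.1 hc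
  obtain ⟨p, hp⟩ := exists_isNumerals hc1
  rw [Function.update_self] at hp
  refine ⟨omegaNm P H p c, hp.inductiveF hE rfl ?_, ?_, fun d => ?_⟩
  · rw [par_update]
    exact hc1
  · rw [par_update]
    exact hc2
  have hd := H.inst hc2 d.a
  refine ⟨by rw [par_update, par_update]; exact hd, fun w hw hi => ?_⟩
  have hVi := hi.toV hE
  rw [par_update, par_update] at hVi
  have he := H.mp hd hVi
  refine ⟨by rw [par_update, par_update]; exact he, fun e => ⟨?_, fun u hu h => ?_⟩⟩
  · rw [par_update, par_update, par_update]
    exact H.inst he e.a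
  · simp only [RF, Function.update_apply] at h ⊢
    norm_num at h ⊢
    obtain ⟨n, hn⟩ : ∃ n : ℕ, Eqv H e (numNm P H p n) u := h.imp fun n h => h.2.2
    have := hp.mem_of_inductive hE hX (hi.mono hu) n
    exact Mem.congr_left hE (by simpa [Function.update_apply] using this) (hn.symm hE)

end Infinity

/-! ## Forcing replacement -/

section Replacement

open ZFForm ZFAxioms Nm

variable {P : Type} [Preorder P] {Ax : Set ZFForm} {H : HenkinTheory Ax}
  {v w : P} {ρ : ℕ → Nm P} {d : Nm P}

theorem HenkinTheory.update_iff (H : HenkinTheory Ax) {A : ZFForm} {x : ℕ} {τ : ℕ → ℕ}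
    (h : x ∉ A.FV) (c : ℕ) : H.V A (Function.update τ x c) ↔ H.V A τ :=
  H.congr fun z hz => Function.update_of_ne (fun e : z = x => h (e ▸ hz)) _ _

theorem RF.replAx (hE : zfEqAxioms ⊆ Ax) {φ : ZFForm} (h3 : 3 ∉ φ.FV) (h4 : 4 ∉ φ.FV)
    (hf : φ.freeFor 4 2) (hT : replAx φ ∈ Ax) : RF H (replAx φ) v ρ := by
  have hV := H.thm (τ := par ρ) (.axm hT)
  refine ⟨hV, fun d => ?_⟩
  have hV1 := H.inst hV d.a
  refine ⟨by rw [par_update]; exact hV1, fun w hw h => ?_⟩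
  set τ := Function.update (par ρ) 0 d.a with hτ
  obtain ⟨c, hc⟩ := H.wit (H.mp hV1 (by rw [hτ, ← par_update]; exact h.toV hE))
  have hz : ∀ p : {p : d.I × P // w ≤ p.2 ∧ p.2 ∈ d.dom p.1 ∧ H.vmem (d.fam p.1).a d.a},
      ∃ z : Nm P, H.vmem z.a c ∧ RF H φ p.1.2
        (Function.update (Function.update (Function.update ρ 0 d) 1 (d.fam p.1.1)) 2 z) := by
    rintro ⟨⟨j, u⟩, hu, hj, hm⟩
    obtain ⟨z, hz1, hz2⟩ := (h.2 (d.fam j)).2 u hu ⟨j, hj, hm, Eqv.refl hE _ _⟩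
    refine ⟨z, ?_, hz1⟩
    obtain ⟨b, hb⟩ := H.wit (H.mp (H.inst hc (d.fam j).a)
      (H.mem_iff.2 (by simpa [hτ, Function.update_apply] using hm)))
    obtain ⟨hb1, hb2⟩ := H.and_iff.1 hb
    have hz3 := H.inst (hz2.toV hE) b
    have hb3 := H.mp hz3 ((H.rename hf).2 (by
      rw [Function.update_self, Function.update_comm (by decide), H.update_iff h4]
      rw [Function.update_comm (b := 1) (by decide), Function.update_comm (b := 2) (by decide),
        H.update_iff h3] at hb2
      simpa using hb2))
    refine H.vmem_congr hE (a := b) (b := c) ?_ (H.veq_refl hE c) ?_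
    · simpa [H.eq_iff, Function.update_apply] using hb3
    · simpa [H.mem_iff, Function.update_apply] using hb1
  choose z hz1 hz2 using hz
  refine ⟨mk _ z (fun p => UpperSet.Ici p.1.2) c, ?_, fun e => ⟨?_, fun u hu he => ?_⟩⟩
  · rw [par_update, par_update]
    exact hc
  · rw [par_update, par_update, par_update]
    exact H.inst hc e.a
  · simp only [RF, Function.update_apply] at he
    norm_num at he
    obtain ⟨j, hj, hm, he⟩ := he
    have hp := hz2 ⟨(j, u), hu, hj, hm⟩
    refine ⟨z ⟨(j, u), hu, hj, hm⟩, ?_, ?_⟩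
    · simp only [RF, Function.update_apply]
      norm_num
      exact ⟨⟨(j, u), hu, hj, hm⟩, le_refl u, hz1 _, Eqv.refl hE _ _⟩
    · rw [Function.update_comm (b := 1) (by decide), Function.update_comm (b := 2) (by decide),
        RF.update_iff h3]
      rw [Function.update_comm (by decide)] at hp ⊢
      exact RF.congr_eqv hE (he.symm hE) hp

theorem RF.of_mem_axioms (hE : zfEqAxioms ⊆ Ax) (hX : ZFAxioms.extAx ∈ Ax) {A : ZFForm}
    (hA : A ∈ Ax) (h : A ∈ IZF_R ∪ CZF_ER) (v : P) (ρ : ℕ → Nm P) : RF H A v ρ := by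
  have key : A ∈ ({ZFAxioms.extAx, ZFAxioms.empAx, ZFAxioms.unionAx, ZFAxioms.pairAx,
      ZFAxioms.infAx, ZFAxioms.powAx, ZFAxioms.strongInfAx, ZFAxioms.expAx} : Set ZFForm) ∪
      sepScheme ∪ indScheme ∪ replScheme := by
    rcases h with (((h | h) | h) | h) | (((h | ⟨φ, -, h⟩) | h) | h)
    · exact .inl (.inl (.inl (by
        simp only [Set.mem_insert_iff, Set.mem_singleton_iff] at h ⊢
        tauto)))
    · exact .inl (.inl (.inr h))
    · exact .inl (.inr h)
    · exact .inr h
    · exact .inl (.inl (.inl (by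
        simp only [Set.mem_insert_iff, Set.mem_singleton_iff] at h ⊢
        tauto)))
    · exact .inl (.inl (.inr ⟨φ, h⟩))
    · exact .inl (.inr h)
    · exact .inr h
  rcases key with ((h | ⟨φ, h1, rfl⟩) | ⟨φ, h1, h2, rfl⟩) | ⟨φ, h1, h2, h3, rfl⟩
  · rcases h with rfl | rfl | rfl | rfl | rfl | rfl | rfl | rfl
    · exact .extAx hE hX
    · exact .empAx hA
    · exact .unionAx hE hA
    · exact .pairAx hE hA
    · exact .infAx hE hA
    · exact .powAx hE hA
    · exact .strongInfAx hE hX hA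
    · exact .expAx hE hA
  · exact .sepAx hE h1 hA
  · exact .indAx hE h1 h2 hA
  · exact .replAx hE h1 h2 h3 hA

/-- The theorems of the set theories considered are forced. -/
theorem RF.of_thyProv {T : Set ZFForm} (hT : T ⊆ IZF_R ∪ CZF_ER) (hX : ZFAxioms.extAx ∈ T)
    (H : HenkinTheory (T ∪ zfEqAxioms)) {A : ZFForm} (h : thyProv T A) (v : P) (ρ : ℕ → Nm P) :
    RF H A v ρ := by
  refine RF.of_prov Set.subset_union_right (fun B hB v ρ => ?_) h v ρ
  rcases hB with hB | hB
  · exact RF.of_mem_axioms Set.subset_union_right (.inl hX) (.inl hB) (hT hB) v ρ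
  · exact RF.of_mem_zfEqAxioms Set.subset_union_right hB v ρ

end Replacement

/-! ## Admissibility and substitution instances in a theory -/

section Instances

open ZFForm ZFAxioms

theorem substZ_substProp (σ : ℕ → ZFForm) (s : ℕ → PropForm) (A : PropForm) :
    substZ σ (substProp s A) = substZ (fun n => substZ σ (s n)) A := by
  induction A with
  | var n => rfl
  | bot => rfl
  | top => rfl
  | and A B ih1 ih2 | or A B ih1 ih2 | imp A B ih1 ih2 => simp only [substProp, substZ, ih1, ih2]

theorem isSentence_substZ {σ : ℕ → ZFForm} (hσ : ∀ n, (σ n).IsSentence) (A : PropForm) :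
    (substZ σ A).IsSentence := by
  induction A with
  | var n => exact hσ n
  | bot => rfl
  | top => rfl
  | and A B ih1 ih2 | or A B ih1 ih2 | imp A B ih1 ih2 =>
    unfold IsSentence at ih1 ih2 ⊢
    simp only [substZ, FV, ih1, ih2, Finset.union_empty]

/-- The propositional formulas all of whose letters are read through `σ` as theorems of `T`. -/
def instThms (T : Set ZFForm) (σ : ℕ → ZFForm) : Set PropForm := {D | thyProv T (substZ σ D)}

theorem thyProv_substZ_of_ipcProv (T : Set ZFForm) (σ : ℕ → ZFForm) {A : PropForm}
    (h : IPCProv ∅ A) : thyProv T (substZ σ A) :=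
  (Der.of_propProv (Γ := ∅) h fun _ hE => hE.elim).toZF

theorem isIPCTheory_instThms (T : Set ZFForm) (σ : ℕ → ZFForm) :
    IsIPCTheory (instThms T σ) :=
  ⟨thyProv_substZ_of_ipcProv T σ, fun h1 h2 => .mp h1 h2⟩

/-- Derivability from instances of a theory uses a single instance. -/
theorem Der.exists_mem_imp {Ax : Set ZFForm} {σ : ℕ → ZFForm} {G : Set PropForm}
    (hG : IsIPCTheory G) {A : ZFForm} (h : Der Ax (substZ σ '' G) A) :
    ∃ E ∈ G, ZFProv Ax ((substZ σ E).imp A) := by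
  induction h with
  | hyp h =>
    obtain ⟨E, hE, rfl⟩ := h
    exact ⟨E, hE, (ded (Γ := ∅) hyp0).toZF⟩
  | thm h => exact ⟨.top, hG.ipc .topI, .mp .k h⟩
  | mp _ _ ih1 ih2 =>
    obtain ⟨E, hE, h1⟩ := ih1
    obtain ⟨F, hF, h2⟩ := ih2
    exact ⟨E.and F, hG.and_mem.2 ⟨hE, hF⟩, (ded (Γ := ∅)
      (.mp (.mp (.thm h1) (andE1 hyp0)) (.mp (.thm h2) (andE2 hyp0)))).toZF⟩

theorem hasSlash_instThms {T : Set ZFForm} (hT : T ⊆ IZF_R ∪ CZF_ER) (hX : extAx ∈ T)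
    {σ : ℕ → ZFForm} (hσ : ∀ n, (σ n).IsSentence) : HasSlash (instThms T σ) := by
  intro G hG hΘ
  have hΓ : ∀ B ∈ substZ σ '' G, B.FV = ∅ := by
    rintro _ ⟨D, -, rfl⟩
    exact isSentence_substZ hσ D
  obtain ⟨H, hH⟩ := HenkinTheory.exists_conservative (T ∪ zfEqAxioms) (substZ σ '' G) hΓ
  let ρ : ℕ → Nm Unit := fun _ => .mk Empty Empty.elim Empty.elim 0
  have hE : zfEqAxioms ⊆ T ∪ zfEqAxioms := Set.subset_union_right
  have hV : ∀ D, H.V (substZ σ D) (Nm.par ρ) ↔ D ∈ G := by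
    intro D
    rw [hH _ (isSentence_substZ hσ D)]
    refine ⟨fun h => ?_, fun h => .hyp ⟨D, h, rfl⟩⟩
    obtain ⟨E, hEG, h⟩ := h.exists_mem_imp hG
    exact hG.mp (hΘ (show thyProv T (substZ σ (E.imp D)) from h)) hEG
  have hR : ∀ D, thyProv T (substZ σ D) → RF H (substZ σ D) () ρ :=
    fun D h => RF.of_thyProv hT hX H h () ρ
  refine ⟨{D | RF H (substZ σ D) () ρ}, hR, fun D h => (hV D).1 (RF.toV hE h),
    ⟨fun h => hR _ (thyProv_substZ_of_ipcProv T σ h), fun h1 h2 => h1.2 () le_rfl h2⟩,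
    fun h => h, fun A B h => h, fun A B => ?_⟩
  exact and_congr (hV (A.imp B)) ⟨fun h => h () le_rfl, fun h _ _ => h⟩

/-- Every rule admissible in intuitionistic propositional logic is admissible in `T`. -/
theorem admZ_of_admIPC {T : Set ZFForm} (hT : T ⊆ IZF_R ∪ CZF_ER) (hX : extAx ∈ T)
    {A B : PropForm} (h : AdmIPC A B) : AdmZ (thyProv T) A B := fun _ hσ hA =>
  (hasSlash_instThms hT hX hσ).mem_of_admIPC (isIPCTheory_instThms T _) h hA

end Instances

/-! ## Sentences that count antichains -/

section Antichains

open ZFForm Nm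

namespace ZFForm

/-- The disjunction of a list of formulas. -/
def disj (l : List ZFForm) : ZFForm := l.foldr .or .bot

theorem mem_FV_disj {l : List ZFForm} {x : ℕ} : x ∈ (disj l).FV ↔ ∃ A ∈ l, x ∈ A.FV := by
  induction l with
  | nil => simp [disj, FV]
  | cons A l ih =>
    simp only [disj, List.foldr_cons, FV, Finset.mem_union, List.mem_cons] at ih ⊢
    rw [ih]
    simp

theorem mem_FV_allList {l : List ℕ} {A : ZFForm} {x : ℕ} :
    x ∈ (l.foldr ZFForm.all A).FV ↔ x ∈ A.FV ∧ x ∉ l := by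
  induction l with
  | nil => simp
  | cons y l ih =>
    simp only [List.foldr_cons, FV, Finset.mem_erase, ih, List.mem_cons]
    tauto

/-- `x` is inhabited. -/
def inhab (x : ℕ) : ZFForm := .ex (x + 1) (.mem (x + 1) x)

theorem FV_inhab (x : ℕ) : (inhab x).FV = {x} := by
  ext z
  simp only [inhab, FV, Finset.mem_erase, Finset.mem_insert, Finset.mem_singleton]
  omega

/-- For `n` sets, the inhabitedness of one of them implies that of another one. -/
def widthMatrix (n : ℕ) : ZFForm :=
  disj ((List.range n).map fun i => (inhab (2 * i)).imp
    (disj (((List.range n).filter (· ≠ i)).map fun j => inhab (2 * j))))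

/-- The truth values have width less than `n`. -/
def widthLT (n : ℕ) : ZFForm := ((List.range n).map (2 * ·)).foldr .all (widthMatrix n)

/-- The truth values have width exactly `n`, persistently. -/
def widthEq (n : ℕ) : ZFForm := (widthLT (n + 1)).and (widthLT n).neg

theorem mem_of_mem_FV_widthMatrix {n x : ℕ} (h : x ∈ (widthMatrix n).FV) :
    x ∈ (List.range n).map (2 * ·) := by
  obtain ⟨_, hA, hx⟩ := mem_FV_disj.1 h
  obtain ⟨i, hi, rfl⟩ := List.mem_map.1 hA
  rcases Finset.mem_union.1 hx with hx | hx
  · rw [FV_inhab, Finset.mem_singleton] at hx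
    exact List.mem_map.2 ⟨i, hi, hx.symm⟩
  · obtain ⟨_, hB, hx⟩ := mem_FV_disj.1 hx
    obtain ⟨j, hj, rfl⟩ := List.mem_map.1 hB
    rw [FV_inhab, Finset.mem_singleton] at hx
    exact List.mem_map.2 ⟨j, (List.mem_filter.1 hj).1, hx.symm⟩

theorem isSentence_widthLT (n : ℕ) : (widthLT n).IsSentence :=
  Finset.eq_empty_of_forall_notMem fun _ h =>
    (mem_FV_allList.1 h).2 (mem_of_mem_FV_widthMatrix (mem_FV_allList.1 h).1)

theorem isSentence_widthEq (n : ℕ) : (widthEq n).IsSentence := by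
  have h := isSentence_widthLT
  unfold IsSentence at h ⊢
  simp [widthEq, neg, FV, h]

end ZFForm

variable {P : Type} [Preorder P] {Ax : Set ZFForm} {v : P} {ρ : ℕ → Nm P}

theorem RF.disj_iff {H : HenkinTheory Ax} {l : List ZFForm} :
    RF H (disj l) v ρ ↔ ∃ A ∈ l, RF H A v ρ := by
  induction l with
  | nil => simp [disj, RF]
  | cons A l ih =>
    simp only [disj, List.foldr_cons, RF, List.mem_cons] at ih ⊢
    rw [ih]
    simp

theorem RF.trivial_allList_iff {l : List ℕ} {A : ZFForm} :
    RF (HenkinTheory.trivial Ax) (l.foldr ZFForm.all A) v ρ ↔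
      ∀ ρ', (∀ z, z ∉ l → ρ' z = ρ z) → RF (HenkinTheory.trivial Ax) A v ρ' := by
  induction l generalizing ρ with
  | nil =>
    exact ⟨fun h ρ' h' => by rwa [show ρ' = ρ from funext fun z => h' z (by simp)],
      fun h => h ρ fun _ _ => rfl⟩
  | cons x l ih =>
    refine ⟨fun h ρ' h' => ih.1 (h.2 (ρ' x)) ρ' fun z hz => ?_,
      fun h => ⟨True.intro, fun d => ih.2 fun ρ' h' => h ρ' fun z hz => ?_⟩⟩
    · by_cases hzx : z = x
      · subst hzx; simp
      · rw [Function.update_of_ne hzx, h' z (by simp [hzx, hz])]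
    · simp only [List.mem_cons, not_or] at hz
      rw [h' z hz.2, Function.update_of_ne hz.1]

theorem RF.trivial_close_iff {l : List ℕ} {A : ZFForm} (hA : ∀ x ∈ A.FV, x ∈ l) :
    RF (HenkinTheory.trivial Ax) (l.foldr ZFForm.all A) v ρ ↔
      ∀ ρ', RF (HenkinTheory.trivial Ax) A v ρ' := by
  rw [RF.trivial_allList_iff]
  refine ⟨fun h ρ' => ?_, fun h ρ' _ => h ρ'⟩
  refine (RF.congr fun z hz => ?_).1
    (h (fun z => if z ∈ l then ρ' z else ρ z) fun z hz => if_neg hz)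
  exact if_pos (hA z hz)

theorem RF.trivial_inhab_iff (hE : zfEqAxioms ⊆ Ax) {x : ℕ} :
    RF (HenkinTheory.trivial Ax) (inhab x) v ρ ↔ ∃ j, v ∈ (ρ x).dom j := by
  simp only [inhab, RF, Function.update_apply, if_true, Nat.left_eq_add, one_ne_zero, if_false]
  exact ⟨fun ⟨_, j, h, _⟩ => ⟨j, h⟩,
    fun ⟨j, h⟩ => ⟨(ρ x).fam j, j, h, True.intro, Eqv.refl hE _ _⟩⟩

theorem RF.trivial_imp_iff {A B : ZFForm} :
    RF (HenkinTheory.trivial Ax) (A.imp B) v ρ ↔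
      ∀ w, v ≤ w → RF (HenkinTheory.trivial Ax) A w ρ → RF (HenkinTheory.trivial Ax) B w ρ :=
  ⟨fun h => h.2, fun h => ⟨True.intro, h⟩⟩

theorem RF.trivial_widthLT_iff (hE : zfEqAxioms ⊆ Ax) {n : ℕ} :
    RF (HenkinTheory.trivial Ax) (widthLT n) v ρ ↔ ∀ U : ℕ → UpperSet P,
      ∃ i < n, ∀ w, v ≤ w → w ∈ U i → ∃ j < n, j ≠ i ∧ w ∈ U j := by
  rw [widthLT, RF.trivial_close_iff fun _ => mem_of_mem_FV_widthMatrix]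
  have key : ∀ (ρ : ℕ → Nm P) (U : ℕ → UpperSet P),
      (∀ i w, w ∈ U i ↔ ∃ j, w ∈ (ρ (2 * i)).dom j) →
      (RF (HenkinTheory.trivial Ax) (widthMatrix n) v ρ ↔
        ∃ i < n, ∀ w, v ≤ w → w ∈ U i → ∃ j < n, j ≠ i ∧ w ∈ U j) := by
    intro ρ U hU
    simp only [widthMatrix, RF.disj_iff, List.mem_map, List.mem_range, List.mem_filter,
      exists_exists_and_eq_and, RF.trivial_imp_iff, RF.trivial_inhab_iff hE, ← hU,
      decide_eq_true_eq, and_assoc, ne_eq]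
    simp only [← and_assoc, exists_exists_and_eq_and, RF.trivial_inhab_iff hE, ← hU]
  constructor
  · intro h U
    refine (key (fun z => .mk Unit (fun _ => .mk Empty Empty.elim Empty.elim 0)
      (fun _ => U (z / 2)) 0) U fun i w => ?_).1 (h _)
    refine ⟨fun h => ⟨(), ?_⟩, fun ⟨_, h⟩ => ?_⟩ <;> simpa [Nm.dom] using h
  · intro h ρ'
    refine (key ρ' (fun i => ⟨{w | ∃ j, w ∈ (ρ' (2 * i)).dom j}, ?_⟩) fun i w => Iff.rfl).2 (h _)
    rintro w w' hw ⟨j, hj⟩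
    exact ⟨j, ((ρ' (2 * i)).dom j).upper hw hj⟩

end Antichains

/-! ## Refuting substitution instances of underivable formulas -/

section DeJongh

open ZFForm ZFAxioms Nm

/-- The nodes of the frame obtained from `K` by placing above every node `y` an infinite tower
of antichains of size `c y`. -/
inductive Tower (K : Type) (c : K → ℕ) : Type
  | base (x : K) : Tower K c
  | leaf (y : K) (j : ℕ) : Tower K c

namespace Tower

variable {K : Type} {c : K → ℕ}

/-- The sentence that all towers above are among those of `l`. -/
def labSubset (c : K → ℕ) (l : List K) : ZFForm := (disj (l.map fun y => widthEq (c y))).neg.neg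

theorem isSentence_labSubset (l : List K) : (labSubset c l).IsSentence := by
  refine Finset.eq_empty_of_forall_notMem fun x hx => ?_
  simp only [labSubset, neg, FV, Finset.union_empty, mem_FV_disj, List.mem_map] at hx
  obtain ⟨_, ⟨y, -, rfl⟩, hx⟩ := hx
  rw [isSentence_widthEq] at hx
  exact absurd hx (Finset.notMem_empty x)

instance [PartialOrder K] : Preorder (Tower K c) where
  le
    | base x, base y => x ≤ y
    | base x, leaf y _ => x ≤ y
    | leaf _ _, base _ => False
    | leaf y i, leaf y' j => y = y' ∧ (i = j ∨ i / c y < j / c y)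
  le_refl
    | base x => le_refl x
    | leaf y i => ⟨rfl, .inl rfl⟩
  le_trans
    | base _, base _, base _, h1, h2 => le_trans (α := K) h1 h2
    | base _, base _, leaf _ _, h1, h2 => le_trans (α := K) h1 h2
    | base _, leaf _ _, leaf _ _, h1, h2 => le_of_le_of_eq (α := K) h1 h2.1
    | leaf y i, leaf y' j, leaf y'' k, ⟨h1, h2⟩, ⟨h3, h4⟩ => by
      subst h1 h3
      refine ⟨rfl, ?_⟩
      rcases h2 with rfl | h2
      · exact h4
      · rcases h4 with rfl | h4
        · exact .inr h2
        · exact .inr (h2.trans h4)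

variable [PartialOrder K] {x y z : K} {i j n : ℕ}

theorem base_le_leaf : (base x : Tower K c) ≤ leaf y j ↔ x ≤ y := Iff.rfl

theorem leaf_le_leaf :
    (leaf x i : Tower K c) ≤ leaf y j ↔ x = y ∧ (i = j ∨ i / c x < j / c x) := Iff.rfl

theorem exists_leaf_of_leaf_le {w : Tower K c} (h : leaf y i ≤ w) : ∃ j, w = leaf y j := by
  cases w with
  | base x => exact h.elim
  | leaf y' j =>
    obtain rfl := (leaf_le_leaf.1 h).1
    exact ⟨j, rfl⟩

/-- The towers above a node. -/
def lab (w : Tower K c) : Set K := {y | ∃ j, w ≤ leaf y j}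

theorem lab_base : lab (base x : Tower K c) = {y | x ≤ y} := by
  ext y
  exact ⟨fun ⟨_, h⟩ => h, fun h => ⟨0, h⟩⟩

theorem lab_leaf : lab (leaf y i : Tower K c) = {y} := by
  ext z
  exact ⟨fun ⟨_, h⟩ => h.1.symm, fun h => ⟨i, h.symm, .inl rfl⟩⟩

theorem lab_nonempty (w : Tower K c) : (lab w).Nonempty := by
  cases w with
  | base x => exact ⟨x, 0, le_refl x⟩
  | leaf y i => exact ⟨y, i, le_rfl⟩

/-- The projection to the original frame, given for each tower the node that it is sent to. -/
def proj (m : K → K) : Tower K c → K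
  | base x => x
  | leaf y _ => m y

theorem proj_mono {m : K → K} (hm : ∀ y, y ≤ m y) {w w' : Tower K c} (h : w ≤ w') :
    proj m w ≤ proj m w' := by
  cases w with
  | base x =>
    cases w' with
    | base y => exact h
    | leaf y j => exact (base_le_leaf.1 h).trans (hm y)
  | leaf y i =>
    obtain ⟨j, rfl⟩ := exists_leaf_of_leaf_le h
    exact le_rfl

theorem exists_proj_eq {m : K → K} (hm : ∀ y, IsMax (m y)) {w : Tower K c} {z : K}
    (h : proj m w ≤ z) : ∃ w', w ≤ w' ∧ proj m w' = z := by
  cases w with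
  | base x => exact ⟨base z, h, rfl⟩
  | leaf y i => exact ⟨leaf y i, le_rfl, (hm y).eq_of_le h⟩

theorem proj_le_of_lab_subset {m : K → K} (hm : ∀ y, y ≤ m y) {w w' : Tower K c}
    (h : lab w ⊆ lab w') : proj m w' ≤ proj m w := by
  cases w with
  | base x =>
    cases w' with
    | base x' =>
      rw [lab_base, lab_base] at h
      exact h (le_refl x)
    | leaf y j =>
      rw [lab_base, lab_leaf] at h
      obtain rfl : x = y := h (le_refl x)
      exact (h (hm x) : m x = x).le
  | leaf y i =>
    cases w' with
    | base x =>
      rw [lab_leaf, lab_base] at h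
      exact (h rfl : x ≤ y).trans (hm y)
    | leaf y' j =>
      rw [lab_leaf, lab_leaf] at h
      obtain rfl : y = y' := h rfl
      exact le_rfl

variable {Ax : Set ZFForm} {ρ : ℕ → Nm (Tower K c)}

theorem rf_widthLT_leaf (hE : zfEqAxioms ⊆ Ax) (hc : 0 < c y) :
    RF (HenkinTheory.trivial Ax) (widthLT n) (leaf y i : Tower K c) ρ ↔ c y < n := by
  rw [RF.trivial_widthLT_iff hE]
  constructor
  · intro h
    by_contra! hn
    obtain ⟨k, hk, h⟩ := h fun k => .Ici (leaf y ((i / c y + 1) * c y + k))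
    have hd : ∀ l < n, ((i / c y + 1) * c y + l) / c y = i / c y + 1 := fun l hl => by
      rw [mul_comm, Nat.mul_add_div hc, Nat.div_eq_of_lt (hl.trans_le hn), add_zero]
    obtain ⟨l, hl, hlk, h⟩ := h (leaf y ((i / c y + 1) * c y + k))
      ⟨rfl, .inr (by rw [hd k hk]; exact Nat.lt_succ_self _)⟩ (UpperSet.mem_Ici_iff.2 le_rfl)
    rcases (leaf_le_leaf.1 h).2 with h | h
    · exact hlk (by omega)
    · rw [hd k hk, hd l hl] at h
      exact lt_irrefl _ h
  · intro hn U
    by_contra! h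
    have h' : ∀ k : Fin n, ∃ j, leaf y j ∈ U k ∧ ∀ l < n, l ≠ k → leaf y j ∉ U l := by
      intro k
      obtain ⟨w, hw, h1, h2⟩ := h k k.2
      obtain ⟨j, rfl⟩ := exists_leaf_of_leaf_le hw
      exact ⟨j, h1, h2⟩
    choose f hf1 hf2 using h'
    have hinc : ∀ k l : Fin n, k ≠ l → ¬ (leaf y (f k) : Tower K c) ≤ leaf y (f l) :=
      fun k l hkl hle => hf2 l k k.2 (fun h => hkl (Fin.ext h)) ((U k).upper hle (hf1 k))
    obtain ⟨k, l, hkl, hmod⟩ := Fintype.exists_ne_map_eq_of_card_lt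
      (fun k : Fin n => (⟨f k % c y, Nat.mod_lt _ hc⟩ : Fin (c y))) (by simpa using hn)
    have h1 := hinc k l hkl
    have h2 := hinc l k hkl.symm
    simp only [leaf_le_leaf, true_and, not_or, not_lt] at h1 h2
    refine h1.1 ?_
    rw [← Nat.div_add_mod (f k) (c y), ← Nat.div_add_mod (f l) (c y), le_antisymm h2.2 h1.2,
      Fin.mk.inj_iff.1 hmod]

theorem rf_widthEq_leaf (hE : zfEqAxioms ⊆ Ax) (hc : 0 < c y) :
    RF (HenkinTheory.trivial Ax) (widthEq n) (leaf y i : Tower K c) ρ ↔ n = c y := by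
  have h : RF (HenkinTheory.trivial Ax) (widthLT n).neg (leaf y i : Tower K c) ρ ↔ n ≤ c y := by
    rw [neg, RF.trivial_imp_iff]
    refine ⟨fun h => not_lt.1 fun hn => h _ le_rfl ((rf_widthLT_leaf hE hc).2 hn),
      fun hn w hw h => ?_⟩
    obtain ⟨j, rfl⟩ := exists_leaf_of_leaf_le hw
    exact absurd ((rf_widthLT_leaf hE hc).1 h) (not_lt.2 hn)
  rw [widthEq, RF, h, rf_widthLT_leaf hE hc]
  omega

theorem rf_labSubset (hE : zfEqAxioms ⊆ Ax) (hc : ∀ y, 0 < c y) (hi : Function.Injective c)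
    {l : List K} {w : Tower K c} :
    RF (HenkinTheory.trivial Ax) (labSubset c l) w ρ ↔ ∀ y ∈ lab w, y ∈ l := by
  have hleaf : ∀ y j, RF (HenkinTheory.trivial Ax) (disj (l.map fun y => widthEq (c y)))
      (leaf y j : Tower K c) ρ ↔ y ∈ l := by
    intro y j
    simp only [RF.disj_iff, List.mem_map, exists_exists_and_eq_and, rf_widthEq_leaf hE (hc y)]
    exact ⟨fun ⟨z, hz, h⟩ => hi h ▸ hz, fun h => ⟨y, h, rfl⟩⟩
  simp only [labSubset, neg, RF.trivial_imp_iff]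
  constructor
  · rintro h y ⟨j, hj⟩
    by_contra hy
    refine h _ hj fun u hu hd => ?_
    obtain ⟨i, rfl⟩ := exists_leaf_of_leaf_le hu
    exact hy ((hleaf y i).1 hd)
  · intro h u hu hd
    obtain ⟨y, j, hj⟩ := lab_nonempty u
    exact hd (leaf y j) hj ((hleaf y j).2 (h y ⟨j, hu.trans hj⟩))

end Tower

open Tower

/-- An underivable propositional formula has an instance that is not a theorem of `T`. -/
theorem exists_not_thyProv {T : Set ZFForm} (hT : T ⊆ IZF_R ∪ CZF_ER) (hX : extAx ∈ T)
    {C : PropForm} (hC : ¬ IPCProv ∅ C) :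
    ∃ σ : ℕ → ZFForm, (∀ n, (σ n).IsSentence) ∧ ¬ thyProv T (substZ σ C) := by
  classical
  obtain ⟨K, _, _, val, hval, k, hk⟩ := exists_finite_countermodel hC
  have := Fintype.ofFinite K
  have hE : zfEqAxioms ⊆ T ∪ zfEqAxioms := Set.subset_union_right
  obtain ⟨m, hm⟩ : ∃ m : K → K, ∀ y, y ≤ m y ∧ IsMax (m y) := by
    choose m hm using fun y : K =>
      Finite.exists_le_maximal (p := fun _ : K => True) (a := y) trivial
    exact ⟨m, fun y => ⟨(hm y).1, fun z hz => (hm y).2.2 trivial hz⟩⟩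
  let c : K → ℕ := fun y => Fintype.equivFin K y + 1
  have hc : ∀ y, 0 < c y := fun y => Nat.succ_pos _
  have hi : Function.Injective c := fun y z h =>
    (Fintype.equivFin K).injective (Fin.ext (Nat.succ_injective h))
  let S : ℕ → Finset (Finset K) := fun n =>
    Finset.univ.filter fun B => ∃ w : Tower K c, lab w = ↑B ∧ val (proj m w) n
  let σ : ℕ → ZFForm := fun n => disj ((S n).toList.map fun B => labSubset c B.toList)
  have hσ : ∀ n, (σ n).IsSentence := by
    intro n
    refine Finset.eq_empty_of_forall_notMem fun x hx => ?_
    obtain ⟨_, hA, hx⟩ := mem_FV_disj.1 hx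
    obtain ⟨B, -, rfl⟩ := List.mem_map.1 hA
    rw [isSentence_labSubset] at hx
    exact absurd hx (Finset.notMem_empty x)
  let ρ : ℕ → Nm (Tower K c) := fun _ => .mk Empty Empty.elim Empty.elim 0
  have key : ∀ (D : PropForm) (w : Tower K c),
      RF (HenkinTheory.trivial (T ∪ zfEqAxioms)) (substZ σ D) w ρ ↔ pforce val D (proj m w) := by
    intro D
    induction D with
    | var n =>
      intro w
      simp only [substZ, σ, RF.disj_iff, List.mem_map, exists_exists_and_eq_and,
        rf_labSubset hE hc hi, Finset.mem_toList, S, Finset.mem_filter, Finset.mem_univ, true_and,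
        pforce]
      constructor
      · rintro ⟨B, ⟨w', hB, h⟩, hw⟩
        refine hval _ _ n (proj_le_of_lab_subset (fun y => (hm y).1) fun y hy => ?_) h
        rw [hB]
        exact hw y hy
      · intro h
        exact ⟨(lab w).toFinset, ⟨w, by simp, h⟩, fun y hy => by simpa using hy⟩
    | bot => exact fun w => Iff.rfl
    | top => exact fun w => Iff.rfl
    | and A B ih1 ih2 => exact fun w => and_congr (ih1 w) (ih2 w)
    | or A B ih1 ih2 => exact fun w => or_congr (ih1 w) (ih2 w)
    | imp A B ih1 ih2 =>
      intro w
      simp only [substZ, RF.trivial_imp_iff, ih1, ih2, pforce]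
      refine ⟨fun h z hz => ?_, fun h w' hw' => h _ (proj_mono (fun y => (hm y).1) hw')⟩
      obtain ⟨w', hw', rfl⟩ := exists_proj_eq (fun y => (hm y).2) hz
      exact h w' hw'
  exact ⟨σ, hσ, fun h => hk ((key C (.base k)).1 (RF.of_thyProv hT hX _ h _ ρ))⟩

/-- Every rule admissible in `T` is admissible in intuitionistic propositional logic. -/
theorem admIPC_of_admZ {T : Set ZFForm} (hT : T ⊆ IZF_R ∪ CZF_ER) (hX : extAx ∈ T)
    {A B : PropForm} (h : AdmZ (thyProv T) A B) : AdmIPC A B := by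
  intro s hA
  by_contra hB
  obtain ⟨σ, hσ, hn⟩ := exists_not_thyProv hT hX hB
  refine hn ?_
  rw [substZ_substProp]
  refine h _ (fun n => isSentence_substZ hσ (s n)) ?_
  rw [← substZ_substProp]
  exact thyProv_substZ_of_ipcProv T σ hA

theorem admZ_iff_admIPC {T : Set ZFForm} (hT : T ⊆ IZF_R ∪ CZF_ER) (hX : extAx ∈ T)
    (A B : PropForm) : AdmZ (thyProv T) A B ↔ AdmIPC A B :=
  ⟨admIPC_of_admZ hT hX, admZ_of_admIPC hT hX⟩

end DeJongh

open ZFAxioms in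
/-- The propositional admissible rules of each of `IZF_R`, `CZF_ER`,
`ECST` and `BCST` are exactly those of `IPC`. -/
theorem admissible_rules_of_constructive_set_theories :
    (∀ A B : PropForm, AdmZ (thyProv IZF_R) A B ↔ AdmIPC A B) ∧
    (∀ A B : PropForm, AdmZ (thyProv CZF_ER) A B ↔ AdmIPC A B) ∧
    (∀ A B : PropForm, AdmZ (thyProv ECST) A B ↔ AdmIPC A B) ∧
    (∀ A B : PropForm, AdmZ (thyProv BCST) A B ↔ AdmIPC A B) := by
  have hC : CZF_ER ⊆ IZF_R ∪ CZF_ER := Set.subset_union_right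
  have hE : ECST ⊆ CZF_ER := by
    rintro A ((h | h) | h)
    · refine .inl (.inl (.inl ?_))
      simp only [Set.mem_insert_iff, Set.mem_singleton_iff] at h ⊢
      tauto
    · exact .inl (.inl (.inr h))
    · exact .inr h
  have hB : BCST ⊆ CZF_ER := by
    rintro A ((h | h) | h)
    · refine .inl (.inl (.inl ?_))
      simp only [Set.mem_insert_iff, Set.mem_singleton_iff] at h ⊢
      tauto
    · exact .inl (.inl (.inr h))
    · exact .inr h
  exact ⟨admZ_iff_admIPC Set.subset_union_left (.inl (.inl (.inl (.inl rfl)))),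
    admZ_iff_admIPC hC (.inl (.inl (.inl (.inl rfl)))),
    admZ_iff_admIPC (hE.trans hC) (.inl (.inl (.inl rfl))),
    admZ_iff_admIPC (hB.trans hC) (.inl (.inl (.inl rfl)))⟩
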